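/- Let (u_p)_{p>1} be a family of low energy nodal solutions of (P_p), and suppose ξ_p ∈ H¹₀(Ω) satisfies ‖ξ_p‖_∞ = 1 and −Δξ_p = p|u_p|^{p−1}ξ_p in Ω. Define ξ_{i,p}(z) := ξ_p(ε_{i,p} z + x_{i,p}) for i = 1,2. Then, up to a subsequence, there exist constants a_i, b_{i1}, b_{i2} ∈ ℝ such that ξ_{i,p}(z) = a_i (8 − |z|²)/(8 + |z|²) + Σ_{j=1}^2 b_{ij} z_j/(8 + |z|²) + o(1) in C²_loc(ℝ²) as p → ∞. -/

import Mathlib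

open Real MeasureTheory Metric Filter Topology Bornology

noncomputable section

abbrev E2 : Type := EuclideanSpace ℝ (Fin 2)

/-- Laplacian of `u : ℝ² → ℝ` via coordinate second derivatives. -/
def lap (u : E2 → ℝ) (x : E2) : ℝ :=
  ∑ i : Fin 2,
    fderiv ℝ (fun y => fderiv ℝ u y (EuclideanSpace.single i 1)) x (EuclideanSpace.single i 1)

/-- `u` is a (classical) solution of the Lane–Emden problem `(P_p)` on `Ω`. -/
def IsSolution (Ω : Set E2) (p : ℝ) (u : E2 → ℝ) : Prop :=
  ContDiffOn ℝ 2 u Ω ∧ ContinuousOn u (closure Ω) ∧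
    (∀ x ∈ Ω, -lap u x = |u x| ^ (p - 1) * u x) ∧
    (∀ x ∈ frontier Ω, u x = 0)

/-- `u` is a nodal (sign-changing) function on `Ω`. -/
def IsNodal (Ω : Set E2) (u : E2 → ℝ) : Prop :=
  (∃ x ∈ Ω, 0 < u x) ∧ (∃ x ∈ Ω, u x < 0)

/-- The Green function of `-Δ` on `Ω` with Dirichlet boundary conditions, together with
its regular part `H`, so that `G(x,y) = -(1/2π) log|x-y| + H(x,y)`. -/
structure GreenData (Ω : Set E2) where
  G : E2 → E2 → ℝ
  H : E2 → E2 → ℝ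
  decomp : ∀ x y, G x y = -(1 / (2 * π)) * Real.log ‖x - y‖ + H x y
  bdry : ∀ x ∈ Ω, ∀ y ∈ frontier Ω, G x y = 0
  symm : ∀ x y, G x y = G y x
  smoothH : ContDiffOn ℝ (⊤ : ℕ∞) (fun q : E2 × E2 => H q.1 q.2) (Ω ×ˢ Ω)
  contH : ∀ x ∈ Ω, ContinuousOn (H x) (closure Ω)
  harmH : ∀ x ∈ Ω, ∀ y ∈ Ω, lap (H x) y = 0

/-- The Kirchhoff–Routh type function `Ψ(a₁,a₂) = 2G(a₁,a₂) − R(a₁) − R(a₂)`. -/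
def KR {Ω : Set E2} (gd : GreenData Ω) (q : E2 × E2) : ℝ :=
  2 * gd.G q.1 q.2 - gd.H q.1 q.1 - gd.H q.2 q.2

/-- `q` is a non-degenerate critical point of `F`. -/
def NondegCrit (F : E2 × E2 → ℝ) (q : E2 × E2) : Prop :=
  fderiv ℝ F q = 0 ∧
    ∀ v : E2 × E2, (∀ w : E2 × E2, fderiv ℝ (fun r => fderiv ℝ F r) q v w = 0) → v = 0

/-- Convergence in `C²_loc(S)`: uniform convergence of all derivatives of order `≤ 2`
on compact subsets of `S`. -/
def TendstoC2LocOn (S : Set E2) (F : ℕ → E2 → ℝ) (g : E2 → ℝ) : Prop :=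
  ∀ K : Set E2, K ⊆ S → IsCompact K → ∀ k : ℕ, k ≤ 2 →
    TendstoUniformlyOn (fun n x => iteratedFDeriv ℝ k (F n) x)
      (fun x => iteratedFDeriv ℝ k g x) atTop K

/-- `‖u⁺‖_∞` on `closure Ω`. -/
def supPos (Ω : Set E2) (u : E2 → ℝ) : ℝ := sSup ((fun x => max (u x) 0) '' closure Ω)

/-- `‖u⁻‖_∞` on `closure Ω`. -/
def supNeg (Ω : Set E2) (u : E2 → ℝ) : ℝ := sSup ((fun x => max (-u x) 0) '' closure Ω)

/-- The energy functional `J_p`. -/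
def energy (Ω : Set E2) (p : ℝ) (u : E2 → ℝ) : ℝ :=
  (1 / 2) * (∫ x in Ω, ‖fderiv ℝ u x‖ ^ 2) - (1 / (p + 1)) * ∫ x in Ω, |u x| ^ (p + 1)

/-- The standard bubble `U(z) = −2 log(1 + |z|²/8)`. -/
def Ustd (z : E2) : ℝ := -2 * Real.log (1 + ‖z‖ ^ 2 / 8)

/-- Unit vector at angle `θ`. -/
def circDir (θ : ℝ) : E2 :=
  EuclideanSpace.single 0 (Real.cos θ) + EuclideanSpace.single 1 (Real.sin θ)

/-- Surface integral over the circle `∂B_r(c)`; the integrand may depend on the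
outer unit normal (first argument) and on the point (second argument). -/
def surfInt (c : E2) (r : ℝ) (F : E2 → E2 → ℝ) : ℝ :=
  ∫ θ in (0:ℝ)..(2 * π), r * F (circDir θ) (c + r • circDir θ)

/-- Inner product of gradients `⟨∇f, ∇g⟩`. -/
def gradInner (f g : E2 → ℝ) (x : E2) : ℝ :=
  ∑ j : Fin 2, fderiv ℝ f x (EuclideanSpace.single j 1) *
    fderiv ℝ g x (EuclideanSpace.single j 1)

/-- The quadratic form `P_i` (centred at `c`, radius `r`). -/
def Pform (c : E2) (r : ℝ) (f g : E2 → ℝ) : ℝ :=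
  -2 * r * surfInt c r (fun ν x => fderiv ℝ f x ν * fderiv ℝ g x ν) +
    r * surfInt c r (fun _ x => gradInner f g x)

/-- The quadratic form `Q_{ij}` (centred at `c`, radius `r`). -/
def Qform (c : E2) (r : ℝ) (j : Fin 2) (f g : E2 → ℝ) : ℝ :=
  surfInt c r (fun ν x =>
    -(fderiv ℝ f x (EuclideanSpace.single j 1)) * fderiv ℝ g x ν -
      fderiv ℝ f x ν * fderiv ℝ g x (EuclideanSpace.single j 1) +
      gradInner f g x * ν j)


lemma hasFDerivAt_param {H : Type*} [NormedAddCommGroup H] [NormedSpace ℝ H] [ProperSpace H]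
    {F : H → ℝ → ℝ} {F' : H → ℝ → H →L[ℝ] ℝ}
    (hF : Continuous (Function.uncurry F)) (hF' : Continuous (Function.uncurry F'))
    (hd : ∀ x t, HasFDerivAt (fun y => F y t) (F' x t) x) (a b : ℝ) (x : H) :
    HasFDerivAt (fun x => ∫ t in a..b, F x t) (∫ t in a..b, F' x t) x := by
  have hK : IsCompact (closedBall x 1 ×ˢ Set.uIcc a b) :=
    (isCompact_closedBall x 1).prod isCompact_uIcc
  obtain ⟨C, hC⟩ := hK.exists_bound_of_continuousOn hF'.continuousOn
  have hFx : ∀ y, Continuous (F y) := fun y => hF.comp (by fun_prop : Continuous fun t => (y, t))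
  have hFx' : Continuous (F' x) := hF'.comp (by fun_prop : Continuous fun t => (x, t))
  refine (intervalIntegral.hasFDerivAt_integral_of_dominated_of_fderiv_le (μ := volume)
    (s := ball x 1) (bound := fun _ => C) (F' := F') (ball_mem_nhds x one_pos) ?_ ?_ ?_ ?_ ?_ ?_)
  · exact Eventually.of_forall fun y => (hFx y).aestronglyMeasurable
  · exact (hFx x).intervalIntegrable _ _
  · exact hFx'.aestronglyMeasurable
  · refine Eventually.of_forall fun t ht y hy => ?_
    exact hC (y, t) ⟨ball_subset_closedBall hy, Set.uIoc_subset_uIcc ht⟩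
  · exact intervalIntegrable_const
  · exact Eventually.of_forall fun t ht y hy => hd y t

lemma hasDerivAt_param {F F' : ℝ → ℝ → ℝ}
    (hF : Continuous (Function.uncurry F)) (hF' : Continuous (Function.uncurry F'))
    (hd : ∀ x t, HasDerivAt (fun y => F y t) (F' x t) x) (a b : ℝ) (x : ℝ) :
    HasDerivAt (fun x => ∫ t in a..b, F x t) (∫ t in a..b, F' x t) x := by
  have hK : IsCompact (closedBall x 1 ×ˢ Set.uIcc a b) :=
    (isCompact_closedBall x 1).prod isCompact_uIcc
  obtain ⟨C, hC⟩ := hK.exists_bound_of_continuousOn hF'.continuousOn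
  have hFx : ∀ y, Continuous (F y) := fun y => hF.comp (by fun_prop : Continuous fun t => (y, t))
  have hFx' : Continuous (F' x) := hF'.comp (by fun_prop : Continuous fun t => (x, t))
  refine (intervalIntegral.hasDerivAt_integral_of_dominated_loc_of_deriv_le (μ := volume)
    (s := ball x 1) (bound := fun _ => C) (F' := F') (ball_mem_nhds x one_pos) ?_ ?_ ?_ ?_ ?_ ?_).2
  · exact Eventually.of_forall fun y => (hFx y).aestronglyMeasurable
  · exact (hFx x).intervalIntegrable _ _
  · exact hFx'.aestronglyMeasurable
  · refine Eventually.of_forall fun t ht y hy => ?_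
    exact hC (y, t) ⟨ball_subset_closedBall hy, Set.uIoc_subset_uIcc ht⟩
  · exact intervalIntegrable_const
  · exact Eventually.of_forall fun t ht y hy => hd y t

/-- partial derivative -/
def pd (i : Fin 2) (f : E2 → ℝ) : E2 → ℝ :=
  fun y => fderiv ℝ f y (EuclideanSpace.single i 1)

lemma lap_eq (u : E2 → ℝ) (x : E2) : lap u x = pd 0 (pd 0 u) x + pd 1 (pd 1 u) x := by
  simp only [lap, Fin.sum_univ_two]; rfl

lemma clm_coord (L : E2 →L[ℝ] ℝ) (v : E2) :
    L v = v 0 * L (EuclideanSpace.single 0 1) + v 1 * L (EuclideanSpace.single 1 1) := by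
  have : v = v 0 • EuclideanSpace.single 0 (1:ℝ) + v 1 • EuclideanSpace.single 1 (1:ℝ) := by
    ext i; fin_cases i <;> simp
  conv_lhs => rw [this]
  simp

lemma fderiv_coord (f : E2 → ℝ) (x v : E2) : fderiv ℝ f x v = v 0 * pd 0 f x + v 1 * pd 1 f x :=
  clm_coord _ v

lemma pd_contDiff {n : ℕ} {f : E2 → ℝ} (hf : ContDiff ℝ (n + 1) f) (i : Fin 2) :
    ContDiff ℝ n (pd i f) := by
  have := hf.fderiv_right (m := n) (by norm_cast)
  exact this.clm_apply contDiff_const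

lemma pd_continuous {f : E2 → ℝ} (hf : ContDiff ℝ 1 f) (i : Fin 2) : Continuous (pd i f) :=
  (pd_contDiff (n := 0) (by simpa using hf) i).continuous

lemma pd_contDiff1 {f : E2 → ℝ} (hf : ContDiff ℝ 2 f) (i : Fin 2) : ContDiff ℝ 1 (pd i f) := by
  exact_mod_cast pd_contDiff (n := 1) (by exact_mod_cast hf) i

lemma lap_continuous {f : E2 → ℝ} (hf : ContDiff ℝ 2 f) : Continuous (lap f) := by
  have h0 := pd_continuous (pd_contDiff1 hf 0) 0
  have h1 := pd_continuous (pd_contDiff1 hf 1) 1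
  have : lap f = fun x => pd 0 (pd 0 f) x + pd 1 (pd 1 f) x := funext (lap_eq f)
  rw [this]; fun_prop

/-- unit direction -/
def ev (θ : ℝ) : E2 := !₂[cos θ, sin θ]

@[simp] lemma ev_zero (θ : ℝ) : ev θ 0 = cos θ := by simp [ev]
@[simp] lemma ev_one (θ : ℝ) : ev θ 1 = sin θ := by simp [ev]

lemma continuous_ev : Continuous ev := by
  unfold ev
  fun_prop

lemma norm_ev (θ : ℝ) : ‖ev θ‖ = 1 := by
  rw [EuclideanSpace.norm_eq]; simp

lemma ev_eq (θ : ℝ) : ev θ = cos θ • EuclideanSpace.single 0 (1:ℝ) + sin θ • EuclideanSpace.single 1 (1:ℝ) := by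
  ext i; fin_cases i <;> simp

lemma ev_pi : ev (-π) = ev π := by
  ext i; fin_cases i <;> simp

lemma hasDerivAt_ray {f : E2 → ℝ} (hf : Differentiable ℝ f) (c : E2) (r θ : ℝ) :
    HasDerivAt (fun s => f (c + s • ev θ))
      (cos θ * pd 0 f (c + r • ev θ) + sin θ * pd 1 f (c + r • ev θ)) r := by
  have h1 : HasDerivAt (fun s : ℝ => c + s • ev θ) (ev θ) r := by
    simpa using ((hasDerivAt_id r).smul_const (ev θ)).const_add c
  have := (hf (c + r • ev θ)).hasFDerivAt.comp_hasDerivAt r h1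
  rw [fderiv_coord] at this
  simp only [ev_zero, ev_one] at this
  exact this

lemma hasDerivAt_arc {f : E2 → ℝ} (hf : Differentiable ℝ f) (c : E2) (r θ : ℝ) :
    HasDerivAt (fun t => f (c + r • ev t))
      (r * (-sin θ * pd 0 f (c + r • ev θ) + cos θ * pd 1 f (c + r • ev θ))) θ := by
  have h0 : HasDerivAt ev (-sin θ • EuclideanSpace.single 0 (1:ℝ) + cos θ • EuclideanSpace.single 1 (1:ℝ)) θ := by
    have : ev = fun θ => cos θ • EuclideanSpace.single 0 (1:ℝ) + sin θ • EuclideanSpace.single 1 (1:ℝ) := funext ev_eq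
    rw [this]
    exact ((hasDerivAt_cos θ).smul_const _).add ((hasDerivAt_sin θ).smul_const _)
  have h1 := (h0.const_smul r).const_add c
  have := (hf (c + r • ev θ)).hasFDerivAt.comp_hasDerivAt θ h1
  rw [fderiv_coord] at this
  refine HasDerivAt.congr_deriv this ?_
  simp
  ring

/-- polar engine -/
lemma polar_engine {u : E2 → ℝ} (hu : ContDiff ℝ 2 u) (c : E2) {m m' : ℝ → ℝ} {κ : ℝ}
    (hm : ∀ θ, HasDerivAt m (m' θ) θ) (hm' : ∀ θ, HasDerivAt m' (-κ * m θ) θ)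
    (hp : m (-π) = m π) (hp' : m' (-π) = m' π) (r : ℝ) (hr : r ≠ 0) :
    HasDerivAt (fun r => ∫ θ in (-π)..π, u (c + r • ev θ) * m θ)
      (∫ θ in (-π)..π, (cos θ * pd 0 u (c + r • ev θ) + sin θ * pd 1 u (c + r • ev θ)) * m θ) r ∧
    HasDerivAt (fun r => r * ∫ θ in (-π)..π, (cos θ * pd 0 u (c + r • ev θ) + sin θ * pd 1 u (c + r • ev θ)) * m θ)
      (r * (∫ θ in (-π)..π, lap u (c + r • ev θ) * m θ) +
        κ * (∫ θ in (-π)..π, u (c + r • ev θ) * m θ) / r) r := by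
  have ce := continuous_ev
  have cm : Continuous m := continuous_iff_continuousAt.2 fun θ => (hm θ).continuousAt
  have cm' : Continuous m' := continuous_iff_continuousAt.2 fun θ => (hm' θ).continuousAt
  have cu := hu.continuous
  have h0 := pd_contDiff1 hu 0
  have h1 := pd_contDiff1 hu 1
  have d : Differentiable ℝ u := hu.differentiable (by norm_num)
  have d0 := h0.differentiable (by norm_num)
  have d1 := h1.differentiable (by norm_num)
  have c0 := h0.continuous
  have c1 := h1.continuous
  have c00 := pd_continuous h0 0
  have c01 := pd_continuous h0 1
  have c10 := pd_continuous h1 0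
  have c11 := pd_continuous h1 1
  have cl := lap_continuous hu
  constructor
  · refine hasDerivAt_param (F := fun r θ => u (c + r • ev θ) * m θ)
      (F' := fun r θ => (cos θ * pd 0 u (c + r • ev θ) + sin θ * pd 1 u (c + r • ev θ)) * m θ) ?_ ?_ ?_ _ _ r
    · simp only [Function.uncurry_def]; fun_prop
    · simp only [Function.uncurry_def]; fun_prop
    · intro r θ; exact (hasDerivAt_ray d c r θ).mul_const _
  · have key : HasDerivAt (fun r => ∫ θ in (-π)..π, (r * (cos θ * pd 0 u (c + r • ev θ) + sin θ * pd 1 u (c + r • ev θ))) * m θ)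
       (∫ θ in (-π)..π, ((cos θ * pd 0 u (c + r • ev θ) + sin θ * pd 1 u (c + r • ev θ)) +
          r * (cos θ * (cos θ * pd 0 (pd 0 u) (c + r • ev θ) + sin θ * pd 1 (pd 0 u) (c + r • ev θ)) +
            sin θ * (cos θ * pd 0 (pd 1 u) (c + r • ev θ) + sin θ * pd 1 (pd 1 u) (c + r • ev θ)))) * m θ) r := by
      refine hasDerivAt_param (F := fun r θ => (r * (cos θ * pd 0 u (c + r • ev θ) + sin θ * pd 1 u (c + r • ev θ))) * m θ)
        (F' := fun r θ => ((cos θ * pd 0 u (c + r • ev θ) + sin θ * pd 1 u (c + r • ev θ)) +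
          r * (cos θ * (cos θ * pd 0 (pd 0 u) (c + r • ev θ) + sin θ * pd 1 (pd 0 u) (c + r • ev θ)) +
            sin θ * (cos θ * pd 0 (pd 1 u) (c + r • ev θ) + sin θ * pd 1 (pd 1 u) (c + r • ev θ)))) * m θ) ?_ ?_ ?_ _ _ r
      · simp only [Function.uncurry_def]; fun_prop
      · simp only [Function.uncurry_def]; fun_prop
      · intro r θ
        have := (hasDerivAt_id r).mul (((hasDerivAt_ray d0 c r θ).const_mul (cos θ)).add
          ((hasDerivAt_ray d1 c r θ).const_mul (sin θ)))
        simpa using this.mul_const (m θ)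
    have hT : ∀ θ, HasDerivAt (fun θ => -sin θ * pd 0 u (c + r • ev θ) + cos θ * pd 1 u (c + r • ev θ))
        (-cos θ * pd 0 u (c + r • ev θ) - sin θ * pd 1 u (c + r • ev θ) +
         r * (-sin θ * (-sin θ * pd 0 (pd 0 u) (c + r • ev θ) + cos θ * pd 1 (pd 0 u) (c + r • ev θ)) +
            cos θ * (-sin θ * pd 0 (pd 1 u) (c + r • ev θ) + cos θ * pd 1 (pd 1 u) (c + r • ev θ)))) θ := by
      intro θ
      have := (((hasDerivAt_sin θ).neg).mul (hasDerivAt_arc d0 c r θ)).add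
        ((hasDerivAt_cos θ).mul (hasDerivAt_arc d1 c r θ))
      refine this.congr_deriv ?_
      simp only [Pi.neg_apply]
      ring
    have i1 := intervalIntegral.integral_mul_deriv_eq_deriv_mul (a := -π) (b := π)
      (fun θ _ => hm θ) (fun θ _ => hT θ) (cm'.intervalIntegrable _ _)
      (Continuous.intervalIntegrable (by fun_prop) _ _)
    have i2 := intervalIntegral.integral_mul_deriv_eq_deriv_mul (a := -π) (b := π)
      (fun θ _ => hm' θ) (fun θ _ => hasDerivAt_arc d c r θ) (Continuous.intervalIntegrable (by fun_prop) _ _)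
      (Continuous.intervalIntegrable (by fun_prop) _ _)
    rw [hp, ev_pi, hp'] at *
    simp only [sin_neg, cos_neg, sin_pi, neg_zero, sub_self, zero_sub] at i1 i2
    have e1 : (fun r => r * ∫ θ in (-π)..π, (cos θ * pd 0 u (c + r • ev θ) + sin θ * pd 1 u (c + r • ev θ)) * m θ)
      = fun r => ∫ θ in (-π)..π, (r * (cos θ * pd 0 u (c + r • ev θ) + sin θ * pd 1 u (c + r • ev θ))) * m θ := by
      funext r
      rw [← intervalIntegral.integral_const_mul]
      congr 1; funext θ; ring
    rw [e1]
    refine key.congr_deriv ?_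
    have e2 : (∫ θ in (-π)..π, u (c + r • ev θ) * m θ) * κ = r * ∫ θ in (-π)..π, m' θ * (-sin θ * pd 0 u (c + r • ev θ) + cos θ * pd 1 u (c + r • ev θ)) := by
      rw [← intervalIntegral.integral_const_mul, ← intervalIntegral.integral_mul_const]
      calc _ = - ∫ θ in (-π)..π, -κ * m θ * u (c + r • ev θ) := by
            rw [← intervalIntegral.integral_neg]; congr 1; funext θ; ring
        _ = _ := by rw [← i2]; congr 1; funext θ; ring
    have e3 : κ * (∫ θ in (-π)..π, u (c + r • ev θ) * m θ) / r = ∫ θ in (-π)..π, m' θ * (-sin θ * pd 0 u (c + r • ev θ) + cos θ * pd 1 u (c + r • ev θ)) := by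
      rw [mul_comm κ, e2]; field_simp
    rw [e3, ← neg_neg (∫ θ in (-π)..π, m' θ * (-sin θ * pd 0 u (c + r • ev θ) + cos θ * pd 1 u (c + r • ev θ))), ← i1]
    rw [← intervalIntegral.integral_const_mul, ← intervalIntegral.integral_neg,
      ← intervalIntegral.integral_add (Continuous.intervalIntegrable (by fun_prop) _ _) (Continuous.intervalIntegrable (by fun_prop) _ _)]
    congr 1; funext θ
    rw [lap_eq]
    have := sin_sq_add_cos_sq θ
    linear_combination (r * m θ * (pd 0 (pd 0 u) (c + r • ev θ) + pd 1 (pd 1 u) (c + r • ev θ))) * this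

lemma pd_congr {f g : E2 → ℝ} {U : Set E2} (hU : IsOpen U) (h : Set.EqOn f g U) (i : Fin 2) :
    Set.EqOn (pd i f) (pd i g) U := by
  intro x hx
  have : f =ᶠ[𝓝 x] g := h.eventuallyEq_of_mem (hU.mem_nhds hx)
  simp only [pd]; rw [this.fderiv_eq]

lemma lap_congr {f g : E2 → ℝ} {U : Set E2} (hU : IsOpen U) (h : Set.EqOn f g U) :
    Set.EqOn (lap f) (lap g) U := by
  intro x hx
  rw [lap_eq, lap_eq, pd_congr hU (pd_congr hU h 0) 0 hx, pd_congr hU (pd_congr hU h 1) 1 hx]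

lemma ext_ball {n : ℕ} {u : E2 → ℝ} {c : E2} {R R' : ℝ} (hR : 0 ≤ R) (hRR : R < R')
    (hu : ContDiffOn ℝ n u (ball c R')) :
    ∃ v : E2 → ℝ, ContDiff ℝ n v ∧ ∃ S, R < S ∧ S < R' ∧ Set.EqOn v u (ball c S) := by
  let φ : ContDiffBump c := ⟨(2 * R + R') / 3, (R + 2 * R') / 3, by linarith, by linarith⟩
  refine ⟨fun x => φ x * u x, ?_, (2 * R + R') / 3, by linarith, by linarith, ?_⟩
  · rw [contDiff_iff_contDiffAt]
    intro x
    by_cases hx : x ∈ ball c R'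
    · exact φ.contDiff.contDiffAt.mul (hu.contDiffAt (isOpen_ball.mem_nhds hx))
    · have : (fun x => φ x * u x) =ᶠ[𝓝 x] fun _ => 0 := by
        have hxo : x ∈ (closedBall c ((R + 2 * R') / 3))ᶜ := by
          simp only [mem_ball, not_lt, Set.mem_compl_iff, mem_closedBall, not_le] at *
          linarith
        filter_upwards [isClosed_closedBall.isOpen_compl.mem_nhds hxo] with y hy
        have : φ y = 0 := by
          apply φ.zero_of_le_dist
          simp only [Set.mem_compl_iff, mem_closedBall, not_le] at hy
          exact hy.le
        simp [this]
      exact contDiffAt_const.congr_of_eventuallyEq this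
  · intro x hx
    have : φ x = 1 := φ.one_of_mem_closedBall (ball_subset_closedBall hx)
    simp [this]

/-- circle average -/
def cav (c : E2) (r : ℝ) (f : E2 → ℝ) : ℝ := (∫ θ in (-π)..π, f (c + r • ev θ)) / (2 * π)

lemma ray_mem_closedBall (c : E2) {r R : ℝ} (hr : 0 ≤ r) (hR : r ≤ R) (θ : ℝ) :
    c + r • ev θ ∈ closedBall c R := by
  simp [norm_smul, norm_ev, abs_of_nonneg hr, hR]

lemma ray_mem_ball (c : E2) {r R : ℝ} (hr : 0 ≤ r) (hR : r < R) (θ : ℝ) :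
    c + r • ev θ ∈ ball c R := by
  simp [norm_smul, norm_ev, abs_of_nonneg hr, hR]

lemma cav_congr {f g : E2 → ℝ} {c : E2} {r : ℝ} (hr : 0 ≤ r) (h : Set.EqOn f g (closedBall c r)) :
    cav c r f = cav c r g := by
  unfold cav; congr 2; funext θ; exact h (ray_mem_closedBall c hr le_rfl θ)

lemma cav_neg (c : E2) (r : ℝ) (f : E2 → ℝ) : cav c r (fun x => - f x) = - cav c r f := by
  unfold cav; rw [intervalIntegral.integral_neg, neg_div]

lemma cav_mono {f g : E2 → ℝ} {c : E2} {r : ℝ} (hr : 0 ≤ r)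
    (hf : ContinuousOn f (closedBall c r)) (hg : ContinuousOn g (closedBall c r))
    (h : ∀ x ∈ closedBall c r, f x ≤ g x) : cav c r f ≤ cav c r g := by
  unfold cav
  have ce := continuous_ev
  refine div_le_div_of_nonneg_right ?_ (by positivity)
  refine intervalIntegral.integral_mono_on (by linarith [pi_pos]) ?_ ?_ ?_
  · exact (hf.comp_continuous (by fun_prop) (fun θ => ray_mem_closedBall c hr le_rfl θ)).intervalIntegrable _ _
  · exact (hg.comp_continuous (by fun_prop) (fun θ => ray_mem_closedBall c hr le_rfl θ)).intervalIntegrable _ _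
  · intro θ _; exact h _ (ray_mem_closedBall c hr le_rfl θ)

lemma cav_const (c : E2) (r k : ℝ) : cav c r (fun _ => k) = k := by
  unfold cav; simp; field_simp; ring

lemma mean_ineq_global {u : E2 → ℝ} (hu : ContDiff ℝ 2 u) (c : E2) {R Λ : ℝ} (hR : 0 ≤ R)
    (hl : ∀ x ∈ closedBall c R, -Λ ≤ lap u x) :
    u c ≤ cav c R u + Λ * R ^ 2 / 4 := by
  have ce := continuous_ev
  have cu := hu.continuous
  have c0 := (pd_contDiff1 hu 0).continuous
  have c1 := (pd_contDiff1 hu 1).continuous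
  have cl := lap_continuous hu
  have eng := fun r hr => polar_engine hu c (m := fun _ => 1) (m' := fun _ => 0) (κ := 0)
    (fun θ => hasDerivAt_const _ _) (fun θ => by simpa using hasDerivAt_const _ _) rfl rfl r hr
  simp only [mul_one, zero_mul, zero_div, add_zero] at eng
  set a : ℝ → ℝ := fun r => ∫ θ in (-π)..π, u (c + r • ev θ) with ha
  set b : ℝ → ℝ := fun r => ∫ θ in (-π)..π, (cos θ * pd 0 u (c + r • ev θ) + sin θ * pd 1 u (c + r • ev θ)) with hb
  have ca : Continuous a := by
    apply intervalIntegral.continuous_parametric_intervalIntegral_of_continuous'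
    simp only [Function.uncurry_def]; fun_prop
  have cb : Continuous b := by
    apply intervalIntegral.continuous_parametric_intervalIntegral_of_continuous'
    simp only [Function.uncurry_def]; fun_prop
  have hΦ : MonotoneOn (fun r => r * b r + π * Λ * r ^ 2) (Set.Icc 0 R) := by
    apply monotoneOn_of_hasDerivWithinAt_nonneg (convex_Icc 0 R) (f' := fun r => r * (∫ θ in (-π)..π, lap u (c + r • ev θ)) + 2 * π * Λ * r)
    · fun_prop
    · intro r hr
      rw [interior_Icc] at hr
      have := (eng r hr.1.ne').2.add (((hasDerivAt_id r).pow 2).const_mul (π * Λ))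
      refine (this.congr_deriv ?_).hasDerivWithinAt
      simp; ring
    · intro r hr
      rw [interior_Icc] at hr
      have : -(2 * π * Λ) ≤ ∫ θ in (-π)..π, lap u (c + r • ev θ) := by
        have := intervalIntegral.integral_mono_on (μ := volume) (a := -π) (b := π) (by linarith [pi_pos]) (f := fun _ => -Λ) (g := fun θ => lap u (c + r • ev θ))
          (Continuous.intervalIntegrable (by fun_prop) _ _) (Continuous.intervalIntegrable (by fun_prop) _ _)
          (fun θ _ => hl _ (ray_mem_closedBall c hr.1.le hr.2.le θ))
        simp at this; linarith
      nlinarith [hr.1]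
  have hA : MonotoneOn (fun r => a r + π * Λ * r ^ 2 / 2) (Set.Icc 0 R) := by
    apply monotoneOn_of_hasDerivWithinAt_nonneg (convex_Icc 0 R) (f' := fun r => b r + π * Λ * r)
    · fun_prop
    · intro r hr
      rw [interior_Icc] at hr
      have := (eng r hr.1.ne').1.add ((((hasDerivAt_id r).pow 2).const_mul (π * Λ)).div_const 2)
      refine (this.congr_deriv ?_).hasDerivWithinAt
      simp; ring
    · intro r hr
      rw [interior_Icc] at hr
      have := hΦ ⟨le_rfl, hR⟩ ⟨hr.1.le, hr.2.le⟩ hr.1.le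
      simp at this
      have h2 : 0 ≤ r * (b r + π * Λ * r) := by nlinarith
      exact nonneg_of_mul_nonneg_right h2 hr.1
  have := hA ⟨le_rfl, hR⟩ ⟨hR, le_rfl⟩ hR
  have ha0 : a 0 = 2 * π * u c := by
    simp only [ha, zero_smul, add_zero, intervalIntegral.integral_const, smul_eq_mul]; ring
  simp only [ha0] at this
  have h3 : cav c R u = a R / (2 * π) := rfl
  rw [h3]
  have hp := pi_pos
  have : u c * (2 * π) ≤ (a R / (2 * π) + Λ * R ^ 2 / 4) * (2 * π) := by
    have : a R / (2 * π) * (2 * π) = a R := by field_simp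
    nlinarith
  exact le_of_mul_le_mul_right this (by positivity)

lemma mean_ineq {u : E2 → ℝ} {c : E2} {R R' Λ : ℝ} (hu : ContDiffOn ℝ 2 u (ball c R')) (hR : 0 ≤ R)
    (hRR : R < R') (hl : ∀ x ∈ closedBall c R, -Λ ≤ lap u x) :
    u c ≤ cav c R u + Λ * R ^ 2 / 4 := by
  obtain ⟨v, hv, S, hS, hS', he⟩ := ext_ball (n := 2) hR hRR (by exact_mod_cast hu)
  have hsub : closedBall c R ⊆ ball c S := closedBall_subset_ball hS
  have := mean_ineq_global (Λ := Λ) (by exact_mod_cast hv) c hR (fun x hx => by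
    rw [lap_congr isOpen_ball he (hsub hx)]; exact hl x hx)
  rw [cav_congr hR (he.mono hsub), he (hsub (mem_closedBall_self hR))] at this
  exact this

lemma pd_neg (i : Fin 2) (u : E2 → ℝ) : pd i (fun x => - u x) = fun x => - pd i u x := by
  funext x; simp [pd, fderiv_fun_neg]

lemma lap_neg (u : E2 → ℝ) (x : E2) : lap (fun x => - u x) x = - lap u x := by
  rw [lap_eq, lap_eq]; simp only [pd_neg]; ring

lemma mean_ineq_upper {u : E2 → ℝ} {c : E2} {R R' Λ : ℝ} (hu : ContDiffOn ℝ 2 u (ball c R')) (hR : 0 ≤ R)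
    (hRR : R < R') (hl : ∀ x ∈ closedBall c R, lap u x ≤ Λ) :
    cav c R u ≤ u c + Λ * R ^ 2 / 4 := by
  have := mean_ineq (u := fun x => - u x) (Λ := Λ) hu.neg hR hRR (fun x hx => by
    rw [lap_neg]; linarith [hl x hx])
  rw [cav_neg] at this
  linarith

/-- gradient representation operator -/
def TR (i : Fin 2) (R : ℝ) (f h : E2 → ℝ) (c : E2) : ℝ :=
  (1 / (2 * π)) * ∫ r in (0:ℝ)..R, ∫ θ in (-π)..π,
    (8 * r ^ 2 / R ^ 4 * f (c + r • ev θ) + (1 - r ^ 2 / R ^ 2) ^ 2 * h (c + r • ev θ)) * ev θ i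

lemma grad_formula_aux {u : E2 → ℝ} (hu : ContDiff ℝ 2 u) (c : E2) {R : ℝ} (hR : 0 < R)
    {m m' : ℝ → ℝ} (hm : ∀ θ, HasDerivAt m (m' θ) θ) (hm' : ∀ θ, HasDerivAt m' (-1 * m θ) θ)
    (hp : m (-π) = m π) (hp' : m' (-π) = m' π) (hm0 : ∫ θ in (-π)..π, m θ = 0) :
    2 * (∫ θ in (-π)..π, (cos θ * pd 0 u c + sin θ * pd 1 u c) * m θ) =
    ∫ r in (0:ℝ)..R, ∫ θ in (-π)..π,
    (8 * r ^ 2 / R ^ 4 * u (c + r • ev θ) + (1 - r ^ 2 / R ^ 2) ^ 2 * (- lap u (c + r • ev θ))) * m θ := by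
  have ce := continuous_ev
  have cu := hu.continuous
  have c0 := (pd_contDiff1 hu 0).continuous
  have c1 := (pd_contDiff1 hu 1).continuous
  have cl := lap_continuous hu
  have cm : Continuous m := continuous_iff_continuousAt.2 fun θ => (hm θ).continuousAt
  have eng := fun r hr => polar_engine hu c hm hm' hp hp' r hr
  have hd0 : HasDerivAt (fun r : ℝ => ∫ θ in (-π)..π, u (c + r • ev θ) * m θ)
      (∫ θ in (-π)..π, (cos θ * pd 0 u (c + (0:ℝ) • ev θ) + sin θ * pd 1 u (c + (0:ℝ) • ev θ)) * m θ) 0 := by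
    refine hasDerivAt_param (F := fun r θ => u (c + r • ev θ) * m θ)
      (F' := fun r θ => (cos θ * pd 0 u (c + r • ev θ) + sin θ * pd 1 u (c + r • ev θ)) * m θ) ?_ ?_ ?_ _ _ 0
    · simp only [Function.uncurry_def]; fun_prop
    · simp only [Function.uncurry_def]; fun_prop
    · intro r θ; exact (hasDerivAt_ray (hu.differentiable (by norm_num)) c r θ).mul_const _
  set a : ℝ → ℝ := fun r => ∫ θ in (-π)..π, u (c + r • ev θ) * m θ with ha
  set b : ℝ → ℝ := fun r => ∫ θ in (-π)..π, (cos θ * pd 0 u (c + r • ev θ) + sin θ * pd 1 u (c + r • ev θ)) * m θ with hb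
  set l : ℝ → ℝ := fun r => ∫ θ in (-π)..π, lap u (c + r • ev θ) * m θ with hl
  have ca : Continuous a := by
    apply intervalIntegral.continuous_parametric_intervalIntegral_of_continuous'
    simp only [Function.uncurry_def]; fun_prop
  have cb : Continuous b := by
    apply intervalIntegral.continuous_parametric_intervalIntegral_of_continuous'
    simp only [Function.uncurry_def]; fun_prop
  have cll : Continuous l := by
    apply intervalIntegral.continuous_parametric_intervalIntegral_of_continuous'
    simp only [Function.uncurry_def]; fun_prop
  have ha0 : a 0 = 0 := by simp [ha, hm0]
  have hds : ∀ r, r ≠ 0 → dslope a 0 r = a r / r := by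
    intro r hr; rw [dslope_of_ne _ hr, slope_def_field, ha0]; simp
  have cds : Continuous (dslope a 0) := by
    rw [continuous_iff_continuousAt]; intro r
    by_cases hr : r = 0
    · subst hr; exact continuousAt_dslope_same.2 hd0.differentiableAt
    · exact (continuousAt_dslope_of_ne hr).2 ca.continuousAt
  have ftc := intervalIntegral.integral_eq_sub_of_hasDerivAt_of_le (a := 0) (b := R) hR.le
    (f := fun r => (1 - r ^ 2 / R ^ 2) ^ 2 * b r + (1 + 2 * r ^ 2 / R ^ 2 - 3 * r ^ 4 / R ^ 4) * dslope a 0 r)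
    (f' := fun r => (1 - r ^ 2 / R ^ 2) ^ 2 * l r - 8 * r ^ 2 / R ^ 4 * a r)
    (by fun_prop) ?_ (Continuous.intervalIntegrable (by fun_prop) _ _)
  · have hb0 : b 0 = ∫ θ in (-π)..π, (cos θ * pd 0 u c + sin θ * pd 1 u c) * m θ := by simp [hb]
    have hds0 : dslope a 0 0 = b 0 := by rw [dslope_same]; exact hd0.deriv
    rw [hds0, hds R hR.ne'] at ftc
    have hRR : R ^ 2 / R ^ 2 = 1 := by field_simp
    have hR4 : 1 + 2 * R ^ 2 / R ^ 2 - 3 * R ^ 4 / R ^ 4 = 0 := by field_simp; ring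
    rw [hRR, hR4] at ftc
    rw [← hb0]
    have e : ∀ r, (∫ θ in (-π)..π,
      (8 * r ^ 2 / R ^ 4 * u (c + r • ev θ) + (1 - r ^ 2 / R ^ 2) ^ 2 * (- lap u (c + r • ev θ))) * m θ)
        = - ((1 - r ^ 2 / R ^ 2) ^ 2 * l r - 8 * r ^ 2 / R ^ 4 * a r) := by
      intro r
      simp only [hl, ha]
      rw [← intervalIntegral.integral_const_mul, ← intervalIntegral.integral_const_mul,
        ← intervalIntegral.integral_sub (Continuous.intervalIntegrable (by fun_prop) _ _) (Continuous.intervalIntegrable (by fun_prop) _ _),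
        ← intervalIntegral.integral_neg]
      congr 1; funext θ; ring
    simp only [e]
    rw [intervalIntegral.integral_neg, ftc]
    simp; ring
  · intro r hr
    have hr0 := hr.1.ne'
    obtain ⟨e1, e2⟩ := eng r hr0
    have key : HasDerivAt (fun r => (1 / r - 2 * r / R ^ 2 + r ^ 3 / R ^ 4) * (r * b r) + (1 / r + 2 * r / R ^ 2 - 3 * r ^ 3 / R ^ 4) * a r)
        ((1 - r ^ 2 / R ^ 2) ^ 2 * l r - 8 * r ^ 2 / R ^ 4 * a r) r := by
      have k1 : HasDerivAt (fun r : ℝ => 1 / r - 2 * r / R ^ 2 + r ^ 3 / R ^ 4) (-1 / r ^ 2 - 2 / R ^ 2 + 3 * r ^ 2 / R ^ 4) r := by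
        have := (((hasDerivAt_inv hr0).sub (((hasDerivAt_id r).const_mul 2).div_const (R ^ 2))).add (((hasDerivAt_id r).pow 3).div_const (R ^ 4)))
        simp only [one_div]
        refine this.congr_deriv ?_
        simp; ring
      have k2 : HasDerivAt (fun r : ℝ => 1 / r + 2 * r / R ^ 2 - 3 * r ^ 3 / R ^ 4) (-1 / r ^ 2 + 2 / R ^ 2 - 9 * r ^ 2 / R ^ 4) r := by
        have := (((hasDerivAt_inv hr0).add (((hasDerivAt_id r).const_mul 2).div_const (R ^ 2))).sub ((((hasDerivAt_id r).pow 3).const_mul 3).div_const (R ^ 4)))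
        simp only [one_div]
        refine this.congr_deriv ?_
        simp; ring
      refine ((k1.mul e2).add (k2.mul e1)).congr_deriv ?_
      change (-1 / r ^ 2 - 2 / R ^ 2 + 3 * r ^ 2 / R ^ 4) * (r * b r) + (1 / r - 2 * r / R ^ 2 + r ^ 3 / R ^ 4) * (r * l r + 1 * a r / r) +
        ((-1 / r ^ 2 + 2 / R ^ 2 - 9 * r ^ 2 / R ^ 4) * a r + (1 / r + 2 * r / R ^ 2 - 3 * r ^ 3 / R ^ 4) * b r) = _
      field_simp
      ring
    refine key.congr_of_eventuallyEq ?_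
    filter_upwards [isOpen_ne.mem_nhds hr0] with s hs
    have hs' : s ≠ 0 := hs
    rw [hds s hs']
    field_simp
    ring

lemma grad_formula {u : E2 → ℝ} (hu : ContDiff ℝ 2 u) (c : E2) {R : ℝ} (hR : 0 < R) (i : Fin 2) :
    pd i u c = TR i R u (fun x => - lap u x) c := by
  have hp := pi_pos
  fin_cases i
  · have := grad_formula_aux hu c hR (m := cos) (m' := fun θ => - sin θ) hasDerivAt_cos
      (fun θ => by rw [neg_one_mul]; exact (hasDerivAt_sin θ).neg) (by simp) (by simp) (by simp)
    simp only [TR, Fin.zero_eta, ev_zero]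
    rw [← this]
    have e : ∫ θ in (-π)..π, (cos θ * pd 0 u c + sin θ * pd 1 u c) * cos θ = π * pd 0 u c := by
      have : ∀ θ, (cos θ * pd 0 u c + sin θ * pd 1 u c) * cos θ = cos θ ^ 2 * pd 0 u c + sin θ * cos θ * pd 1 u c := by intro θ; ring
      simp only [this]
      rw [intervalIntegral.integral_add (Continuous.intervalIntegrable (by fun_prop) _ _) (Continuous.intervalIntegrable (by fun_prop) _ _),
        intervalIntegral.integral_mul_const, intervalIntegral.integral_mul_const, integral_cos_sq, integral_sin_mul_cos₁]
      simp
    rw [e]; field_simp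
  · have := grad_formula_aux hu c hR (m := sin) (m' := cos) hasDerivAt_sin
      (fun θ => by simpa using (hasDerivAt_cos θ)) (by simp) (by simp) (by simp)
    simp only [TR, Fin.mk_one, ev_one]
    rw [← this]
    have e : ∫ θ in (-π)..π, (cos θ * pd 0 u c + sin θ * pd 1 u c) * sin θ = π * pd 1 u c := by
      have : ∀ θ, (cos θ * pd 0 u c + sin θ * pd 1 u c) * sin θ = sin θ * cos θ * pd 0 u c + sin θ ^ 2 * pd 1 u c := by intro θ; ring
      simp only [this]
      rw [intervalIntegral.integral_add (Continuous.intervalIntegrable (by fun_prop) _ _) (Continuous.intervalIntegrable (by fun_prop) _ _),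
        intervalIntegral.integral_mul_const, intervalIntegral.integral_mul_const, integral_sin_sq, integral_sin_mul_cos₁]
      simp
    rw [e]; field_simp

lemma integral_E2_polar (f : E2 → ℝ) :
    ∫ y, f y = ∫ q in polarCoord.target, q.1 • f (q.1 • ev q.2) := by
  have h1 := (EuclideanSpace.volume_preserving_symm_measurableEquiv_toLp (Fin 2)).symm
  have h2 := (volume_preserving_finTwoArrow ℝ).symm
  rw [← h1.integral_comp (MeasurableEquiv.measurableEmbedding _), ← h2.integral_comp (MeasurableEquiv.measurableEmbedding _),
    ← integral_comp_polarCoord_symm]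
  congr 1; funext q
  congr 2
  ext i
  fin_cases i <;> simp [polarCoord, ev]

/-- polar coordinates on annuli -/
lemma polar_annulus {g : E2 → ℝ} (hg : Continuous g) (c : E2) {r1 r2 : ℝ} (h0 : 0 ≤ r1) (h : r1 ≤ r2) :
    ∫ y in {y | r1 < dist y c ∧ dist y c < r2}, g y =
      ∫ r in r1..r2, ∫ θ in (-π)..π, r * g (c + r • ev θ) := by
  have ce := continuous_ev
  have hm : MeasurableSet {y : E2 | r1 < dist y c ∧ dist y c < r2} := by measurability
  rw [← integral_indicator hm, ← integral_add_left_eq_self _ c, integral_E2_polar]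
  have e : ∀ q ∈ polarCoord.target, q.1 • (Set.indicator {y : E2 | r1 < dist y c ∧ dist y c < r2} g (c + q.1 • ev q.2))
      = Set.indicator (Set.Ioo r1 r2 ×ˢ Set.Ioo (-π) π) (fun q : ℝ × ℝ => q.1 * g (c + q.1 • ev q.2)) q := by
    intro q hq
    have hq1 : 0 < q.1 := hq.1
    have hq2 := hq.2
    have hd : dist (c + q.1 • ev q.2) c = q.1 := by
      simp [norm_smul, norm_ev, abs_of_pos hq1]
    by_cases hin : r1 < q.1 ∧ q.1 < r2
    · rw [Set.indicator_of_mem, Set.indicator_of_mem]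
      · rfl
      · exact ⟨hin, hq2⟩
      · simpa [Set.mem_setOf_eq, hd] using hin
    · rw [Set.indicator_of_notMem, Set.indicator_of_notMem]
      · simp
      · exact fun hh => hin hh.1
      · simp only [Set.mem_setOf_eq, hd]; exact hin
  rw [setIntegral_congr_fun polarCoord.open_target.measurableSet e,
    setIntegral_indicator (measurableSet_Ioo.prod measurableSet_Ioo)]
  have hs : polarCoord.target ∩ (Set.Ioo r1 r2 ×ˢ Set.Ioo (-π) π) = Set.Ioo r1 r2 ×ˢ Set.Ioo (-π) π := by
    apply Set.inter_eq_right.2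
    rintro ⟨a, b⟩ ⟨ha, hb⟩
    exact ⟨lt_of_le_of_lt h0 ha.1, hb⟩
  rw [hs, Measure.volume_eq_prod, setIntegral_prod]
  · rw [intervalIntegral.integral_of_le h, integral_Ioc_eq_integral_Ioo]
    congr 1; funext r
    rw [intervalIntegral.integral_of_le (by linarith [pi_pos]), integral_Ioc_eq_integral_Ioo]
  · refine IntegrableOn.mono_set (t := Set.Icc r1 r2 ×ˢ Set.Icc (-π) π) ?_ (Set.prod_mono Set.Ioo_subset_Icc_self Set.Ioo_subset_Icc_self)
    exact ContinuousOn.integrableOn_compact (isCompact_Icc.prod isCompact_Icc) (by fun_prop)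

lemma polar_ball {g : E2 → ℝ} (hg : Continuous g) (c : E2) {R : ℝ} (h : 0 ≤ R) :
    ∫ y in ball c R, g y = ∫ r in (0:ℝ)..R, ∫ θ in (-π)..π, r * g (c + r • ev θ) := by
  rw [← polar_annulus hg c le_rfl h]
  apply setIntegral_congr_set
  have : ball c R \ {c} = {y | 0 < dist y c ∧ dist y c < R} := by
    ext y; simp [and_comm]
  rw [← this]
  exact (diff_null_ae_eq_self (measure_singleton c)).symm

lemma cav_int (g : E2 → ℝ) (c : E2) (r : ℝ) :
    ∫ θ in (-π)..π, r * g (c + r • ev θ) = 2 * π * r * cav c r g := by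
  rw [intervalIntegral.integral_const_mul, cav]; field_simp

lemma polar_ball_cav {g : E2 → ℝ} (hg : Continuous g) (c : E2) {R : ℝ} (h : 0 ≤ R) :
    ∫ y in ball c R, g y = ∫ r in (0:ℝ)..R, 2 * π * r * cav c r g := by
  rw [polar_ball hg c h]; simp only [cav_int]

lemma cav_continuous {g : E2 → ℝ} (hg : Continuous g) (c : E2) : Continuous (fun r => cav c r g) := by
  have ce := continuous_ev
  unfold cav
  apply Continuous.div_const
  apply intervalIntegral.continuous_parametric_intervalIntegral_of_continuous'
  simp only [Function.uncurry_def]; fun_prop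

/-- functional with given coordinates -/
def gcl (a b : ℝ) : E2 →L[ℝ] ℝ := a • EuclideanSpace.proj 0 + b • EuclideanSpace.proj 1

lemma gcl_apply (a b : ℝ) (v : E2) : gcl a b v = v 0 * a + v 1 * b := by
  simp [gcl, mul_comm]

lemma fderiv_eq_gcl (f : E2 → ℝ) (x : E2) : fderiv ℝ f x = gcl (pd 0 f x) (pd 1 f x) := by
  ext v; rw [fderiv_coord, gcl_apply]

lemma pd_of_hasFDerivAt {f : E2 → ℝ} {x : E2} {a b : ℝ} (h : HasFDerivAt f (gcl a b) x) :
    pd 0 f x = a ∧ pd 1 f x = b := by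
  simp [pd, h.fderiv, gcl_apply]

lemma gcl_contDiff {n : ℕ} {a b : E2 → ℝ} (ha : ContDiff ℝ n a) (hb : ContDiff ℝ n b) :
    ContDiff ℝ n (fun x => gcl (a x) (b x)) := by
  unfold gcl; fun_prop

lemma contDiff_succ_of_pd {n : ℕ} {f : E2 → ℝ} (hf : Differentiable ℝ f) (h : ∀ i, ContDiff ℝ n (pd i f)) :
    ContDiff ℝ (n + 1) f := by
  rw [contDiff_succ_iff_fderiv]
  refine ⟨hf, by simp, ?_⟩
  have : fderiv ℝ f = fun x => gcl (pd 0 f x) (pd 1 f x) := funext (fderiv_eq_gcl f)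
  rw [this]
  exact gcl_contDiff (h 0) (h 1)

lemma contDiff2_of_pd {f : E2 → ℝ} (hf : ContDiff ℝ 1 f) (h : ∀ i, ContDiff ℝ 1 (pd i f)) :
    ContDiff ℝ 2 f := by
  exact_mod_cast contDiff_succ_of_pd (n := 1) (hf.differentiable (by norm_num)) (by exact_mod_cast h)

lemma contDiff1_of_grad {f g0 g1 : E2 → ℝ} (h0 : Continuous g0) (h1 : Continuous g1)
    (h : ∀ x, HasFDerivAt f (gcl (g0 x) (g1 x)) x) : ContDiff ℝ 1 f ∧ pd 0 f = g0 ∧ pd 1 f = g1 := by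
  have e0 : pd 0 f = g0 := funext fun x => (pd_of_hasFDerivAt (h x)).1
  have e1 : pd 1 f = g1 := funext fun x => (pd_of_hasFDerivAt (h x)).2
  refine ⟨?_, e0, e1⟩
  have := contDiff_succ_of_pd (n := 0) (f := f) (fun x => (h x).differentiableAt) (fun i => by
    fin_cases i
    · simpa [e0] using h0
    · simpa [e1] using h1)
  simpa using this

lemma pd_comm {f : E2 → ℝ} (hf : ContDiff ℝ 2 f) (i j : Fin 2) : pd i (pd j f) = pd j (pd i f) := by
  funext x
  have hs : IsSymmSndFDerivAt ℝ f x := hf.contDiffAt.isSymmSndFDerivAt (by simp)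
  have hd : DifferentiableAt ℝ (fderiv ℝ f) x :=
    (hf.fderiv_right (m := 1) (by norm_num)).differentiable (by norm_num) x
  have e : ∀ i j, pd i (pd j f) x = fderiv ℝ (fderiv ℝ f) x (EuclideanSpace.single i 1) (EuclideanSpace.single j 1) := by
    intro i j
    change fderiv ℝ (fun y => fderiv ℝ f y (EuclideanSpace.single j 1)) x _ = _
    rw [fderiv_clm_apply hd (differentiableAt_const _)]
    simp
  rw [e, e, hs]

/-! TR -/

lemma TR_cont1 (i : Fin 2) (R : ℝ) {f h : E2 → ℝ} (hf : Continuous f) (hh : Continuous h) :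
    Continuous (fun q : (E2 × ℝ) × ℝ => (8 * q.1.2 ^ 2 / R ^ 4 * f (q.1.1 + q.1.2 • ev q.2) + (1 - q.1.2 ^ 2 / R ^ 2) ^ 2 * h (q.1.1 + q.1.2 • ev q.2)) * ev q.2 i) := by
  have ce := continuous_ev
  fun_prop

lemma TR_cont2 (i : Fin 2) (R : ℝ) {f h : E2 → ℝ} (hf : Continuous f) (hh : Continuous h) :
    Continuous (fun q : E2 × ℝ => ∫ θ in (-π)..π, (8 * q.2 ^ 2 / R ^ 4 * f (q.1 + q.2 • ev θ) + (1 - q.2 ^ 2 / R ^ 2) ^ 2 * h (q.1 + q.2 • ev θ)) * ev θ i) := by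
  apply intervalIntegral.continuous_parametric_intervalIntegral_of_continuous'
  exact TR_cont1 i R hf hh

lemma TR_continuous (i : Fin 2) (R : ℝ) {f h : E2 → ℝ} (hf : Continuous f) (hh : Continuous h) :
    Continuous (TR i R f h) := by
  unfold TR
  apply Continuous.const_mul
  apply intervalIntegral.continuous_parametric_intervalIntegral_of_continuous'
  exact TR_cont2 i R hf hh

lemma TR_sub (i : Fin 2) (R : ℝ) {f h f' h' : E2 → ℝ} (hf : Continuous f) (hh : Continuous h)
    (hf' : Continuous f') (hh' : Continuous h') (c : E2) :
    TR i R f h c - TR i R f' h' c = TR i R (fun x => f x - f' x) (fun x => h x - h' x) c := by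
  unfold TR
  rw [← mul_sub, ← intervalIntegral.integral_sub]
  · congr 2; funext r
    rw [← intervalIntegral.integral_sub]
    · congr 1; funext θ; ring
    · exact ((TR_cont1 i R hf hh).comp (by fun_prop : Continuous fun θ : ℝ => ((c, r), θ))).intervalIntegrable _ _
    · exact ((TR_cont1 i R hf' hh').comp (by fun_prop : Continuous fun θ : ℝ => ((c, r), θ))).intervalIntegrable _ _
  · exact ((TR_cont2 i R hf hh).comp (by fun_prop : Continuous fun r : ℝ => (c, r))).intervalIntegrable _ _
  · exact ((TR_cont2 i R hf' hh').comp (by fun_prop : Continuous fun r : ℝ => (c, r))).intervalIntegrable _ _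

lemma abs_ev_le (θ : ℝ) (i : Fin 2) : |ev θ i| ≤ 1 := by
  fin_cases i
  · simpa using abs_cos_le_one θ
  · simpa using abs_sin_le_one θ

lemma TR_congr (i : Fin 2) {R : ℝ} (hR : 0 ≤ R) {f h f' h' : E2 → ℝ} {c : E2}
    (hf : Set.EqOn f f' (closedBall c R)) (hh : Set.EqOn h h' (closedBall c R)) :
    TR i R f h c = TR i R f' h' c := by
  unfold TR
  congr 1
  apply intervalIntegral.integral_congr
  intro r hr
  rw [Set.uIcc_of_le hR] at hr
  simp only
  congr 1; funext θ
  rw [hf (ray_mem_closedBall c hr.1 hr.2 θ), hh (ray_mem_closedBall c hr.1 hr.2 θ)]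

lemma TR_bound (i : Fin 2) {R A B : ℝ} (hR : 0 < R) {f h : E2 → ℝ} {c : E2}
    (hf : ∀ x ∈ closedBall c R, |f x| ≤ A) (hh : ∀ x ∈ closedBall c R, |h x| ≤ B) :
    |TR i R f h c| ≤ 8 * A / R + B * R := by
  have hA : 0 ≤ A := (abs_nonneg _).trans (hf c (mem_closedBall_self hR.le))
  have hB : 0 ≤ B := (abs_nonneg _).trans (hh c (mem_closedBall_self hR.le))
  unfold TR
  have hp := pi_pos
  have key : ‖∫ r in (0:ℝ)..R, ∫ θ in (-π)..π,
    (8 * r ^ 2 / R ^ 4 * f (c + r • ev θ) + (1 - r ^ 2 / R ^ 2) ^ 2 * h (c + r • ev θ)) * ev θ i‖ ≤ ((8 * A / R ^ 2 + B) * |π - (-π)|) * |R - 0| := by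
    apply intervalIntegral.norm_integral_le_of_norm_le_const
    intro r hr
    apply intervalIntegral.norm_integral_le_of_norm_le_const
    intro θ _
    rw [Set.uIoc_of_le hR.le] at hr
    have m := ray_mem_closedBall c hr.1.le hr.2 θ
    have h1 : r ^ 2 / R ^ 2 ≤ 1 := by
      rw [div_le_one (by positivity)]; exact pow_le_pow_left₀ hr.1.le hr.2 2
    have h2 : 0 ≤ r ^ 2 / R ^ 2 := by positivity
    rw [norm_mul, Real.norm_eq_abs, Real.norm_eq_abs]
    calc _ ≤ |8 * r ^ 2 / R ^ 4 * f (c + r • ev θ) + (1 - r ^ 2 / R ^ 2) ^ 2 * h (c + r • ev θ)| * 1 := by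
          gcongr; exact abs_ev_le θ i
      _ ≤ |8 * r ^ 2 / R ^ 4 * f (c + r • ev θ)| + |(1 - r ^ 2 / R ^ 2) ^ 2 * h (c + r • ev θ)| := by
          rw [mul_one]; exact abs_add_le _ _
      _ ≤ 8 * A / R ^ 2 + B := by
          rw [abs_mul, abs_mul]
          apply add_le_add
          · rw [abs_of_nonneg (by positivity)]
            calc 8 * r ^ 2 / R ^ 4 * |f (c + r • ev θ)| ≤ 8 * R ^ 2 / R ^ 4 * A := by
                  gcongr
                  · exact hr.1.le
                  · exact hr.2
                  · exact hf _ m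
              _ = 8 * A / R ^ 2 := by field_simp
          · rw [abs_of_nonneg (by positivity)]
            calc (1 - r ^ 2 / R ^ 2) ^ 2 * |h (c + r • ev θ)| ≤ 1 * B := by
                  gcongr
                  · nlinarith
                  · exact hh _ m
              _ = B := one_mul B
  rw [abs_mul, abs_of_pos (by positivity)]
  rw [Real.norm_eq_abs] at key
  calc 1 / (2 * π) * _ ≤ 1 / (2 * π) * (((8 * A / R ^ 2 + B) * |π - (-π)|) * |R - 0|) := by gcongr
    _ = 8 * A / R + B * R := by
      rw [abs_of_pos (by linarith), abs_of_pos (by linarith)]; field_simp; ring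

lemma TR_hasFDerivAt (i : Fin 2) (R : ℝ) {f h : E2 → ℝ} (hf : ContDiff ℝ 1 f) (hh : ContDiff ℝ 1 h) (c : E2) :
    HasFDerivAt (TR i R f h) (gcl (TR i R (pd 0 f) (pd 0 h) c) (TR i R (pd 1 f) (pd 1 h) c)) c := by
  have ce := continuous_ev
  have cf := hf.continuous
  have ch := hh.continuous
  have cf' : Continuous (fderiv ℝ f) := hf.continuous_fderiv (by norm_num)
  have ch' : Continuous (fderiv ℝ h) := hh.continuous_fderiv (by norm_num)
  -- inner
  have hin : ∀ (r : ℝ) (x : E2), HasFDerivAt (fun y : E2 => ∫ θ in (-π)..π, (8 * r ^ 2 / R ^ 4 * f (y + r • ev θ) + (1 - r ^ 2 / R ^ 2) ^ 2 * h (y + r • ev θ)) * ev θ i)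
      (∫ θ in (-π)..π, ev θ i • ((8 * r ^ 2 / R ^ 4) • fderiv ℝ f (x + r • ev θ) + ((1 - r ^ 2 / R ^ 2) ^ 2) • fderiv ℝ h (x + r • ev θ))) x := by
    intro r x
    refine hasFDerivAt_param (F := fun y θ => (8 * r ^ 2 / R ^ 4 * f (y + r • ev θ) + (1 - r ^ 2 / R ^ 2) ^ 2 * h (y + r • ev θ)) * ev θ i)
      (F' := fun x θ => ev θ i • ((8 * r ^ 2 / R ^ 4) • fderiv ℝ f (x + r • ev θ) + ((1 - r ^ 2 / R ^ 2) ^ 2) • fderiv ℝ h (x + r • ev θ))) ?_ ?_ ?_ _ _ x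
    · simp only [Function.uncurry_def]; fun_prop
    · simp only [Function.uncurry_def]; fun_prop
    · intro x θ
      have h1 : HasFDerivAt (fun y => f (y + r • ev θ)) (fderiv ℝ f (x + r • ev θ)) x :=
        by
        have := (hf.differentiable (by norm_num) (x + r • ev θ)).hasFDerivAt.comp x ((hasFDerivAt_id x).add_const (r • ev θ))
        rw [ContinuousLinearMap.comp_id] at this
        exact this
      have h2 : HasFDerivAt (fun y => h (y + r • ev θ)) (fderiv ℝ h (x + r • ev θ)) x :=
        by
        have := (hh.differentiable (by norm_num) (x + r • ev θ)).hasFDerivAt.comp x ((hasFDerivAt_id x).add_const (r • ev θ))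
        rw [ContinuousLinearMap.comp_id] at this
        exact this
      exact ((h1.const_mul _).add (h2.const_mul _)).mul_const _
  have hout := hasFDerivAt_param (F := fun (y : E2) r => ∫ θ in (-π)..π, (8 * r ^ 2 / R ^ 4 * f (y + r • ev θ) + (1 - r ^ 2 / R ^ 2) ^ 2 * h (y + r • ev θ)) * ev θ i)
     (F' := fun x r => ∫ θ in (-π)..π, ev θ i • ((8 * r ^ 2 / R ^ 4) • fderiv ℝ f (x + r • ev θ) + ((1 - r ^ 2 / R ^ 2) ^ 2) • fderiv ℝ h (x + r • ev θ)))
     (TR_cont2 i R cf ch) (by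
        apply intervalIntegral.continuous_parametric_intervalIntegral_of_continuous'
        simp only [Function.uncurry_def]; fun_prop) (fun x r => hin r x) 0 R c
  have := hout.const_mul (1 / (2 * π))
  refine this.congr_fderiv ?_
  have e : ∀ j : Fin 2, ((1 / (2 * π)) • ∫ r in (0:ℝ)..R, ∫ θ in (-π)..π, ev θ i • ((8 * r ^ 2 / R ^ 4) • fderiv ℝ f (c + r • ev θ) + ((1 - r ^ 2 / R ^ 2) ^ 2) • fderiv ℝ h (c + r • ev θ))) (EuclideanSpace.single j 1) = TR i R (pd j f) (pd j h) c := by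
    intro j
    rw [ContinuousLinearMap.smul_apply, ContinuousLinearMap.intervalIntegral_apply, smul_eq_mul]
    · unfold TR
      congr 2; funext r
      rw [ContinuousLinearMap.intervalIntegral_apply]
      · congr 1; funext θ
        simp [pd]; ring
      · exact Continuous.intervalIntegrable (by fun_prop) _ _
    · apply Continuous.intervalIntegrable
      apply intervalIntegral.continuous_parametric_intervalIntegral_of_continuous'
      simp only [Function.uncurry_def]; fun_prop
  ext v
  rw [clm_coord, e 0, e 1, gcl_apply]

lemma TR_contDiff1 (i : Fin 2) (R : ℝ) {f h : E2 → ℝ} (hf : ContDiff ℝ 1 f) (hh : ContDiff ℝ 1 h) :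
    ContDiff ℝ 1 (TR i R f h) ∧ ∀ j, pd j (TR i R f h) = TR i R (pd j f) (pd j h) := by
  obtain ⟨h1, h2, h3⟩ := contDiff1_of_grad (TR_continuous i R (pd_continuous hf 0) (pd_continuous hh 0))
    (TR_continuous i R (pd_continuous hf 1) (pd_continuous hh 1)) (TR_hasFDerivAt i R hf hh)
  refine ⟨h1, fun j => ?_⟩
  fin_cases j
  · exact h2
  · exact h3

lemma TR_pd_local (i j : Fin 2) {f h : E2 → ℝ} {c : E2} (hf : ContDiff ℝ 1 f) (hh : ContDiffOn ℝ 1 h (ball c 2)) :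
    pd j (TR i 1 f h) c = TR i 1 (pd j f) (pd j h) c := by
  obtain ⟨v, hv, S, hS, hS', he⟩ := ext_ball (n := 1) (R := 1) (R' := 2) zero_le_one (by norm_num) (by exact_mod_cast hh)
  have e1 : Set.EqOn (TR i 1 f h) (TR i 1 f v) (ball c (S - 1)) := by
    intro x hx
    refine TR_congr i zero_le_one (fun _ _ => rfl) (fun y hy => (he ?_).symm)
    rw [mem_ball] at *; rw [mem_closedBall] at hy
    linarith [dist_triangle y x c]
  rw [pd_congr isOpen_ball e1 j (mem_ball_self (by linarith)), (TR_contDiff1 i 1 hf (by exact_mod_cast hv)).2 j]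
  refine TR_congr i zero_le_one (fun _ _ => rfl) (fun y hy => ?_)
  exact pd_congr isOpen_ball he j (closedBall_subset_ball hS hy)

/-- locally uniform convergence -/
def LU (F : ℕ → E2 → ℝ) (f : E2 → ℝ) : Prop :=
  ∀ x, Tendsto (fun q : ℕ × E2 => F q.1 q.2) (atTop ×ˢ 𝓝 x) (𝓝 (f x))

lemma LU.pointwise {F : ℕ → E2 → ℝ} {f : E2 → ℝ} (h : LU F f) (x : E2) :
    Tendsto (fun n => F n x) atTop (𝓝 (f x)) :=
  (h x).comp (tendsto_id.prodMk tendsto_const_nhds)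

lemma LU.continuous {F : ℕ → E2 → ℝ} {f : E2 → ℝ} (h : LU F f) : Continuous f := by
  rw [continuous_iff_continuousAt]; intro x
  rw [ContinuousAt, Metric.tendsto_nhds]
  intro ε hε
  have := h x (Metric.closedBall_mem_nhds (f x) (half_pos hε))
  rw [mem_map] at this
  obtain ⟨A, hA, B, hB, hAB⟩ := mem_prod_iff.1 this
  filter_upwards [hB] with y hy
  have h1 : f y ∈ closedBall (f x) (ε / 2) := by
    refine isClosed_closedBall.mem_of_tendsto (h.pointwise y) ?_
    filter_upwards [hA] with n hn
    exact hAB (⟨hn, hy⟩ : (n, y) ∈ A ×ˢ B)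
  rw [mem_closedBall] at h1; linarith

lemma LU.uniform {F : ℕ → E2 → ℝ} {f : E2 → ℝ} (h : LU F f) {K : Set E2} (hK : IsCompact K) :
    TendstoUniformlyOn F f atTop K := by
  rw [← tendstoLocallyUniformlyOn_iff_tendstoUniformlyOn_of_compact hK]
  apply TendstoLocallyUniformly.tendstoLocallyUniformlyOn
  rw [tendstoLocallyUniformly_iff_forall_tendsto]
  intro x
  have hc : Tendsto (fun q : ℕ × E2 => f q.2) (atTop ×ˢ 𝓝 x) (𝓝 (f x)) :=
    h.continuous.continuousAt.tendsto.comp tendsto_snd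
  have := hc.prodMk (h x)
  rw [← nhds_prod_eq] at this
  exact this.mono_right (nhds_le_uniformity (f x))

lemma LU.of_uniform {F : ℕ → E2 → ℝ} {f : E2 → ℝ} (hf : Continuous f)
    (h : ∀ R : ℝ, TendstoUniformlyOn F f atTop (closedBall 0 R)) : LU F f := by
  intro x
  rw [Metric.tendsto_nhds]
  intro ε hε
  have h1 := Metric.tendstoUniformlyOn_iff.1 (h (‖x‖ + 1)) (ε / 2) (half_pos hε)
  have h2 : ∀ᶠ y in 𝓝 x, dist (f y) (f x) < ε / 2 := Metric.tendsto_nhds.1 hf.continuousAt _ (half_pos hε)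
  have h3 : ∀ᶠ y in 𝓝 x, y ∈ closedBall (0:E2) (‖x‖ + 1) := by
    filter_upwards [ball_mem_nhds x one_pos] with y hy
    rw [mem_ball, dist_eq_norm] at hy
    rw [mem_closedBall, dist_zero_right]
    have := norm_add_le (y - x) x
    simp at this; linarith
  filter_upwards [h1.prod_mk (h2.and h3)] with q hq
  have := hq.1 q.2 hq.2.2
  rw [dist_comm] at this
  linarith [dist_triangle (F q.1 q.2) (f q.2) (f x), hq.2.1]

lemma LU.subseq {F : ℕ → E2 → ℝ} {f : E2 → ℝ} (h : LU F f) {φ : ℕ → ℕ} (hφ : StrictMono φ) :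
    LU (fun n => F (φ n)) f := fun x =>
  (h x).comp ((hφ.tendsto_atTop.comp tendsto_fst).prodMk tendsto_snd)

/-- eventual equality on balls -/
def EvEq (F G : ℕ → E2 → ℝ) : Prop := ∀ R : ℝ, ∀ᶠ n in atTop, Set.EqOn (F n) (G n) (ball 0 R)

lemma ball0_mem_nhds (x : E2) : ball (0:E2) (‖x‖ + 1) ∈ 𝓝 x :=
  isOpen_ball.mem_nhds (by simp)

lemma LU.congr {F G : ℕ → E2 → ℝ} {f : E2 → ℝ} (h : LU F f) (hG : EvEq F G) : LU G f := by
  intro x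
  refine (h x).congr' ?_
  filter_upwards [(hG (‖x‖ + 1)).prod_mk (ball0_mem_nhds x)] with q hq
  exact hq.1 hq.2

lemma EvEq.symm {F G : ℕ → E2 → ℝ} (h : EvEq F G) : EvEq G F := fun R => (h R).mono fun _ h => h.symm

lemma EvEq.pd {F G : ℕ → E2 → ℝ} (h : EvEq F G) (i : Fin 2) : EvEq (fun n => pd i (F n)) (fun n => pd i (G n)) :=
  fun R => (h R).mono fun _ h => pd_congr isOpen_ball h i

lemma LU_TR (i : Fin 2) {F H : ℕ → E2 → ℝ} {f h : E2 → ℝ} (hF : LU F f) (hH : LU H h)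
    (cF : ∀ R : ℝ, ∀ᶠ n in atTop, ContinuousOn (F n) (ball 0 R)) (cH : ∀ R : ℝ, ∀ᶠ n in atTop, ContinuousOn (H n) (ball 0 R)) :
    LU (fun n => TR i 1 (F n) (H n)) (TR i 1 f h) := by
  apply LU.of_uniform (TR_continuous i 1 hF.continuous hH.continuous)
  intro R
  rw [Metric.tendstoUniformlyOn_iff]
  intro ε hε
  have h1 := Metric.tendstoUniformlyOn_iff.1 (hF.uniform (isCompact_closedBall 0 (R + 1))) (ε / 18) (by positivity)
  have h2 := Metric.tendstoUniformlyOn_iff.1 (hH.uniform (isCompact_closedBall 0 (R + 1))) (ε / 18) (by positivity)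
  have key : ∀ g : E2 → ℝ, ContinuousOn g (ball 0 (R + 3)) → 0 ≤ R → ∃ g', Continuous g' ∧ Set.EqOn g' g (closedBall 0 (R + 1)) := by
    intro g hg hR
    obtain ⟨v, hv, S, hS, hS', he⟩ := ext_ball (n := 0) (c := 0) (R := R + 1) (R' := R + 3) (u := g) (by linarith) (by linarith) (by simpa using hg)
    exact ⟨v, hv.continuous, he.mono (closedBall_subset_ball hS)⟩
  filter_upwards [h1, h2, cF (R + 3), cH (R + 3)] with n hn1 hn2 hn3 hn4 x hx
  have hR : 0 ≤ R := by
    rw [mem_closedBall] at hx; exact dist_nonneg.trans hx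
  obtain ⟨F', cF', eF⟩ := key _ hn3 hR
  obtain ⟨H', cH', eH⟩ := key _ hn4 hR
  have hs : closedBall x 1 ⊆ closedBall 0 (R + 1) := by
    apply closedBall_subset_closedBall'
    rw [mem_closedBall] at hx; linarith
  rw [← TR_congr i zero_le_one (eF.mono hs) (eH.mono hs), Real.dist_eq, TR_sub i 1 hF.continuous hH.continuous cF' cH']
  refine (TR_bound i one_pos (A := ε / 18) (B := ε / 18) ?_ ?_).trans_lt ?_
  · intro y hy
    have := hn1 y (hs hy); rw [Real.dist_eq] at this; rw [eF (hs hy)]; exact this.le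
  · intro y hy
    have := hn2 y (hs hy); rw [Real.dist_eq] at this; rw [eH (hs hy)]; exact this.le
  · linarith

lemma gcl_norm_le (a b : ℝ) : ‖gcl a b‖ ≤ |a| + |b| := by
  apply ContinuousLinearMap.opNorm_le_bound _ (by positivity)
  intro v
  rw [gcl_apply, Real.norm_eq_abs]
  have h0 : |v 0| ≤ ‖v‖ := by simpa using PiLp.norm_apply_le v 0
  have h1 : |v 1| ≤ ‖v‖ := by simpa using PiLp.norm_apply_le v 1
  calc |v 0 * a + v 1 * b| ≤ |v 0| * |a| + |v 1| * |b| := by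
        rw [← abs_mul, ← abs_mul]; exact abs_add_le _ _
    _ ≤ ‖v‖ * |a| + ‖v‖ * |b| := by gcongr
    _ = _ := by ring

lemma gcl_sub (a b a' b' : ℝ) : gcl a b - gcl a' b' = gcl (a - a') (b - b') := by
  ext v; simp [gcl_apply]; ring

lemma LU_C1 {F : ℕ → E2 → ℝ} {f g0 g1 : E2 → ℝ} (hF : LU F f)
    (dF : ∀ R : ℝ, ∀ᶠ n in atTop, DifferentiableOn ℝ (F n) (ball 0 R))
    (h0 : LU (fun n => pd 0 (F n)) g0) (h1 : LU (fun n => pd 1 (F n)) g1) :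
    ContDiff ℝ 1 f ∧ pd 0 f = g0 ∧ pd 1 f = g1 := by
  apply contDiff1_of_grad h0.continuous h1.continuous
  intro x
  refine hasFDerivAt_of_tendstoUniformlyOnFilter (l := atTop) (f := F) (f' := fun n y => gcl (pd 0 (F n) y) (pd 1 (F n) y)) (g := f) (g' := fun y => gcl (g0 y) (g1 y)) (x := x) ?_ ?_ ?_
  · rw [Metric.tendstoUniformlyOnFilter_iff]
    intro ε hε
    have hc0 : Tendsto (fun q : ℕ × E2 => g0 q.2 - pd 0 (F q.1) q.2) (atTop ×ˢ 𝓝 x) (𝓝 0) := by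
      simpa using (h0.continuous.continuousAt.tendsto.comp tendsto_snd).sub (h0 x)
    have hc1 : Tendsto (fun q : ℕ × E2 => g1 q.2 - pd 1 (F q.1) q.2) (atTop ×ˢ 𝓝 x) (𝓝 0) := by
      simpa using (h1.continuous.continuousAt.tendsto.comp tendsto_snd).sub (h1 x)
    filter_upwards [Metric.tendsto_nhds.1 hc0 (ε / 2) (half_pos hε), Metric.tendsto_nhds.1 hc1 (ε / 2) (half_pos hε)] with q hq0 hq1
    rw [dist_eq_norm, gcl_sub]
    refine (gcl_norm_le _ _).trans_lt ?_
    simp [Real.dist_eq] at hq0 hq1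
    linarith
  · filter_upwards [(dF (‖x‖ + 1)).prod_mk (ball0_mem_nhds x)] with q hq
    have := ((hq.1 q.2 hq.2).differentiableAt (isOpen_ball.mem_nhds hq.2)).hasFDerivAt
    rwa [fderiv_eq_gcl] at this
  · filter_upwards with y; exact hF.pointwise y

lemma fin2_cases {P : Fin 2 → Prop} (h0 : P 0) (h1 : P 1) : ∀ i, P i := by
  intro i; fin_cases i
  · exact h0
  · exact h1

lemma LU_grad {F : ℕ → E2 → ℝ} {f h : E2 → ℝ} (hF : ∀ n, ContDiff ℝ 2 (F n)) (hf : LU F f)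
    (hh : LU (fun n x => - lap (F n) x) h) :
    ContDiff ℝ 1 f ∧ (∀ i, LU (fun n => pd i (F n)) (pd i f)) ∧ (∀ i, pd i f = TR i 1 f h) := by
  have h1 : ∀ i, LU (fun n => pd i (F n)) (TR i 1 f h) := by
    intro i
    have := LU_TR i hf hh (fun R => Eventually.of_forall fun n => (hF n).continuous.continuousOn)
      (fun R => Eventually.of_forall fun n => (lap_continuous (hF n)).neg.continuousOn)
    have e : (fun n => pd i (F n)) = fun n => TR i 1 (F n) (fun x => - lap (F n) x) := by
      funext n c; exact grad_formula (hF n) c one_pos i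
    rw [e]; exact this
  obtain ⟨a, b, c⟩ := LU_C1 hf (fun R => Eventually.of_forall fun n => ((hF n).differentiable (by norm_num)).differentiableOn) (h1 0) (h1 1)
  have e : ∀ i, pd i f = TR i 1 f h := fin2_cases b c
  refine ⟨a, fun i => ?_, e⟩
  rw [e i]; exact h1 i

lemma pd_continuousOn {f : E2 → ℝ} {U : Set E2} (hU : IsOpen U) (hf : ContDiffOn ℝ 1 f U) (i : Fin 2) :
    ContinuousOn (pd i f) U :=
  (hf.continuousOn_fderiv_of_isOpen hU (by norm_num)).clm_apply continuousOn_const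

lemma LU_C2 {F H : ℕ → E2 → ℝ} {f h : E2 → ℝ} {g : Fin 2 → E2 → ℝ} (hF : ∀ n, ContDiff ℝ 2 (F n)) (hf : LU F f)
    (hE : EvEq (fun n x => - lap (F n) x) H) (hh : LU H h)
    (hH : ∀ R : ℝ, ∀ᶠ n in atTop, ContDiffOn ℝ 1 (H n) (ball 0 R))
    (hg : ∀ j, LU (fun n => pd j (H n)) (g j)) :
    ContDiff ℝ 2 f ∧ (∀ i j, LU (fun n => pd j (pd i (F n))) (pd j (pd i f))) ∧ (∀ x, lap f x = - h x) ∧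
      ContDiff ℝ 1 h := by
  have hh' : LU (fun n x => - lap (F n) x) h := hh.congr hE.symm
  obtain ⟨a, b, c⟩ := LU_grad hF hf hh'
  have key : ∀ i j, EvEq (fun n => pd j (pd i (F n))) (fun n => TR i 1 (pd j (F n)) (pd j (H n))) := by
    intro i j R
    filter_upwards [hE (R + 3), hH (R + 3)] with n hn1 hn2 x hx
    have e : pd i (F n) = TR i 1 (F n) (fun x => - lap (F n) x) := by
      funext c; exact grad_formula (hF n) c one_pos i
    simp only [e]
    have hx' : x ∈ ball (0:E2) (R + 2) := ball_subset_ball (by linarith) hx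
    have e2 : Set.EqOn (TR i 1 (F n) (fun x => - lap (F n) x)) (TR i 1 (F n) (H n)) (ball 0 (R + 2)) := by
      intro y hy
      refine TR_congr i zero_le_one (fun _ _ => rfl) (hn1.mono ?_)
      intro z hz
      rw [mem_ball] at *; rw [mem_closedBall] at hz
      linarith [dist_triangle z y 0]
    rw [pd_congr isOpen_ball e2 j hx']
    apply TR_pd_local i j ((hF n).of_le (by norm_num))
    refine hn2.mono ?_
    intro z hz
    rw [mem_ball] at *
    linarith [dist_triangle z x 0]
  have h2 : ∀ i j, LU (fun n => pd j (pd i (F n))) (TR i 1 (pd j f) (g j)) := by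
    intro i j
    refine (LU_TR i (b j) (hg j) ?_ ?_).congr (key i j).symm
    · exact fun R => Eventually.of_forall fun n => (pd_contDiff1 (hF n) j).continuous.continuousOn
    · exact fun R => (hH R).mono fun n hn => pd_continuousOn isOpen_ball hn j
  have h3 : ∀ i, ContDiff ℝ 1 (pd i f) ∧ ∀ j, pd j (pd i f) = TR i 1 (pd j f) (g j) := by
    intro i
    obtain ⟨a', b', c'⟩ := LU_C1 (b i) (fun R => Eventually.of_forall fun n => ((pd_contDiff1 (hF n) i).differentiable (by norm_num)).differentiableOn) (h2 i 0) (h2 i 1)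
    exact ⟨a', fin2_cases b' c'⟩
  have h4 : ∀ i j, LU (fun n => pd j (pd i (F n))) (pd j (pd i f)) := by
    intro i j; rw [(h3 i).2 j]; exact h2 i j
  refine ⟨contDiff2_of_pd a (fun i => (h3 i).1), h4, ?_, ?_⟩
  · intro x
    have t1 := ((h4 0 0).pointwise x).add ((h4 1 1).pointwise x)
    have t2 := (hh'.pointwise x).neg
    rw [lap_eq]
    refine tendsto_nhds_unique t1 (t2.congr fun n => ?_)
    simp only [neg_neg]; rw [lap_eq]
  · exact (LU_C1 hh (fun R => (hH R).mono fun n hn => hn.differentiableOn (by norm_num)) (hg 0) (hg 1)).1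

lemma snd_fderiv {f : E2 → ℝ} (hf : ContDiff ℝ 2 f) (x a b : E2) :
    fderiv ℝ (fderiv ℝ f) x a b = a 0 * (b 0 * pd 0 (pd 0 f) x + b 1 * pd 0 (pd 1 f) x)
      + a 1 * (b 0 * pd 1 (pd 0 f) x + b 1 * pd 1 (pd 1 f) x) := by
  have hd : DifferentiableAt ℝ (fderiv ℝ f) x :=
    (hf.fderiv_right (m := 1) (by norm_num)).differentiable (by norm_num) x
  have e : ∀ i j, pd i (pd j f) x = fderiv ℝ (fderiv ℝ f) x (EuclideanSpace.single i 1) (EuclideanSpace.single j 1) := by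
    intro i j
    change fderiv ℝ (fun y => fderiv ℝ f y (EuclideanSpace.single j 1)) x _ = _
    rw [fderiv_clm_apply hd (differentiableAt_const _)]
    simp
  rw [e, e, e, e]
  have h2 := clm_coord ((fderiv ℝ (fderiv ℝ f) x).flip b) a
  simp only [ContinuousLinearMap.flip_apply] at h2
  rw [h2, clm_coord _ b, clm_coord (fderiv ℝ (fderiv ℝ f) x (EuclideanSpace.single 1 1)) b]

lemma LU_to_C2 {F : ℕ → E2 → ℝ} {f : E2 → ℝ} (hF : ∀ n, ContDiff ℝ 2 (F n)) (hf : ContDiff ℝ 2 f)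
    (h0 : LU F f) (h1 : ∀ i, LU (fun n => pd i (F n)) (pd i f))
    (h2 : ∀ i j, LU (fun n => pd j (pd i (F n))) (pd j (pd i f))) :
    TendstoC2LocOn Set.univ F f := by
  intro K _ hK k hk
  rw [Metric.tendstoUniformlyOn_iff]
  intro ε hε
  have aux : ∀ (v : E2) (i : Fin 2), |v i| ≤ ‖v‖ := fun v i => by simpa using PiLp.norm_apply_le v i
  have hU : ∀ {G : ℕ → E2 → ℝ} {g : E2 → ℝ}, LU G g → ∀ᶠ n in atTop, ∀ x ∈ K, |g x - G n x| ≤ ε / 8 := by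
    intro G g h
    filter_upwards [Metric.tendstoUniformlyOn_iff.1 (h.uniform hK) (ε / 8) (by positivity)] with n hn x hx
    have := hn x hx; rw [Real.dist_eq] at this; exact this.le
  interval_cases k
  · filter_upwards [hU h0] with n hn x hx
    rw [dist_eq_norm]
    refine lt_of_le_of_lt ((ContinuousMultilinearMap.opNorm_le_bound (M := ε / 8) (by positivity) fun m => ?_)) (by linarith : ε / 8 < ε)
    simpa using hn x hx
  · filter_upwards [hU (h1 0), hU (h1 1)] with n hn0 hn1 x hx
    rw [dist_eq_norm]
    refine lt_of_le_of_lt ((ContinuousMultilinearMap.opNorm_le_bound (M := ε / 4) (by positivity) fun m => ?_)) (by linarith : ε / 4 < ε)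
    rw [sub_apply, iteratedFDeriv_one_apply, iteratedFDeriv_one_apply, fderiv_coord, fderiv_coord, Real.norm_eq_abs]
    simp only [Fin.prod_univ_one]
    have e : (m 0 0 * pd 0 f x + m 0 1 * pd 1 f x - (m 0 0 * pd 0 (F n) x + m 0 1 * pd 1 (F n) x)) =
      m 0 0 * (pd 0 f x - pd 0 (F n) x) + m 0 1 * (pd 1 f x - pd 1 (F n) x) := by ring
    rw [e]
    calc _ ≤ |m 0 0| * |pd 0 f x - pd 0 (F n) x| + |m 0 1| * |pd 1 f x - pd 1 (F n) x| := by
          rw [← abs_mul, ← abs_mul]; exact abs_add_le _ _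
      _ ≤ ‖m 0‖ * (ε / 8) + ‖m 0‖ * (ε / 8) := by
          gcongr
          · exact aux _ _
          · exact hn0 x hx
          · exact aux _ _
          · exact hn1 x hx
      _ = _ := by ring
  · filter_upwards [hU (h2 0 0), hU (h2 0 1), hU (h2 1 0), hU (h2 1 1)] with n hn00 hn01 hn10 hn11 x hx
    rw [dist_eq_norm]
    refine lt_of_le_of_lt ((ContinuousMultilinearMap.opNorm_le_bound (M := ε / 2) (by positivity) fun m => ?_)) (by linarith : ε / 2 < ε)
    rw [sub_apply, iteratedFDeriv_two_apply, iteratedFDeriv_two_apply, snd_fderiv hf, snd_fderiv (hF n), Real.norm_eq_abs]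
    simp only [Fin.prod_univ_two]
    set a := m 0
    set b := m 1
    have e : a 0 * (b 0 * pd 0 (pd 0 f) x + b 1 * pd 0 (pd 1 f) x) + a 1 * (b 0 * pd 1 (pd 0 f) x + b 1 * pd 1 (pd 1 f) x)
      - (a 0 * (b 0 * pd 0 (pd 0 (F n)) x + b 1 * pd 0 (pd 1 (F n)) x) + a 1 * (b 0 * pd 1 (pd 0 (F n)) x + b 1 * pd 1 (pd 1 (F n)) x))
      = a 0 * b 0 * (pd 0 (pd 0 f) x - pd 0 (pd 0 (F n)) x) + a 0 * b 1 * (pd 0 (pd 1 f) x - pd 0 (pd 1 (F n)) x)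
       + a 1 * b 0 * (pd 1 (pd 0 f) x - pd 1 (pd 0 (F n)) x) + a 1 * b 1 * (pd 1 (pd 1 f) x - pd 1 (pd 1 (F n)) x) := by ring
    have t : ∀ (i j : Fin 2) (d : ℝ), |d| ≤ ε / 8 → |a i * b j * d| ≤ ‖a‖ * ‖b‖ * (ε / 8) := by
      intro i j d hd
      rw [abs_mul, abs_mul]
      gcongr
      · exact aux _ _
      · exact aux _ _
    rw [e]
    have t1 := t 0 0 _ (hn00 x hx)
    have t2 := t 0 1 _ (hn10 x hx)
    have t3 := t 1 0 _ (hn01 x hx)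
    have t4 := t 1 1 _ (hn11 x hx)
    refine (abs_add_le _ _).trans ?_
    refine (add_le_add_left (abs_add_le _ _) _).trans ?_
    refine (add_le_add_left (add_le_add_left (abs_add_le _ _) _) _).trans ?_
    linarith

lemma arzela {F : ℕ → E2 → ℝ}
    (hb : ∀ R : ℝ, ∃ C, ∀ᶠ n in atTop, ∀ x ∈ closedBall (0:E2) R, |F n x| ≤ C)
    (hl : ∀ R : ℝ, ∃ L, ∀ᶠ n in atTop, ∀ x ∈ closedBall (0:E2) R, ∀ y ∈ closedBall (0:E2) R, |F n x - F n y| ≤ L * dist x y) :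
    ∃ φ : ℕ → ℕ, StrictMono φ ∧ ∃ f, LU (fun n => F (φ n)) f := by
  have hb' : ∀ x : E2, ∃ C, ∀ n, |F n x| ≤ C := by
    intro x
    obtain ⟨C, hC⟩ := hb ‖x‖
    obtain ⟨N, hN⟩ := eventually_atTop.1 hC
    refine ⟨max C (∑ k ∈ Finset.range N, |F k x|), fun n => ?_⟩
    by_cases h : N ≤ n
    · exact (hN n h x (by simp)).trans (le_max_left _ _)
    · refine le_trans ?_ (le_max_right _ _)
      exact Finset.single_le_sum (f := fun k => |F k x|) (fun _ _ => abs_nonneg _) (Finset.mem_range.2 (not_le.1 h))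
  choose C hC using hb'
  let D := TopologicalSpace.denseSeq E2
  have hcomp : IsCompact (Set.pi Set.univ (fun k : ℕ => Set.Icc (-C (D k)) (C (D k)))) :=
    isCompact_univ_pi fun k => isCompact_Icc
  obtain ⟨g, -, φ, hφ, hlim⟩ := hcomp.tendsto_subseq (x := fun n k => F n (D k)) (fun n k _ => abs_le.1 (hC (D k) n))
  rw [tendsto_pi_nhds] at hlim
  refine ⟨φ, hφ, ?_⟩
  have hcau : ∀ R : ℝ, UniformCauchySeqOn (fun n => F (φ n)) atTop (closedBall (0:E2) R) := by
    intro R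
    rw [Metric.uniformCauchySeqOn_iff]
    intro ε hε
    obtain ⟨L, hL⟩ := hl (R + 1)
    have hL' := hφ.tendsto_atTop.eventually hL
    set δ := min 1 (ε / (4 * (|L| + 1))) with hδ
    have hδ0 : 0 < δ := by positivity
    obtain ⟨t, ht⟩ := (isCompact_closedBall (0:E2) R).elim_finite_subcover (fun k => ball (D k) δ) (fun k => isOpen_ball) (by
      intro x _
      obtain ⟨k, hk⟩ := (TopologicalSpace.denseRange_denseSeq E2).exists_dist_lt x hδ0
      exact Set.mem_iUnion.2 ⟨k, hk⟩)
    have hev : ∀ᶠ n in atTop, ∀ k ∈ t, dist (F (φ n) (D k)) (g k) < ε / 8 := by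
      rw [Filter.eventually_all_finset]
      intro k _
      exact Metric.tendsto_nhds.1 (hlim k) _ (by positivity)
    obtain ⟨N, hN⟩ := eventually_atTop.1 (hev.and hL')
    refine ⟨N, fun m hm n hn x hx => ?_⟩
    obtain ⟨k, hk, hxk⟩ : ∃ k ∈ t, x ∈ ball (D k) δ := by
      simpa using ht hx
    have hx1 : x ∈ closedBall (0:E2) (R + 1) := closedBall_subset_closedBall (by linarith) hx
    have hk1 : D k ∈ closedBall (0:E2) (R + 1) := by
      rw [mem_closedBall] at *; rw [mem_ball] at hxk
      have := dist_triangle (D k) x 0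
      rw [dist_comm (D k) x] at this
      linarith [min_le_left 1 (ε / (4 * (|L| + 1)))]
    have hd : L * dist x (D k) ≤ ε / 4 := by
      rw [mem_ball] at hxk
      have h1 : dist x (D k) ≤ ε / (4 * (|L| + 1)) := hxk.le.trans (min_le_right _ _)
      have h2 : (|L| + 1) * (ε / (4 * (|L| + 1))) = ε / 4 := by field_simp
      calc L * dist x (D k) ≤ (|L| + 1) * dist x (D k) := by
            gcongr; linarith [le_abs_self L]
        _ ≤ (|L| + 1) * (ε / (4 * (|L| + 1))) := by gcongr
        _ = _ := h2
    have a1 := (hN m hm).2 x hx1 (D k) hk1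
    have a2 := (hN n hn).2 x hx1 (D k) hk1
    have a3 := (hN m hm).1 k hk
    have a4 := (hN n hn).1 k hk
    rw [Real.dist_eq] at *
    rw [abs_lt] at *
    rw [abs_le] at a1 a2
    constructor <;> linarith [a1.1, a1.2, a2.1, a2.2, a3.1, a3.2, a4.1, a4.2]
  have hpt : ∀ x, ∃ l, Tendsto (fun n => F (φ n) x) atTop (𝓝 l) := by
    intro x
    apply cauchySeq_tendsto_of_complete
    exact (hcau ‖x‖).cauchySeq (by simp)
  choose f hf using hpt
  have hu : ∀ R : ℝ, TendstoUniformlyOn (fun n => F (φ n)) f atTop (closedBall 0 R) := fun R =>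
    (hcau R).tendstoUniformlyOn_of_tendsto fun x _ => hf x
  refine ⟨f, LU.of_uniform ?_ hu⟩
  rw [continuous_iff_continuousAt]; intro x
  -- f locally Lipschitz
  obtain ⟨L, hL⟩ := hl (‖x‖ + 1)
  have hL' := hφ.tendsto_atTop.eventually hL
  have hlip : ∀ y ∈ ball (0:E2) (‖x‖ + 1), |f y - f x| ≤ L * dist y x := by
    intro y hy
    have h1 := ((hf y).sub (hf x)).abs
    refine le_of_tendsto h1 ?_
    filter_upwards [hL'] with n hn
    exact hn y (ball_subset_closedBall hy) x (by simp)
  rw [ContinuousAt, tendsto_iff_dist_tendsto_zero]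
  have h0 : Tendsto (fun y => L * dist y x) (𝓝 x) (𝓝 0) := by
    have : Tendsto (fun y => L * dist y x) (𝓝 x) (𝓝 (L * dist x x)) := by
      apply Continuous.tendsto; fun_prop
    simpa using this
  refine squeeze_zero' (Eventually.of_forall fun _ => dist_nonneg) ?_ h0
  filter_upwards [ball0_mem_nhds x] with y hy
  rw [Real.dist_eq]; exact hlip y hy

/-- Compactness from sup bounds and bounded Laplacian. -/
lemma arzela_lap {F : ℕ → E2 → ℝ} (hF : ∀ n, ContDiff ℝ 2 (F n))
    (hb : ∀ R : ℝ, ∃ C, ∀ᶠ n in atTop, ∀ x ∈ closedBall (0:E2) R, |F n x| ≤ C)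
    (hl : ∀ R : ℝ, ∃ C, ∀ᶠ n in atTop, ∀ x ∈ closedBall (0:E2) R, |lap (F n) x| ≤ C) :
    ∃ φ : ℕ → ℕ, StrictMono φ ∧ ∃ f, LU (fun n => F (φ n)) f := by
  apply arzela hb
  intro R
  obtain ⟨A, hA⟩ := hb (R + 1)
  obtain ⟨B, hB⟩ := hl (R + 1)
  refine ⟨2 * (8 * A + B), ?_⟩
  filter_upwards [hA, hB] with n hA hB x hx y hy
  have hg : ∀ z ∈ closedBall (0:E2) R, ∀ i, |pd i (F n) z| ≤ 8 * A + B := by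
    intro z hz i
    rw [grad_formula (hF n) z one_pos i]
    have hs : closedBall z 1 ⊆ closedBall 0 (R + 1) := by
      apply closedBall_subset_closedBall'
      rw [mem_closedBall] at hz; linarith
    have := TR_bound i one_pos (A := A) (B := B) (f := F n) (h := fun x => - lap (F n) x) (c := z)
      (fun w hw => hA w (hs hw)) (fun w hw => by rw [abs_neg]; exact hB w (hs hw))
    simpa using this
  have := (convex_closedBall (0:E2) R).norm_image_sub_le_of_norm_fderiv_le (f := F n) (𝕜 := ℝ) (C := 2 * (8 * A + B))
    (fun z _ => (hF n).differentiable (by norm_num) z) (fun z hz => by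
      rw [fderiv_eq_gcl]
      refine (gcl_norm_le _ _).trans ?_
      linarith [hg z hz 0, hg z hz 1]) hy hx
  rw [dist_eq_norm]; exact this

lemma harnack0 {w : E2 → ℝ} (hw : ContDiff ℝ 2 w) {R : ℝ} (hR : 0 < R)
    (h0 : ∀ x ∈ closedBall (0:E2) (2 * R), 0 ≤ w x) (hl : ∀ x ∈ closedBall (0:E2) (2 * R), |lap w x| ≤ 1)
    (hw0 : w 0 = 0) {c : E2} (hc : c ∈ closedBall (0:E2) R) : w c ≤ 3 * R ^ 2 := by
  have cw := hw.continuous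
  have hp := pi_pos
  have hcR : closedBall c R ⊆ closedBall 0 (2 * R) := by
    apply closedBall_subset_closedBall'
    rw [mem_closedBall] at hc; linarith
  have i1 : ∀ r ∈ Set.Icc 0 R, 2 * π * r * (w c - r ^ 2 / 4) ≤ 2 * π * r * cav c r w := by
    intro r hr
    have := mean_ineq_global hw c (Λ := 1) hr.1 (fun x hx => (abs_le.1 (hl x (hcR (closedBall_subset_closedBall hr.2 hx)))).1)
    have h3 : 0 ≤ 2 * π * r := mul_nonneg (by positivity) hr.1
    apply mul_le_mul_of_nonneg_left _ h3
    linarith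
  have i2 : ∀ r ∈ Set.Icc 0 (2 * R), 2 * π * r * cav 0 r w ≤ 2 * π * r * (r ^ 2 / 4) := by
    intro r hr
    have := mean_ineq_upper (hw.contDiffOn (s := ball (0:E2) (r + 1))) (Λ := 1) hr.1 (by linarith) (fun x hx => (abs_le.1 (hl x (closedBall_subset_closedBall hr.2 hx))).2)
    have h3 : 0 ≤ 2 * π * r := mul_nonneg (by positivity) hr.1
    apply mul_le_mul_of_nonneg_left _ h3
    linarith
  have cc := cav_continuous cw c
  have c0 := cav_continuous cw 0
  have j1 : ∫ r in (0:ℝ)..R, 2 * π * r * (w c - r ^ 2 / 4) ≤ ∫ y in ball c R, w y := by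
    rw [polar_ball_cav cw c hR.le]
    exact intervalIntegral.integral_mono_on hR.le (Continuous.intervalIntegrable (by fun_prop) _ _)
      (Continuous.intervalIntegrable (by fun_prop) _ _) i1
  have j2 : ∫ y in ball 0 (2 * R), w y ≤ ∫ r in (0:ℝ)..(2 * R), 2 * π * r * (r ^ 2 / 4) := by
    rw [polar_ball_cav cw 0 (by linarith)]
    exact intervalIntegral.integral_mono_on (by linarith) (Continuous.intervalIntegrable (by fun_prop) _ _)
      (Continuous.intervalIntegrable (by fun_prop) _ _) i2
  have hb : ball c R ⊆ ball 0 (2 * R) := by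
    apply ball_subset_ball'
    rw [mem_closedBall] at hc; linarith
  have j3 : ∫ y in ball c R, w y ≤ ∫ y in ball 0 (2 * R), w y := by
    apply setIntegral_mono_set
    · exact (cw.continuousOn.integrableOn_compact (isCompact_closedBall 0 (2 * R))).mono_set ball_subset_closedBall
    · filter_upwards [ae_restrict_mem measurableSet_ball] with x hx
      exact h0 x (ball_subset_closedBall hx)
    · exact hb.eventuallyLE
  have k1 : ∫ r in (0:ℝ)..R, 2 * π * r * (w c - r ^ 2 / 4) = π * R ^ 2 * w c - π * R ^ 4 / 8 := by
    have e : ∀ r : ℝ, 2 * π * r * (w c - r ^ 2 / 4) = (2 * π * w c) * r - (π / 2) * r ^ 3 := by intro r; ring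
    simp only [e]
    rw [intervalIntegral.integral_sub (Continuous.intervalIntegrable (by fun_prop) _ _) (Continuous.intervalIntegrable (by fun_prop) _ _)]
    rw [intervalIntegral.integral_const_mul, intervalIntegral.integral_const_mul, integral_id, integral_pow]
    norm_num; ring
  have k2 : ∫ r in (0:ℝ)..(2 * R), 2 * π * r * (r ^ 2 / 4) = 2 * π * R ^ 4 := by
    have e : ∀ r : ℝ, 2 * π * r * (r ^ 2 / 4) = (π / 2) * r ^ 3 := by intro r; ring
    simp only [e]
    rw [intervalIntegral.integral_const_mul, integral_pow]
    norm_num; ring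
  rw [k1] at j1
  rw [k2] at j2
  have : (π * R ^ 2) * w c ≤ (π * R ^ 2) * (3 * R ^ 2) := by
    have : 0 < π * R ^ 4 := by positivity
    nlinarith
  exact le_of_mul_le_mul_left this (by positivity)

lemma tendsto_rpow_exp {α : Type*} {l : Filter α} {p t : α → ℝ} {T : ℝ} (hp : Tendsto p l atTop) (ht : Tendsto t l (𝓝 T)) :
    Tendsto (fun a => |1 + t a / p a| ^ (p a - 1)) l (𝓝 (exp T)) := by
  have h0 : Tendsto (fun a => t a / p a) l (𝓝 0) := ht.div_atTop hp
  have hk : Tendsto (fun s : ℝ => dslope (fun s => Real.log (1 + s)) 0 s) (𝓝 0) (𝓝 1) := by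
    have hd : HasDerivAt (fun s : ℝ => Real.log (1 + s)) 1 0 := by
      have := ((hasDerivAt_id (0:ℝ)).const_add 1).log (by norm_num)
      simpa using this
    have := continuousAt_dslope_same.2 hd.differentiableAt
    rw [ContinuousAt, dslope_same, hd.deriv] at this
    exact this
  have h1 := hk.comp h0
  have h2 : Tendsto (fun a => (t a - t a / p a) * dslope (fun s => Real.log (1 + s)) 0 (t a / p a)) l (𝓝 ((T - 0) * 1)) :=
    (ht.sub h0).mul h1
  have h3 := (continuous_exp.tendsto _).comp h2
  simp only [sub_zero, mul_one] at h3
  refine h3.congr' ?_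
  have hs : ∀ᶠ a in l, t a / p a ∈ Set.Ioo (-1:ℝ) 1 := h0.eventually (isOpen_Ioo.mem_nhds (by norm_num))
  filter_upwards [hs, hp.eventually_gt_atTop 0] with a ha hpa
  have hpos : 0 < 1 + t a / p a := by linarith [ha.1]
  rw [abs_of_pos hpos, rpow_def_of_pos hpos]
  simp only [Function.comp]
  congr 1
  by_cases hta : t a / p a = 0
  · have : t a = 0 := by
      rcases div_eq_zero_iff.1 hta with h | h
      · exact h
      · exact absurd h hpa.ne'
    simp [this]
  · rw [dslope_of_ne _ hta, slope_def_field]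
    have : t a ≠ 0 := by rintro h; simp [h] at hta
    simp only [add_zero, Real.log_one, sub_zero]
    field_simp

/-- derivative of the nonlinearities -/
lemma rpow_c1 {v : E2 → ℝ} (hv : ContDiff ℝ 2 v) {p R : ℝ} (q : ℝ) (hp : 0 < p) (hpos : ∀ x ∈ ball (0:E2) R, 0 < 1 + v x / p) :
    ContDiffOn ℝ 1 (fun x => (1 + v x / p) ^ q) (ball 0 R) ∧
    ∀ x ∈ ball (0:E2) R, ∀ j, pd j (fun x => (1 + v x / p) ^ q) x = q / p * (1 + v x / p) ^ (q - 1) * pd j v x := by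
  have hv1 : ContDiff ℝ 1 v := hv.of_le (by norm_num)
  constructor
  · apply ContDiffOn.rpow_const_of_ne
    · exact (contDiff_const.add (hv1.div_const p)).contDiffOn
    · exact fun x hx => (hpos x hx).ne'
  · intro x hx j
    have h1 : HasFDerivAt (fun x => 1 + v x / p) ((1 / p) • fderiv ℝ v x) x := by
      have := ((hv1.differentiable (by norm_num) x).hasFDerivAt.const_mul (1 / p)).const_add 1
      refine this.congr_of_eventuallyEq (Eventually.of_forall fun y => ?_)
      simp; ring
    have h2 := h1.rpow_const (p := q) (Or.inl (hpos x hx).ne')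
    simp only [pd]
    rw [h2.fderiv]
    simp; ring

lemma tendsto_rpow_exp' {α : Type*} {l : Filter α} {p t : α → ℝ} {T : ℝ} (k : ℝ) (hp : Tendsto p l atTop) (ht : Tendsto t l (𝓝 T)) :
    Tendsto (fun a => (1 + t a / p a) ^ (p a - k)) l (𝓝 (exp T)) := by
  have h0 : Tendsto (fun a => t a / p a) l (𝓝 0) := ht.div_atTop hp
  have h1 : Tendsto (fun a => 1 + t a / p a) l (𝓝 1) := by simpa using h0.const_add 1
  have h2 : Tendsto (fun a => (1 + t a / p a) ^ (1 - k)) l (𝓝 (1 ^ (1 - k))) := h1.rpow_const (Or.inl one_ne_zero)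
  have h3 := (tendsto_rpow_exp hp ht).mul h2
  rw [one_rpow, mul_one] at h3
  refine h3.congr' ?_
  filter_upwards [h1.eventually (isOpen_Ioi.mem_nhds (show (0:ℝ) < 1 by norm_num))] with a ha
  have ha' : 0 < 1 + t a / p a := ha
  rw [abs_of_pos ha', ← rpow_add ha']
  congr 1; ring

lemma tendsto_prod_fst {p : ℕ → ℝ} (hp : Tendsto p atTop atTop) (x : E2) :
    Tendsto (fun q : ℕ × E2 => p q.1) (atTop ×ˢ 𝓝 x) atTop := hp.comp tendsto_fst

lemma LU_rpow {p : ℕ → ℝ} (hp : Tendsto p atTop atTop) {v : ℕ → E2 → ℝ} {V : E2 → ℝ} (h : LU v V) (k : ℝ) :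
    LU (fun n x => (1 + v n x / p n) ^ (p n - k)) (fun x => exp (V x)) := fun x =>
  tendsto_rpow_exp' k (tendsto_prod_fst hp x) (h x)

lemma LU.mul {F G : ℕ → E2 → ℝ} {f g : E2 → ℝ} (hF : LU F f) (hG : LU G g) :
    LU (fun n x => F n x * G n x) (fun x => f x * g x) := fun x => (hF x).mul (hG x)

lemma LU.add {F G : ℕ → E2 → ℝ} {f g : E2 → ℝ} (hF : LU F f) (hG : LU G g) :
    LU (fun n x => F n x + G n x) (fun x => f x + g x) := fun x => (hF x).add (hG x)

lemma LU_seq {c : ℕ → ℝ} {a : ℝ} (h : Tendsto c atTop (𝓝 a)) : LU (fun n _ => c n) (fun _ => a) := fun _ =>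
  h.comp tendsto_fst

lemma pd_mul {f g : E2 → ℝ} {U : Set E2} (hU : IsOpen U) (hf : ContDiffOn ℝ 1 f U) (hg : ContDiffOn ℝ 1 g U) (j : Fin 2) {x : E2} (hx : x ∈ U) :
    pd j (fun x => f x * g x) x = pd j f x * g x + f x * pd j g x := by
  have h1 := ((hf.differentiableOn (by norm_num)).differentiableAt (hU.mem_nhds hx)).hasFDerivAt
  have h2 := ((hg.differentiableOn (by norm_num)).differentiableAt (hU.mem_nhds hx)).hasFDerivAt
  simp only [pd]
  have h3 : HasFDerivAt (fun x => f x * g x) (f x • fderiv ℝ g x + g x • fderiv ℝ f x) x := h1.mul h2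
  rw [h3.fderiv]
  simp; ring

theorem local_lim {p : ℕ → ℝ} (hp : Tendsto p atTop atTop) {v ξ : ℕ → E2 → ℝ}
    (hv : ∀ n, ContDiff ℝ 2 (v n)) (hξ : ∀ n, ContDiff ℝ 2 (ξ n)) (hv0 : ∀ n, v n 0 = 0)
    (hloc : ∀ R : ℝ, ∀ᶠ n in atTop, ∀ x ∈ ball (0:E2) R, v n x ≤ 0 ∧ |1 + v n x / p n| ≤ 1 ∧
      lap (v n) x = -(|1 + v n x / p n| ^ (p n - 1) * (1 + v n x / p n)) ∧ |ξ n x| ≤ 1 ∧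
      lap (ξ n) x = -(|1 + v n x / p n| ^ (p n - 1) * ξ n x)) :
    ∃ φ : ℕ → ℕ, StrictMono φ ∧ ∃ V Ξ : E2 → ℝ, ContDiff ℝ 2 V ∧ ContDiff ℝ 2 Ξ ∧ LU (fun n => v (φ n)) V ∧
      LU (fun n => ξ (φ n)) Ξ ∧ (∀ i, LU (fun n => pd i (ξ (φ n))) (pd i Ξ)) ∧
      (∀ i j, LU (fun n => pd j (pd i (ξ (φ n)))) (pd j (pd i Ξ))) ∧
      (∀ x, lap V x = - exp (V x)) ∧ (∀ x, lap Ξ x = - (exp (V x) * Ξ x)) ∧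
      (∀ x, V x ≤ 0) ∧ V 0 = 0 ∧ (∀ x, |Ξ x| ≤ 1) := by
  have hcb : ∀ R : ℝ, closedBall (0:E2) R ⊆ ball 0 (R + 1) := fun R => closedBall_subset_ball (by linarith)
  have hp1 : ∀ᶠ n in atTop, 1 < p n := hp.eventually_gt_atTop 1
  have hc1 : ∀ᶠ n in atTop, ∀ s : ℝ, |s| ≤ 1 → |s| ^ (p n - 1) ≤ 1 ∧ 0 ≤ |s| ^ (p n - 1) := by
    filter_upwards [hp1] with n hn s hs
    exact ⟨rpow_le_one (abs_nonneg _) hs (by linarith), rpow_nonneg (abs_nonneg _) _⟩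
  have hlv : ∀ R : ℝ, ∀ᶠ n in atTop, ∀ x ∈ closedBall (0:E2) R, |lap (v n) x| ≤ 1 := by
    intro R
    filter_upwards [hc1, hloc (R + 1)] with n h1 h2 x hx
    obtain ⟨_, a, b, _⟩ := h2 x (hcb R hx)
    rw [b, abs_neg, abs_mul, abs_of_nonneg (h1 _ a).2]
    exact mul_le_one₀ (h1 _ a).1 (abs_nonneg _) a
  have hlξ : ∀ R : ℝ, ∀ᶠ n in atTop, ∀ x ∈ closedBall (0:E2) R, |lap (ξ n) x| ≤ 1 := by
    intro R
    filter_upwards [hc1, hloc (R + 1)] with n h1 h2 x hx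
    obtain ⟨_, a, _, c, b⟩ := h2 x (hcb R hx)
    rw [b, abs_neg, abs_mul, abs_of_nonneg (h1 _ a).2]
    exact mul_le_one₀ (h1 _ a).1 (abs_nonneg _) c
  have hvb : ∀ R : ℝ, ∃ C : ℝ, ∀ᶠ n in atTop, ∀ x ∈ closedBall (0:E2) R, |v n x| ≤ C := by
    intro R
    refine ⟨3 * (|R| + 1) ^ 2, ?_⟩
    have hR : 0 < |R| + 1 := by positivity
    filter_upwards [hlv (2 * (|R| + 1)), hloc (2 * (|R| + 1) + 1)] with n h1 h2 x hx
    have h3 : x ∈ closedBall (0:E2) (|R| + 1) := closedBall_subset_closedBall (by linarith [le_abs_self R]) hx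
    have := harnack0 (w := fun x => - v n x) (hv n).neg hR (fun x hx => by linarith [(h2 x (hcb _ hx)).1])
      (fun x hx => by rw [lap_neg, abs_neg]; exact h1 x hx) (by simp [hv0]) h3
    have h4 := (h2 x (hcb _ (closedBall_subset_closedBall (by linarith) h3))).1
    rw [abs_of_nonpos h4]; exact this
  obtain ⟨φ1, hφ1, V, hV⟩ := arzela_lap hv hvb (fun R => ⟨1, hlv R⟩)
  obtain ⟨φ2, hφ2, Ξ, hΞ⟩ := arzela_lap (F := fun n => ξ (φ1 n)) (fun n => hξ _)
    (fun R => ⟨1, (hφ1.tendsto_atTop.eventually (hloc (R + 1))).mono fun n hn x hx => (hn x (hcb R hx)).2.2.2.1⟩)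
    (fun R => ⟨1, (hφ1.tendsto_atTop.eventually (hlξ R))⟩)
  set φ := fun n => φ1 (φ2 n) with hφd
  have hφ : StrictMono φ := hφ1.comp hφ2
  have hV' : LU (fun n => v (φ n)) V := hV.subseq hφ2
  have hpφ : Tendsto (fun n => p (φ n)) atTop atTop := hp.comp hφ.tendsto_atTop
  have hloc' : ∀ R : ℝ, ∀ᶠ n in atTop, ∀ x ∈ ball (0:E2) R, 0 < p (φ n) ∧ 0 < 1 + v (φ n) x / p (φ n) ∧
      - lap (v (φ n)) x = (1 + v (φ n) x / p (φ n)) ^ (p (φ n) - 0) ∧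
      - lap (ξ (φ n)) x = (1 + v (φ n) x / p (φ n)) ^ (p (φ n) - 1) * ξ (φ n) x := by
    intro R
    obtain ⟨C, hC⟩ := hvb R
    filter_upwards [hφ.tendsto_atTop.eventually hC, hφ.tendsto_atTop.eventually (hloc R), hpφ.eventually_gt_atTop (max C 1)] with n h1 h2 h3 x hx
    have hpp : 0 < p (φ n) := by linarith [le_max_right C 1]
    have hpos : 0 < 1 + v (φ n) x / p (φ n) := by
      have := (abs_le.1 (h1 x (ball_subset_closedBall hx))).1
      have h4 : -1 < v (φ n) x / p (φ n) := by
        rw [lt_div_iff₀ hpp]; linarith [le_max_left C 1]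
      linarith
    obtain ⟨_, _, a, _, b⟩ := h2 x hx
    refine ⟨hpp, hpos, ?_, ?_⟩
    · rw [a, neg_neg, abs_of_pos hpos, sub_zero, rpow_sub hpos, rpow_one, div_mul_cancel₀ _ hpos.ne']
    · rw [b, neg_neg, abs_of_pos hpos]
  -- V
  have eV : EvEq (fun n x => - lap (v (φ n)) x) (fun n x => (1 + v (φ n) x / p (φ n)) ^ (p (φ n) - 0)) := fun R =>
    (hloc' R).mono fun n hn x hx => (hn x hx).2.2.1
  have lV := LU_rpow hpφ hV' 0
  have gV := LU_grad (fun n => hv (φ n)) hV' (lV.congr eV.symm)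
  have pV : ∀ j, LU (fun n => pd j (fun x => (1 + v (φ n) x / p (φ n)) ^ (p (φ n) - 0))) (fun x => exp (V x) * pd j V x) := by
    intro j
    refine ((LU_rpow hpφ hV' 1).mul (gV.2.1 j)).congr fun R => ?_
    filter_upwards [hloc' R, hpφ.eventually_gt_atTop 0] with n hn h0 x hx
    rw [(rpow_c1 (hv (φ n)) (p (φ n) - 0) h0 (fun x hx => (hn x hx).2.1)).2 x hx j]
    rw [sub_zero, div_self h0.ne', one_mul]
  have CV := LU_C2 (fun n => hv (φ n)) hV' eV lV (fun R => by
    filter_upwards [hloc' R, hpφ.eventually_gt_atTop 0] with n hn h0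
    exact (rpow_c1 (hv (φ n)) (p (φ n) - 0) h0 (fun x hx => (hn x hx).2.1)).1) pV
  -- Ξ
  have eX : EvEq (fun n x => - lap (ξ (φ n)) x) (fun n x => (1 + v (φ n) x / p (φ n)) ^ (p (φ n) - 1) * ξ (φ n) x) := fun R =>
    (hloc' R).mono fun n hn x hx => (hn x hx).2.2.2
  have lX := (LU_rpow hpφ hV' 1).mul hΞ
  have gX := LU_grad (fun n => hξ (φ n)) hΞ (lX.congr eX.symm)
  have hq : Tendsto (fun n => (p (φ n) - 1) / p (φ n)) atTop (𝓝 1) := by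
    have h1 : Tendsto (fun n => 1 - 1 / p (φ n)) atTop (𝓝 (1 - 0)) := tendsto_const_nhds.sub (tendsto_const_nhds.div_atTop hpφ)
    rw [sub_zero] at h1
    refine h1.congr' ?_
    filter_upwards [hpφ.eventually_gt_atTop 0] with n hn
    field_simp
  have pX : ∀ j, LU (fun n => pd j (fun x => (1 + v (φ n) x / p (φ n)) ^ (p (φ n) - 1) * ξ (φ n) x))
      (fun x => 1 * exp (V x) * pd j V x * Ξ x + exp (V x) * pd j Ξ x) := by
    intro j
    refine (((((LU_seq hq).mul (LU_rpow hpφ hV' 2)).mul (gV.2.1 j)).mul hΞ).add ((LU_rpow hpφ hV' 1).mul (gX.2.1 j))).congr fun R => ?_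
    filter_upwards [hloc' R, hpφ.eventually_gt_atTop 0] with n hn h0 x hx
    have hr := rpow_c1 (hv (φ n)) (p (φ n) - 1) h0 (fun x hx => (hn x hx).2.1)
    rw [pd_mul isOpen_ball hr.1 ((hξ (φ n)).of_le (by norm_num)).contDiffOn j hx, hr.2 x hx j]
    have e2 : p (φ n) - 1 - 1 = p (φ n) - 2 := by ring
    rw [e2]
  have CX := LU_C2 (fun n => hξ (φ n)) hΞ eX lX (fun R => by
    filter_upwards [hloc' R, hpφ.eventually_gt_atTop 0] with n hn h0
    exact (rpow_c1 (hv (φ n)) (p (φ n) - 1) h0 (fun x hx => (hn x hx).2.1)).1.mul ((hξ (φ n)).of_le (by norm_num)).contDiffOn) pX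
  refine ⟨φ, hφ, V, Ξ, CV.1, CX.1, hV', hΞ, gX.2.1, CX.2.1, CV.2.2.1, CX.2.2.1, ?_, ?_, ?_⟩
  · intro x
    refine le_of_tendsto (hV'.pointwise x) ?_
    filter_upwards [hφ.tendsto_atTop.eventually (hloc (‖x‖ + 1))] with n hn
    exact (hn x (by rw [mem_ball_zero_iff]; linarith)).1
  · exact tendsto_nhds_unique (hV'.pointwise 0) (by simp only [hv0]; exact tendsto_const_nhds)
  · intro x
    refine le_of_tendsto (hΞ.pointwise x).abs ?_
    filter_upwards [hφ.tendsto_atTop.eventually (hloc (‖x‖ + 1))] with n hn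
    exact (hn x (by rw [mem_ball_zero_iff]; linarith)).2.2.2.1

/-- limit mass bound -/
lemma limit_mass {p : ℕ → ℝ} (hp : Tendsto p atTop atTop) {v : ℕ → E2 → ℝ} {V : E2 → ℝ}
    (hv : ∀ n, Continuous (v n)) (hV : LU v V) {C0 R : ℝ}
    (hm : ∀ᶠ n in atTop, ∫ x in ball (0:E2) R, |1 + v n x / p n| ^ (p n + 1) ≤ C0) :
    ∫ x in ball (0:E2) R, exp (V x) ≤ C0 := by
  have h1 : TendstoUniformlyOn (fun n x => |1 + v n x / p n| ^ (p n + 1)) (fun x => exp (V x)) atTop (closedBall 0 R) := by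
    have : LU (fun n x => |1 + v n x / p n| ^ (p n + 1)) (fun x => exp (V x)) := by
      intro x
      have h0 : Tendsto (fun q : ℕ × E2 => v q.1 q.2 / p q.1) (atTop ×ˢ 𝓝 x) (𝓝 0) := (hV x).div_atTop (tendsto_prod_fst hp x)
      have h2 : Tendsto (fun q : ℕ × E2 => 1 + v q.1 q.2 / p q.1) (atTop ×ˢ 𝓝 x) (𝓝 1) := by simpa using h0.const_add 1
      refine (tendsto_rpow_exp' (-1) (tendsto_prod_fst hp x) (hV x)).congr' ?_
      filter_upwards [h2.eventually (isOpen_Ioi.mem_nhds (show (0:ℝ) < 1 by norm_num))] with a ha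
      have ha' : 0 < 1 + v a.1 a.2 / p a.1 := ha
      rw [abs_of_pos ha', sub_neg_eq_add]
    exact this.uniform (isCompact_closedBall 0 R)
  have hcV := hV.continuous
  have hfin : volume (ball (0:E2) R) < ⊤ := measure_ball_lt_top
  have hiV : IntegrableOn (fun x => exp (V x)) (ball (0:E2) R) :=
    ((continuous_exp.comp hcV).continuousOn.integrableOn_compact (isCompact_closedBall 0 R)).mono_set ball_subset_closedBall
  apply le_of_forall_pos_le_add
  intro η hη
  set μ := volume.real (ball (0:E2) R)
  have hμ : 0 ≤ μ := measureReal_nonneg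
  have h2 := Metric.tendstoUniformlyOn_iff.1 h1 (η / (μ + 1)) (by positivity)
  obtain ⟨n, hn1, hn2, hn3⟩ := (h2.and (hm.and (hp.eventually_gt_atTop 0))).exists
  have hin : IntegrableOn (fun x => |1 + v n x / p n| ^ (p n + 1)) (ball (0:E2) R) := by
    refine (Continuous.continuousOn ?_).integrableOn_compact (isCompact_closedBall 0 R) |>.mono_set ball_subset_closedBall
    exact ((continuous_const.add ((hv n).div_const _)).abs).rpow_const fun x => Or.inr (by linarith)
  calc ∫ x in ball (0:E2) R, exp (V x) ≤ ∫ x in ball (0:E2) R, (|1 + v n x / p n| ^ (p n + 1) + η / (μ + 1)) := by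
        refine setIntegral_mono_on hiV (hin.add (integrableOn_const hfin.ne)) measurableSet_ball ?_
        intro x hx
        have := hn1 x (ball_subset_closedBall hx)
        rw [Real.dist_eq] at this
        linarith [(abs_lt.1 this).2]
    _ = (∫ x in ball (0:E2) R, |1 + v n x / p n| ^ (p n + 1)) + μ * (η / (μ + 1)) := by
        rw [integral_add hin (integrableOn_const hfin.ne)]
        simp [μ]
    _ ≤ C0 + η := by
        have : μ * (η / (μ + 1)) ≤ η := by
          rw [← mul_div_assoc, div_le_iff₀ (by positivity)]; nlinarith
        linarith

lemma intOn_ball {g : E2 → ℝ} (hg : Continuous g) (c : E2) (R : ℝ) : IntegrableOn g (ball c R) :=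
  (hg.continuousOn.integrableOn_compact (isCompact_closedBall c R)).mono_set ball_subset_closedBall

lemma cav_growth {V g : E2 → ℝ} (hV : ContDiff ℝ 2 V) (hl : ∀ x, lap V x = - g x) {C0 : ℝ}
    (hm : ∀ R : ℝ, ∫ x in ball (0:E2) R, g x ≤ C0) {r : ℝ} (hr : 1 ≤ r) :
    cav 0 1 V ≤ cav 0 r V + C0 / (2 * π) * Real.log r := by
  have ce := continuous_ev
  have cu := hV.continuous
  have c0 := (pd_contDiff1 hV 0).continuous
  have c1 := (pd_contDiff1 hV 1).continuous
  have cl := lap_continuous hV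
  have cg : Continuous g := by
    have : g = fun x => - lap V x := by funext x; rw [hl]; ring
    rw [this]; exact cl.neg
  have eng := fun r hr => polar_engine hV 0 (m := fun _ => 1) (m' := fun _ => 0) (κ := 0)
    (fun θ => hasDerivAt_const _ _) (fun θ => by simpa using hasDerivAt_const _ _) rfl rfl r hr
  simp only [mul_one, zero_mul, zero_div, add_zero] at eng
  set a : ℝ → ℝ := fun r => ∫ θ in (-π)..π, V (0 + r • ev θ) with ha
  set b : ℝ → ℝ := fun r => ∫ θ in (-π)..π, (cos θ * pd 0 V (0 + r • ev θ) + sin θ * pd 1 V (0 + r • ev θ)) with hb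
  have ca : Continuous a := by
    apply intervalIntegral.continuous_parametric_intervalIntegral_of_continuous'
    simp only [Function.uncurry_def]; fun_prop
  have cb : Continuous b := by
    apply intervalIntegral.continuous_parametric_intervalIntegral_of_continuous'
    simp only [Function.uncurry_def]; fun_prop
  have cL : Continuous (fun r : ℝ => r * ∫ θ in (-π)..π, lap V (0 + r • ev θ)) := by
    apply continuous_id.mul
    apply intervalIntegral.continuous_parametric_intervalIntegral_of_continuous'
    simp only [Function.uncurry_def]; fun_prop
  have key : ∀ r : ℝ, 0 ≤ r → - C0 ≤ r * b r := by
    intro r hr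
    have h1 := intervalIntegral.integral_eq_sub_of_hasDerivAt_of_le hr (f := fun r => r * b r)
      (by fun_prop) (fun s hs => (eng s hs.1.ne').2) (cL.intervalIntegrable _ _)
    have h2 := hm r
    rw [polar_ball cg 0 hr] at h2
    have h3 : (∫ s in (0:ℝ)..r, s * ∫ θ in (-π)..π, lap V (0 + s • ev θ)) = - ∫ s in (0:ℝ)..r, ∫ θ in (-π)..π, s * g (0 + s • ev θ) := by
      rw [← intervalIntegral.integral_neg]
      congr 1; funext s
      rw [intervalIntegral.integral_const_mul, ← mul_neg, ← intervalIntegral.integral_neg]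
      simp only [hl]
    rw [h3] at h1
    simp only [zero_mul, sub_zero] at h1
    linarith
  have hmono : MonotoneOn (fun r => a r + C0 * Real.log r) (Set.Icc 1 r) := by
    apply monotoneOn_of_hasDerivWithinAt_nonneg (convex_Icc 1 r) (f' := fun r => b r + C0 * r⁻¹)
    · apply ca.continuousOn.add
      apply continuousOn_const.mul
      exact Real.continuousOn_log.mono fun s hs => by simp; linarith [hs.1]
    · intro s hs
      rw [interior_Icc] at hs
      have hs0 : s ≠ 0 := by linarith [hs.1]
      exact ((eng s hs0).1.add ((Real.hasDerivAt_log hs0).const_mul C0)).hasDerivWithinAt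
    · intro s hs
      rw [interior_Icc] at hs
      have hs0 : 0 < s := by linarith [hs.1]
      have := key s hs0.le
      have e : b s + C0 * s⁻¹ = (s * b s + C0) * s⁻¹ := by field_simp
      rw [e]
      exact mul_nonneg (by linarith) (by positivity)
  have := hmono (Set.left_mem_Icc.2 hr) (Set.right_mem_Icc.2 hr) hr
  simp only [Real.log_one, mul_zero, add_zero] at this
  have hp := pi_pos
  have e1 : cav 0 1 V = a 1 / (2 * π) := rfl
  have e2 : cav 0 r V = a r / (2 * π) := rfl
  rw [e1, e2]
  have : a 1 / (2 * π) ≤ (a r + C0 * Real.log r) / (2 * π) := by gcongr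
  calc _ ≤ _ := this
    _ = _ := by ring

lemma TR_bound2 (i : Fin 2) {R s : ℝ} (hR : 0 < R) (hs : 0 < s) {f h : E2 → ℝ} (hf : Continuous f) (hh : Continuous h) {c : E2}
    (h1 : ∀ x, |h x| ≤ 1) :
    |TR i R f h c| ≤ 4 / (π * R ^ 3) * (∫ x in ball c R, |f x|) + s + 1 / (2 * π * s) * ∫ x in ball c R, |h x| := by
  have hp := pi_pos
  have ce := continuous_ev
  have cev : Continuous fun θ => ev θ i := by fun_prop
  have hpi : -π ≤ π := by linarith
  have A : |∫ r in (0:ℝ)..R, ∫ θ in (-π)..π,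
    (8 * r ^ 2 / R ^ 4 * f (c + r • ev θ) + (1 - r ^ 2 / R ^ 2) ^ 2 * h (c + r • ev θ)) * ev θ i|
     ≤ ∫ r in (0:ℝ)..R, ((8 / R ^ 3 * ∫ θ in (-π)..π, r * |f (c + r • ev θ)|) + (1 / s * ∫ θ in (-π)..π, r * |h (c + r • ev θ)|) + 2 * π * exp (-(1 / s) * r)) := by
    have cI : Continuous (fun r : ℝ => ∫ θ in (-π)..π,
        (8 * r ^ 2 / R ^ 4 * f (c + r • ev θ) + (1 - r ^ 2 / R ^ 2) ^ 2 * h (c + r • ev θ)) * ev θ i) := by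
      apply intervalIntegral.continuous_parametric_intervalIntegral_of_continuous'
      simp only [Function.uncurry_def]; fun_prop
    have cF : Continuous (fun r : ℝ => ∫ θ in (-π)..π, r * |f (c + r • ev θ)|) := by
      apply intervalIntegral.continuous_parametric_intervalIntegral_of_continuous'
      simp only [Function.uncurry_def]; fun_prop
    have cH : Continuous (fun r : ℝ => ∫ θ in (-π)..π, r * |h (c + r • ev θ)|) := by
      apply intervalIntegral.continuous_parametric_intervalIntegral_of_continuous'
      simp only [Function.uncurry_def]; fun_prop
    refine (intervalIntegral.abs_integral_le_integral_abs hR.le).trans ?_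
    refine intervalIntegral.integral_mono_on hR.le (cI.abs.intervalIntegrable _ _) (Continuous.intervalIntegrable (by fun_prop) _ _) ?_
    intro r hr
    have e2 : (2 * π * exp (-(1 / s) * r)) = ∫ θ in (-π)..π, exp (-(1 / s) * r) := by simp; ring
    rw [e2, ← intervalIntegral.integral_const_mul, ← intervalIntegral.integral_const_mul, ← intervalIntegral.integral_add (Continuous.intervalIntegrable (by fun_prop) _ _) (Continuous.intervalIntegrable (by fun_prop) _ _), ← intervalIntegral.integral_add (Continuous.intervalIntegrable (by fun_prop) _ _) (Continuous.intervalIntegrable (by fun_prop) _ _)]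
    refine (intervalIntegral.abs_integral_le_integral_abs hpi).trans ?_
    refine intervalIntegral.integral_mono_on hpi (Continuous.intervalIntegrable (by fun_prop) _ _) (Continuous.intervalIntegrable (by fun_prop) _ _) ?_
    intro θ _
    rw [abs_mul]
    have hr0 := hr.1
    have hrR := hr.2
    have q1 : r ^ 2 / R ^ 2 ≤ 1 := by
      rw [div_le_one (by positivity)]; exact pow_le_pow_left₀ hr.1 hr.2 2
    have q2 : 0 ≤ r ^ 2 / R ^ 2 := by positivity
    set F := f (c + r • ev θ)
    set H := h (c + r • ev θ)
    have hH : |H| ≤ 1 := h1 _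
    have s1 : |8 * r ^ 2 / R ^ 4 * F| ≤ 8 / R ^ 3 * (r * |F|) := by
      rw [abs_mul, abs_of_nonneg (by positivity)]
      have : 8 * r ^ 2 / R ^ 4 ≤ 8 / R ^ 3 * r := by
        rw [div_mul_eq_mul_div, div_le_div_iff₀ (by positivity) (by positivity)]
        have : r * R ^ 3 * r ≤ r * R ^ 3 * R := by gcongr
        nlinarith
      calc _ ≤ 8 / R ^ 3 * r * |F| := by gcongr
        _ = _ := by ring
    have s2 : |(1 - r ^ 2 / R ^ 2) ^ 2 * H| ≤ |H| := by
      rw [abs_mul, abs_of_nonneg (by positivity)]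
      have : (1 - r ^ 2 / R ^ 2) ^ 2 ≤ 1 := by nlinarith
      calc _ ≤ 1 * |H| := by gcongr
        _ = _ := one_mul _
    have s3 : |H| ≤ 1 / s * (r * |H|) + exp (-(1 / s) * r) := by
      have h4 := add_one_le_exp (-(1 / s) * r)
      have h5 : 0 < exp (-(1 / s) * r) := exp_pos _
      have h6 : |H| * (1 - 1 / s * r) ≤ exp (-(1 / s) * r) := by
        by_cases hh : 0 ≤ 1 - 1 / s * r
        · calc |H| * (1 - 1 / s * r) ≤ 1 * (1 - 1 / s * r) := by gcongr
            _ ≤ _ := by linarith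
        · have := mul_nonpos_of_nonneg_of_nonpos (abs_nonneg H) (not_le.1 hh).le
          linarith
      linarith [h6]
    calc _ ≤ |8 * r ^ 2 / R ^ 4 * F + (1 - r ^ 2 / R ^ 2) ^ 2 * H| * 1 := by
          gcongr; exact abs_ev_le θ i
      _ ≤ |8 * r ^ 2 / R ^ 4 * F| + |(1 - r ^ 2 / R ^ 2) ^ 2 * H| := by
          rw [mul_one]; exact abs_add_le _ _
      _ ≤ _ := by linarith
  have cF : Continuous (fun r : ℝ => ∫ θ in (-π)..π, r * |f (c + r • ev θ)|) := by
      apply intervalIntegral.continuous_parametric_intervalIntegral_of_continuous'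
      simp only [Function.uncurry_def]; fun_prop
  have cH : Continuous (fun r : ℝ => ∫ θ in (-π)..π, r * |h (c + r • ev θ)|) := by
      apply intervalIntegral.continuous_parametric_intervalIntegral_of_continuous'
      simp only [Function.uncurry_def]; fun_prop
  rw [intervalIntegral.integral_add (Continuous.intervalIntegrable (by fun_prop) _ _) (Continuous.intervalIntegrable (by fun_prop) _ _), intervalIntegral.integral_add (Continuous.intervalIntegrable (by fun_prop) _ _) (Continuous.intervalIntegrable (by fun_prop) _ _), intervalIntegral.integral_const_mul, intervalIntegral.integral_const_mul, intervalIntegral.integral_const_mul, ← polar_ball hf.abs c hR.le, ← polar_ball hh.abs c hR.le] at A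
  have E : ∫ r in (0:ℝ)..R, exp (-(1 / s) * r) ≤ s := by
    have := intervalIntegral.integral_eq_sub_of_hasDerivAt (a := 0) (b := R) (f := fun r : ℝ => -s * exp (-(1 / s) * r)) (f' := fun r => exp (-(1 / s) * r))
      (fun r _ => by
        have := (((hasDerivAt_id r).const_mul (-(1 / s))).exp).const_mul (-s)
        refine this.congr_deriv ?_
        simp; field_simp) (Continuous.intervalIntegrable (by fun_prop) _ _)
    rw [this]
    have : 0 < s * exp (-(1 / s) * R) := by positivity
    simp; simpa using this.le
  unfold TR
  rw [abs_mul, abs_of_pos (by positivity)]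
  calc _ ≤ 1 / (2 * π) * (8 / R ^ 3 * (∫ y in ball c R, |f y|) + (1 / s * ∫ y in ball c R, |h y|) + 2 * π * s) := by
        gcongr
        exact A.trans (by gcongr)
    _ = _ := by field_simp; ring

/-- decay at infinity -/
def Dec (f : E2 → ℝ) : Prop := Tendsto f (cocompact E2) (𝓝 0)

lemma Dec_iff {f : E2 → ℝ} : Dec f ↔ ∀ η > 0, ∃ R0 : ℝ, ∀ c : E2, R0 ≤ ‖c‖ → |f c| < η := by
  unfold Dec
  rw [Metric.tendsto_nhds]
  refine forall₂_congr fun η hη => ?_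
  rw [← Metric.cobounded_eq_cocompact, ← comap_norm_atTop, eventually_comap, eventually_atTop]
  constructor
  · rintro ⟨a, h⟩
    exact ⟨a, fun c hc => by simpa using h ‖c‖ hc c rfl⟩
  · rintro ⟨a, h⟩
    exact ⟨a, fun b hb c hc => by simpa using h c (by rw [hc]; exact hb)⟩

lemma mass_diff {g : E2 → ℝ} (hg : Continuous g) (hg0 : ∀ x, 0 ≤ g x) {C0 : ℝ}
    (hm : ∀ R : ℝ, ∫ x in ball (0:E2) R, g x ≤ C0) :
    Tendsto (fun R : ℝ => (∫ x in ball (0:E2) (3 * R), g x) - ∫ x in ball (0:E2) R, g x) atTop (𝓝 0) := by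
  have hmono : Monotone fun R : ℝ => ∫ x in ball (0:E2) R, g x := by
    intro a b hab
    exact setIntegral_mono_set (intOn_ball hg 0 b) (Eventually.of_forall hg0) (ball_subset_ball hab).eventuallyLE
  have h1 := tendsto_atTop_ciSup hmono ⟨C0, by rintro _ ⟨R, rfl⟩; exact hm R⟩
  have h2 := h1.comp (tendsto_id.const_mul_atTop (show (0:ℝ) < 3 by norm_num))
  simpa using h2.sub h1

lemma grad_decay {f h g : E2 → ℝ} (hf : ContDiff ℝ 2 f) (hl : ∀ x, lap f x = - h x) (hh : Continuous h)
    (hg : Continuous g) (hg1 : ∀ x, g x ≤ 1) (hhg : ∀ x, |h x| ≤ g x) {C0 : ℝ}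
    (hm : ∀ R : ℝ, ∫ x in ball (0:E2) R, g x ≤ C0)
    (hfi : Tendsto (fun r : ℝ => (∫ x in ball (0:E2) r, |f x|) / r ^ 3) atTop (𝓝 0)) (i : Fin 2) : Dec (pd i f) := by
  rw [Dec_iff]
  intro η hη
  have hp := pi_pos
  have hg0 : ∀ x, 0 ≤ g x := fun x => (abs_nonneg _).trans (hhg x)
  have t1 : Tendsto (fun R : ℝ => 108 / π * ((∫ x in ball (0:E2) (3 * R), |f x|) / (3 * R) ^ 3)) atTop (𝓝 (108 / π * 0)) :=
    (hfi.comp (tendsto_id.const_mul_atTop (show (0:ℝ) < 3 by norm_num))).const_mul _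
  have t2 := (mass_diff hg hg0 hm).const_mul (1 / (2 * π * (η / 3)))
  rw [mul_zero] at t1 t2
  have e1 := t1.eventually (gt_mem_nhds (show 0 < η / 3 by positivity))
  have e2 := t2.eventually (gt_mem_nhds (show 0 < η / 3 by positivity))
  obtain ⟨R0, hR0⟩ := eventually_atTop.1 (e1.and e2)
  refine ⟨max (2 * R0) 1, fun c hc => ?_⟩
  set R := ‖c‖ / 2 with hRd
  have hR : 0 < R := by have := le_max_right (2 * R0) 1; rw [hRd]; linarith
  have hRR : R0 ≤ R := by have := le_max_left (2 * R0) 1; rw [hRd]; linarith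
  obtain ⟨q1, q2⟩ := hR0 R hRR
  have hsub : ball c R ⊆ ball 0 (3 * R) := by
    apply ball_subset_ball'
    rw [dist_zero_right, hRd]; linarith
  have hsub2 : ball c R ⊆ ball 0 (3 * R) \ ball 0 R := by
    intro y hy
    refine ⟨hsub hy, ?_⟩
    rw [mem_ball_zero_iff, not_lt]
    rw [mem_ball, dist_eq_norm] at hy
    have := norm_sub_norm_le c y
    rw [← norm_sub_rev] at hy
    rw [hRd] at *; linarith
  have b1 : ∫ x in ball c R, |f x| ≤ ∫ x in ball (0:E2) (3 * R), |f x| :=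
    setIntegral_mono_set (intOn_ball hf.continuous.abs 0 _) (Eventually.of_forall fun _ => abs_nonneg _) hsub.eventuallyLE
  have b2 : ∫ x in ball c R, |h x| ≤ (∫ x in ball (0:E2) (3 * R), g x) - ∫ x in ball (0:E2) R, g x := by
    rw [← integral_diff measurableSet_ball (intOn_ball hg 0 _) (ball_subset_ball (by linarith))]
    calc _ ≤ ∫ x in ball c R, g x := setIntegral_mono_on (intOn_ball hh.abs c R) (intOn_ball hg c R) measurableSet_ball fun x _ => hhg x
      _ ≤ _ := setIntegral_mono_set ((intOn_ball hg 0 _).mono_set Set.diff_subset) (Eventually.of_forall hg0) hsub2.eventuallyLE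
  have e : (fun x => - lap f x) = h := by funext x; rw [hl]; ring
  rw [grad_formula hf c hR i, e]
  refine (TR_bound2 i hR (s := η / 3) (by positivity) hf.continuous hh (fun x => (hhg x).trans (hg1 x))).trans_lt ?_
  have b3 : 4 / (π * R ^ 3) * (∫ x in ball c R, |f x|) < η / 3 := by
    calc _ ≤ 4 / (π * R ^ 3) * ∫ x in ball (0:E2) (3 * R), |f x| := by gcongr
      _ = 108 / π * ((∫ x in ball (0:E2) (3 * R), |f x|) / (3 * R) ^ 3) := by field_simp; norm_num; ring
      _ < _ := q1
  have b4 : 1 / (2 * π * (η / 3)) * (∫ x in ball c R, |h x|) < η / 3 := by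
    refine lt_of_le_of_lt ?_ q2
    gcongr
  linarith

lemma V_int {V : E2 → ℝ} (hV : ContDiff ℝ 2 V) (hl : ∀ x, lap V x = - exp (V x)) (hV0 : ∀ x, V x ≤ 0) (h0 : V 0 = 0)
    {C0 : ℝ} (hm : ∀ R : ℝ, ∫ x in ball (0:E2) R, exp (V x) ≤ C0) :
    Tendsto (fun r : ℝ => (∫ x in ball (0:E2) r, |V x|) / r ^ 3) atTop (𝓝 0) := by
  have hp := pi_pos
  have cV := hV.continuous
  have hC0 : 0 ≤ C0 := by simpa using hm 0
  have hneg : (fun x => |V x|) = fun x => - V x := by funext x; exact abs_of_nonpos (hV0 x)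
  have hsm : ∀ s : ℝ, 0 ≤ s → - (s ^ 2 / 4) ≤ cav 0 s V := by
    intro s hs
    have := mean_ineq_global hV 0 (Λ := 1) hs (fun x _ => by rw [hl]; have := exp_le_one_iff.2 (hV0 x); linarith)
    rw [h0] at this; linarith
  have hcav : ∀ r : ℝ, 1 ≤ r → ∀ s ∈ Set.Icc 0 r, 2 * π * s * cav 0 s (fun x => |V x|) ≤ 2 * π * r * (1 / 4 + C0 / (2 * π) * Real.log r) := by
    intro r hr s hs
    have e : cav 0 s (fun x => |V x|) = - cav 0 s V := by rw [hneg]; exact cav_neg _ _ _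
    rw [e]
    have hlr : 0 ≤ Real.log r := Real.log_nonneg hr
    have h5 : 0 ≤ C0 / (2 * π) * Real.log r := by positivity
    have h6 : - cav 0 s V ≤ 1 / 4 + C0 / (2 * π) * Real.log r := by
      by_cases h1 : s ≤ 1
      · have := hsm s hs.1
        have : s ^ 2 ≤ 1 := by nlinarith [hs.1]
        linarith
      · have h2 := cav_growth hV hl hm (not_le.1 h1).le
        have h3 := hsm 1 zero_le_one
        have h4 : C0 / (2 * π) * Real.log s ≤ C0 / (2 * π) * Real.log r := by
          have : Real.log s ≤ Real.log r := Real.log_le_log (by linarith) hs.2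
          gcongr
        linarith
    have hs0 := hs.1
    have hs1 := hs.2
    calc _ ≤ 2 * π * s * (1 / 4 + C0 / (2 * π) * Real.log r) := by gcongr
      _ ≤ _ := by gcongr
  have hb : ∀ r : ℝ, 1 ≤ r → (∫ x in ball (0:E2) r, |V x|) / r ^ 3 ≤ 2 * π * (1 / 4 / r + C0 / (2 * π) * (Real.log r / r)) := by
    intro r hr
    have hr0 : 0 < r := by linarith
    rw [polar_ball_cav cV.abs 0 hr0.le]
    have h1 : ∫ s in (0:ℝ)..r, 2 * π * s * cav 0 s (fun x => |V x|) ≤ ∫ s in (0:ℝ)..r, 2 * π * r * (1 / 4 + C0 / (2 * π) * Real.log r) := by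
      have cc := cav_continuous cV.abs 0
      exact intervalIntegral.integral_mono_on hr0.le (Continuous.intervalIntegrable (by fun_prop) _ _)
        (Continuous.intervalIntegrable (by fun_prop) _ _) (hcav r hr)
    rw [intervalIntegral.integral_const, smul_eq_mul, sub_zero] at h1
    rw [div_le_iff₀ (by positivity)]
    refine h1.trans (le_of_eq ?_)
    field_simp
  have hlim : Tendsto (fun r : ℝ => 2 * π * (1 / 4 / r + C0 / (2 * π) * (Real.log r / r))) atTop (𝓝 (2 * π * (0 + C0 / (2 * π) * 0))) := by
    refine ((tendsto_const_nhds.div_atTop tendsto_id).add (Tendsto.const_mul _ ?_)).const_mul _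
    have := Real.isLittleO_log_id_atTop
    exact this.tendsto_div_nhds_zero
  simp only [mul_zero, add_zero] at hlim
  refine squeeze_zero' ?_ ?_ hlim
  · filter_upwards [eventually_ge_atTop 0] with r hr
    have : 0 ≤ ∫ x in ball (0:E2) r, |V x| := integral_nonneg fun x => abs_nonneg _
    positivity
  · filter_upwards [eventually_ge_atTop 1] with r hr using hb r hr

lemma X_int {f : E2 → ℝ} (hf : Continuous f) (h1 : ∀ x, |f x| ≤ 1) :
    Tendsto (fun r : ℝ => (∫ x in ball (0:E2) r, |f x|) / r ^ 3) atTop (𝓝 0) := by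
  have hlim : Tendsto (fun r : ℝ => 2 * π / r) atTop (𝓝 0) := tendsto_const_nhds.div_atTop tendsto_id
  have hp := pi_pos
  refine squeeze_zero' ?_ ?_ hlim
  · filter_upwards [eventually_ge_atTop 0] with r hr
    have : 0 ≤ ∫ x in ball (0:E2) r, |f x| := integral_nonneg fun x => abs_nonneg _
    positivity
  · filter_upwards [eventually_ge_atTop 1] with r hr
    have hr0 : 0 < r := by linarith
    rw [polar_ball_cav hf.abs 0 hr0.le]
    have h1 : ∫ s in (0:ℝ)..r, 2 * π * s * cav 0 s (fun x => |f x|) ≤ ∫ s in (0:ℝ)..r, 2 * π * r := by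
      have cc := cav_continuous hf.abs 0
      refine intervalIntegral.integral_mono_on hr0.le (Continuous.intervalIntegrable (by fun_prop) _ _)
        (Continuous.intervalIntegrable (by fun_prop) _ _) fun s hs => ?_
      have hs0 := hs.1
      have hs1 := hs.2
      have h3 : cav 0 s (fun x => |f x|) ≤ 1 := by
        have ce := continuous_ev
        unfold cav
        rw [div_le_one (by positivity)]
        have := intervalIntegral.integral_mono_on (μ := volume) (a := -π) (b := π) (by linarith [pi_pos]) (f := fun θ => |f (0 + s • ev θ)|) (g := fun _ => 1)
          (Continuous.intervalIntegrable (by fun_prop) _ _) (Continuous.intervalIntegrable (by fun_prop) _ _) (fun θ _ => h1 _)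
        simp at this
        simp; linarith
      calc _ ≤ 2 * π * s * 1 := by gcongr
        _ ≤ _ := by rw [mul_one]; gcongr
    rw [intervalIntegral.integral_const, smul_eq_mul, sub_zero] at h1
    rw [div_le_iff₀ (by positivity)]
    refine h1.trans (le_of_eq ?_)
    field_simp

lemma TR_decay (i : Fin 2) {f h : E2 → ℝ} (hf : Dec f) (hh : Dec h) : Dec (TR i 1 f h) := by
  rw [Dec_iff] at *
  intro η hη
  obtain ⟨A, hA⟩ := hf (η / 10) (by positivity)
  obtain ⟨B, hB⟩ := hh (η / 10) (by positivity)
  refine ⟨max A B + 1, fun c hc => ?_⟩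
  have key : ∀ x ∈ closedBall c 1, max A B ≤ ‖x‖ := by
    intro x hx
    rw [mem_closedBall, dist_eq_norm, norm_sub_rev] at hx
    linarith [norm_sub_norm_le c x]
  have := TR_bound i (R := 1) (A := η / 10) (B := η / 10) one_pos (f := f) (h := h) (c := c)
    (fun x hx => (hA x ((le_max_left _ _).trans (key x hx))).le) (fun x hx => (hB x ((le_max_right _ _).trans (key x hx))).le)
  linarith

lemma pd_of {f : E2 → ℝ} {L : E2 →L[ℝ] ℝ} {x : E2} (h : HasFDerivAt f L x) (j : Fin 2) : pd j f x = L (EuclideanSpace.single j 1) := by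
  simp only [pd]; rw [h.fderiv]

lemma pd_add' {f g : E2 → ℝ} (hf : ContDiff ℝ 1 f) (hg : ContDiff ℝ 1 g) (j : Fin 2) (x : E2) :
    pd j (fun x => f x + g x) x = pd j f x + pd j g x := by
  have h : HasFDerivAt (fun x => f x + g x) (fderiv ℝ f x + fderiv ℝ g x) x :=
    (hf.differentiable (by norm_num) x).hasFDerivAt.add (hg.differentiable (by norm_num) x).hasFDerivAt
  rw [pd_of h]; rfl

lemma pd_sub' {f g : E2 → ℝ} (hf : ContDiff ℝ 1 f) (hg : ContDiff ℝ 1 g) (j : Fin 2) (x : E2) :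
    pd j (fun x => f x - g x) x = pd j f x - pd j g x := by
  have h : HasFDerivAt (fun x => f x - g x) (fderiv ℝ f x - fderiv ℝ g x) x :=
    (hf.differentiable (by norm_num) x).hasFDerivAt.sub (hg.differentiable (by norm_num) x).hasFDerivAt
  rw [pd_of h]; rfl

lemma pd_mul' {f g : E2 → ℝ} (hf : ContDiff ℝ 1 f) (hg : ContDiff ℝ 1 g) (j : Fin 2) (x : E2) :
    pd j (fun x => f x * g x) x = pd j f x * g x + f x * pd j g x :=
  pd_mul isOpen_univ hf.contDiffOn hg.contDiffOn j (Set.mem_univ x)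

lemma pd_cmul (a : ℝ) {f : E2 → ℝ} (hf : ContDiff ℝ 1 f) (j : Fin 2) (x : E2) :
    pd j (fun x => a * f x) x = a * pd j f x := by
  have h : HasFDerivAt (fun x => a * f x) (a • fderiv ℝ f x) x :=
    (hf.differentiable (by norm_num) x).hasFDerivAt.const_mul a
  rw [pd_of h]; rfl

lemma pd_exp {f : E2 → ℝ} (hf : ContDiff ℝ 1 f) (j : Fin 2) (x : E2) :
    pd j (fun x => exp (f x)) x = exp (f x) * pd j f x := by
  have h : HasFDerivAt (fun x => exp (f x)) (exp (f x) • fderiv ℝ f x) x :=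
    (hf.differentiable (by norm_num) x).hasFDerivAt.exp
  rw [pd_of h]; rfl

lemma pd_const (a : ℝ) (j : Fin 2) (x : E2) : pd j (fun _ => a) x = 0 := by
  rw [pd_of (hasFDerivAt_const a x)]; rfl

lemma coord_contDiff (i : Fin 2) {n : WithTop ℕ∞} : ContDiff ℝ n (fun z : E2 => z i) := by fun_prop

lemma pd_coord (i j : Fin 2) (x : E2) : pd j (fun z : E2 => z i) x = if i = j then 1 else 0 := by
  have h : HasFDerivAt (fun z : E2 => z i) (EuclideanSpace.proj i : E2 →L[ℝ] ℝ) x := (EuclideanSpace.proj i : E2 →L[ℝ] ℝ).hasFDerivAt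
  rw [pd_of h]; simp [Pi.single_apply]

lemma const_of_pd {f : E2 → ℝ} (hf : ContDiff ℝ 1 f) (h0 : ∀ x, pd 0 f x = 0) (h1 : ∀ x, pd 1 f x = 0) (x : E2) : f x = f 0 := by
  apply is_const_of_fderiv_eq_zero (𝕜 := ℝ) (hf.differentiable (by norm_num))
  intro y
  ext v
  rw [fderiv_coord, h0, h1]; simp

lemma liouv {P Q : E2 → ℝ} (hP : ContDiff ℝ 1 P) (hQ : ContDiff ℝ 1 Q) (h1 : ∀ x, pd 0 P x = pd 1 Q x)
    (h2 : ∀ x, pd 1 P x = - pd 0 Q x) (dP : Dec P) (dQ : Dec Q) : (∀ x, P x = 0) ∧ ∀ x, Q x = 0 := by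
  let e := Complex.orthonormalBasisOneI.repr
  have eI : e Complex.I = EuclideanSpace.single 1 1 := by
    ext i; fin_cases i <;> simp [e]
  have e1 : e 1 = EuclideanSpace.single 0 1 := by
    ext i; fin_cases i <;> simp [e]
  let f : ℂ → ℂ := fun z => (P (e z) : ℂ) + Complex.I * (Q (e z) : ℂ)
  have hd : ∀ z, HasFDerivAt f ((Complex.ofRealCLM.comp ((fderiv ℝ P (e z)).comp (e.toContinuousLinearEquiv : ℂ →L[ℝ] E2))) +
      Complex.I • (Complex.ofRealCLM.comp ((fderiv ℝ Q (e z)).comp (e.toContinuousLinearEquiv : ℂ →L[ℝ] E2)))) z := by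
    intro z
    have he : HasFDerivAt (fun z => e z) (e.toContinuousLinearEquiv : ℂ →L[ℝ] E2) z := e.toContinuousLinearEquiv.hasFDerivAt
    have a := Complex.ofRealCLM.hasFDerivAt.comp z ((hP.differentiable (by norm_num) (e z)).hasFDerivAt.comp z he)
    have b := Complex.ofRealCLM.hasFDerivAt.comp z ((hQ.differentiable (by norm_num) (e z)).hasFDerivAt.comp z he)
    exact a.add (b.const_mul Complex.I)
  have hdiff : Differentiable ℂ f := by
    intro z
    rw [differentiableAt_complex_iff_differentiableAt_real]
    refine ⟨(hd z).differentiableAt, ?_⟩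
    rw [(hd z).fderiv]
    have p0 := h1 (e z)
    have p1 := h2 (e z)
    simp only [pd] at p0 p1
    simp [eI, e1, p0, p1]
    ring_nf
    simp
  have hte : Tendsto e (cocompact ℂ) (cocompact E2) := e.toHomeomorph.isClosedEmbedding.tendsto_cocompact
  have ht : Tendsto f (cocompact ℂ) (𝓝 0) := by
    have a : Tendsto (fun z => (P (e z) : ℂ)) (cocompact ℂ) (𝓝 ((0:ℝ):ℂ)) := (Complex.continuous_ofReal.tendsto 0).comp (dP.comp hte)
    have b : Tendsto (fun z => (Q (e z) : ℂ)) (cocompact ℂ) (𝓝 ((0:ℝ):ℂ)) := (Complex.continuous_ofReal.tendsto 0).comp (dQ.comp hte)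
    simpa using a.add (b.const_mul Complex.I)
  have hz : ∀ z, f z = 0 := fun z => hdiff.apply_eq_of_tendsto_cocompact z ht
  have key : ∀ x, P x = 0 ∧ Q x = 0 := by
    intro x
    have := hz (e.symm x)
    simp only [f, LinearIsometryEquiv.apply_symm_apply] at this
    have r := congrArg Complex.re this
    have i := congrArg Complex.im this
    simp at r i
    exact ⟨r, i⟩
  exact ⟨fun x => (key x).1, fun x => (key x).2⟩

lemma poly {X : E2 → ℝ} (hX : ContDiff ℝ 2 X) (hC : ∀ i j, ContDiff ℝ 1 (pd j (pd i X)))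
    (h1 : ∀ x, pd 1 (pd 0 X) x = 0) (h2 : ∀ x, pd 0 (pd 0 X) x = pd 1 (pd 1 X) x) (z : E2) :
    X z = X 0 + pd 0 X 0 * z 0 + pd 1 X 0 * z 1 + pd 0 (pd 0 X) 0 / 2 * (z 0 * z 0 + z 1 * z 1) := by
  have hX1 : ContDiff ℝ 1 X := hX.of_le (by norm_num)
  have hp1 : ∀ i, ContDiff ℝ 1 (pd i X) := fun i => pd_contDiff1 hX i
  have hp2 : ∀ i, ContDiff ℝ 2 (pd i X) := fun i => contDiff2_of_pd (hp1 i) (hC i)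
  have z1 : pd 1 (pd 0 X) = fun _ => 0 := funext h1
  have e2 : pd 0 (pd 0 X) = pd 1 (pd 1 X) := funext h2
  have z2 : pd 0 (pd 1 X) = fun _ => 0 := by rw [pd_comm hX]; exact z1
  set k := pd 0 (pd 0 X) 0
  have hk : ∀ x, pd 0 (pd 0 X) x = k := by
    intro x
    refine const_of_pd (hC 0 0) (fun x => ?_) (fun x => ?_) x
    · rw [e2, pd_comm (hp2 1) 0 1, z2, pd_const]
    · rw [pd_comm (hp2 0) 1 0, z1, pd_const]
  have hk1 : ∀ x, pd 1 (pd 1 X) x = k := fun x => by rw [← h2, hk]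
  have c0 : ContDiff ℝ 1 (fun z : E2 => z 0) := coord_contDiff 0
  have c1 : ContDiff ℝ 1 (fun z : E2 => z 1) := coord_contDiff 1
  have X0 : ∀ x, pd 0 X x = pd 0 X 0 + k * x 0 := by
    intro x
    have := const_of_pd (f := fun x => pd 0 X x - k * x 0) ((hp1 0).sub (contDiff_const.mul c0))
      (fun x => by rw [pd_sub' (hp1 0) (contDiff_const.mul c0), pd_cmul k c0, pd_coord, hk]; simp)
      (fun x => by rw [pd_sub' (hp1 0) (contDiff_const.mul c0), pd_cmul k c0, pd_coord, h1]; simp) x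
    simp at this; linarith
  have X1 : ∀ x, pd 1 X x = pd 1 X 0 + k * x 1 := by
    intro x
    have := const_of_pd (f := fun x => pd 1 X x - k * x 1) ((hp1 1).sub (contDiff_const.mul c1))
      (fun x => by rw [pd_sub' (hp1 1) (contDiff_const.mul c1), pd_cmul k c1, pd_coord, z2]; simp)
      (fun x => by rw [pd_sub' (hp1 1) (contDiff_const.mul c1), pd_cmul k c1, pd_coord, hk1]; simp) x
    simp at this; linarith
  have cA : ContDiff ℝ 1 (fun z : E2 => pd 0 X 0 * z 0) := contDiff_const.mul c0
  have cB : ContDiff ℝ 1 (fun z : E2 => pd 1 X 0 * z 1) := contDiff_const.mul c1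
  have cC : ContDiff ℝ 1 (fun z : E2 => k / 2 * (z 0 * z 0 + z 1 * z 1)) := contDiff_const.mul ((c0.mul c0).add (c1.mul c1))
  have hpd : ∀ j x, pd j (fun z => X z - (pd 0 X 0 * z 0 + pd 1 X 0 * z 1 + k / 2 * (z 0 * z 0 + z 1 * z 1))) x = 
      pd j X x - (pd 0 X 0 * pd j (fun z : E2 => z 0) x + pd 1 X 0 * pd j (fun z : E2 => z 1) x + k / 2 * ((pd j (fun z : E2 => z 0) x * x 0 + x 0 * pd j (fun z : E2 => z 0) x) + (pd j (fun z : E2 => z 1) x * x 1 + x 1 * pd j (fun z : E2 => z 1) x))) := by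
    intro j x
    rw [pd_sub' hX1 ((cA.add cB).add cC), pd_add' (cA.add cB) cC, pd_add' cA cB, pd_cmul _ c0, pd_cmul _ c1, pd_cmul _ ((c0.mul c0).add (c1.mul c1)),
      pd_add' (c0.mul c0) (c1.mul c1), pd_mul' c0 c0, pd_mul' c1 c1]
  have := const_of_pd (f := fun z => X z - (pd 0 X 0 * z 0 + pd 1 X 0 * z 1 + k / 2 * (z 0 * z 0 + z 1 * z 1))) (hX1.sub ((cA.add cB).add cC))
    (fun x => by rw [hpd, pd_coord, pd_coord, X0]; simp; ring) (fun x => by rw [hpd, pd_coord, pd_coord, X1]; simp; ring) z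
  simp at this; linarith

lemma reg3 {f h : E2 → ℝ} (hf : ContDiff ℝ 2 f) (hh : ContDiff ℝ 2 h) (hl : ∀ x, lap f x = - h x) :
    (∀ i j, ContDiff ℝ 1 (pd j (pd i f))) ∧ ∀ i j, pd j (pd i f) = TR i 1 (pd j f) (pd j h) := by
  have e : (fun x => - lap f x) = h := by funext x; rw [hl]; ring
  have g : ∀ i, pd i f = TR i 1 f h := by
    intro i; funext c; rw [grad_formula hf c one_pos i, e]
  have g2 : ∀ i j, pd j (pd i f) = TR i 1 (pd j f) (pd j h) := by
    intro i j
    rw [g i, (TR_contDiff1 i 1 (hf.of_le (by norm_num)) (hh.of_le (by norm_num))).2 j]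
  refine ⟨fun i j => ?_, g2⟩
  rw [g2]
  exact (TR_contDiff1 i 1 (pd_contDiff1 hf j) (pd_contDiff1 hh j)).1

lemma Dec.add' {f g : E2 → ℝ} (hf : Dec f) (hg : Dec g) : Dec (fun x => f x + g x) := by
  have := Filter.Tendsto.add hf hg; simpa [Dec] using this
lemma Dec.sub' {f g : E2 → ℝ} (hf : Dec f) (hg : Dec g) : Dec (fun x => f x - g x) := by
  have := Filter.Tendsto.sub hf hg; simpa [Dec] using this
lemma Dec.mul' {f g : E2 → ℝ} (hf : Dec f) (hg : Dec g) : Dec (fun x => f x * g x) := by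
  have := Filter.Tendsto.mul hf hg; simpa [Dec] using this
lemma Dec.cmul (a : ℝ) {f : E2 → ℝ} (hf : Dec f) : Dec (fun x => a * f x) := by
  have := Filter.Tendsto.const_mul a hf; simpa [Dec] using this
lemma Dec.bmul {f g : E2 → ℝ} (hf : Dec f) (hg : ∀ x, |g x| ≤ 1) : Dec (fun x => g x * f x) := by
  rw [Dec_iff] at *
  intro η hη
  obtain ⟨R, hR⟩ := hf η hη
  refine ⟨R, fun c hc => ?_⟩
  rw [abs_mul]
  calc _ ≤ 1 * |f c| := by gcongr; exact hg c
    _ < η := by rw [one_mul]; exact hR c hc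

theorem classify {V Ξ : E2 → ℝ} (hV : ContDiff ℝ 2 V) (hX : ContDiff ℝ 2 Ξ)
    (lV : ∀ x, lap V x = - exp (V x)) (lX : ∀ x, lap Ξ x = - (exp (V x) * Ξ x))
    (hV0 : ∀ x, V x ≤ 0) (h0 : V 0 = 0) (hX1 : ∀ x, |Ξ x| ≤ 1)
    {C0 : ℝ} (hm : ∀ R : ℝ, ∫ x in ball (0:E2) R, exp (V x) ≤ C0) :
    ∃ a : ℝ, ∃ b : Fin 2 → ℝ, ∀ z : E2, Ξ z = a * ((8 - ‖z‖ ^ 2) / (8 + ‖z‖ ^ 2)) + ∑ j : Fin 2, b j * z j / (8 + ‖z‖ ^ 2) := by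
  have V1 : ContDiff ℝ 1 V := hV.of_le (by norm_num)
  have X1 : ContDiff ℝ 1 Ξ := hX.of_le (by norm_num)
  have hE : ContDiff ℝ 2 (fun x => exp (V x)) := hV.exp
  have hE1 : ContDiff ℝ 1 (fun x => exp (V x)) := V1.exp
  have hEX : ContDiff ℝ 2 (fun x => exp (V x) * Ξ x) := hE.mul hX
  have le1 : ∀ x, exp (V x) ≤ 1 := fun x => exp_le_one_iff.2 (hV0 x)
  have ab1 : ∀ x, |exp (V x)| ≤ 1 := fun x => by rw [abs_of_pos (exp_pos _)]; exact le1 x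
  obtain ⟨cV, tV⟩ := reg3 hV hE lV
  obtain ⟨cX, tX⟩ := reg3 hX hEX lX
  have pV : ∀ i, ContDiff ℝ 1 (pd i V) := fun i => pd_contDiff1 hV i
  have pX : ∀ i, ContDiff ℝ 1 (pd i Ξ) := fun i => pd_contDiff1 hX i
  have pV2 : ∀ i, ContDiff ℝ 2 (pd i V) := fun i => contDiff2_of_pd (pV i) (cV i)
  have pX2 : ∀ i, ContDiff ℝ 2 (pd i Ξ) := fun i => contDiff2_of_pd (pX i) (cX i)
  have dV : ∀ i, Dec (pd i V) := fun i => grad_decay hV lV hE.continuous hE.continuous le1 (fun x => by rw [abs_of_pos (exp_pos _)]) hm (V_int hV lV hV0 h0 hm) i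
  have dX : ∀ i, Dec (pd i Ξ) := fun i => grad_decay hX lX hEX.continuous hE.continuous le1 (fun x => by
    rw [abs_mul, abs_of_pos (exp_pos _)]
    exact mul_le_of_le_one_right (exp_pos _).le (hX1 x)) hm (X_int hX.continuous hX1) i
  have dV2 : ∀ i j, Dec (pd j (pd i V)) := by
    intro i j
    rw [tV]
    apply TR_decay i (dV j)
    have : pd j (fun x => exp (V x)) = fun x => exp (V x) * pd j V x := funext fun x => pd_exp V1 j x
    rw [this]
    exact (dV j).bmul ab1
  have dX2 : ∀ i j, Dec (pd j (pd i Ξ)) := by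
    intro i j
    rw [tX]
    apply TR_decay i (dX j)
    have : pd j (fun x => exp (V x) * Ξ x) = fun x => exp (V x) * (Ξ x * pd j V x) + exp (V x) * pd j Ξ x := funext fun x => by
      rw [pd_mul' hE1 X1, pd_exp V1]; ring
    rw [this]
    exact (((dV j).bmul hX1).bmul ab1).add' ((dX j).bmul ab1)
  -- differentiated equations
  have eV : ∀ j x, pd j (pd 0 (pd 0 V)) x + pd j (pd 1 (pd 1 V)) x = - (exp (V x) * pd j V x) := by
    intro j x
    rw [← pd_add' (cV 0 0) (cV 1 1), ← pd_exp V1]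
    have : (fun x => pd 0 (pd 0 V) x + pd 1 (pd 1 V) x) = fun x => (-1) * exp (V x) := by
      funext x; rw [← lap_eq, lV]; ring
    rw [this, pd_cmul _ hE1]; ring
  have eX : ∀ j x, pd j (pd 0 (pd 0 Ξ)) x + pd j (pd 1 (pd 1 Ξ)) x = - (exp (V x) * pd j V x * Ξ x + exp (V x) * pd j Ξ x) := by
    intro j x
    rw [← pd_add' (cX 0 0) (cX 1 1), ← pd_exp V1, ← pd_mul' hE1 X1]
    have : (fun x => pd 0 (pd 0 Ξ) x + pd 1 (pd 1 Ξ) x) = fun x => (-1) * (exp (V x) * Ξ x) := by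
      funext x; rw [← lap_eq, lX]; ring
    rw [this, pd_cmul _ (hE1.mul X1)]; ring
  have sV : ∀ x, pd 0 (pd 0 V) x + pd 1 (pd 1 V) x = - exp (V x) := fun x => by rw [← lap_eq, lV]
  have sX : ∀ x, pd 0 (pd 0 Ξ) x + pd 1 (pd 1 Ξ) x = - (exp (V x) * Ξ x) := fun x => by rw [← lap_eq, lX]
  have kV : pd 0 (pd 1 V) = pd 1 (pd 0 V) := pd_comm hV 0 1
  have kX : pd 0 (pd 1 Ξ) = pd 1 (pd 0 Ξ) := pd_comm hX 0 1
  -- V Liouville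
  have LV := liouv (P := fun x => (pd 0 (pd 0 V) x - pd 1 (pd 1 V) x) - (1/2) * (pd 0 V x * pd 0 V x - pd 1 V x * pd 1 V x))
    (Q := fun x => pd 0 V x * pd 1 V x - 2 * pd 1 (pd 0 V) x)
    (((cV 0 0).sub (cV 1 1)).sub (contDiff_const.mul (((pV 0).mul (pV 0)).sub ((pV 1).mul (pV 1)))))
    (((pV 0).mul (pV 1)).sub (contDiff_const.mul (cV 0 1)))
    (fun x => by
      rw [pd_sub' ((cV 0 0).sub (cV 1 1)) (contDiff_const.mul (((pV 0).mul (pV 0)).sub ((pV 1).mul (pV 1)))),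
        pd_sub' (cV 0 0) (cV 1 1), pd_cmul _ (((pV 0).mul (pV 0)).sub ((pV 1).mul (pV 1))), pd_sub' ((pV 0).mul (pV 0)) ((pV 1).mul (pV 1)),
        pd_mul' (pV 0) (pV 0), pd_mul' (pV 1) (pV 1), pd_sub' ((pV 0).mul (pV 1)) (contDiff_const.mul (cV 0 1)), pd_mul' (pV 0) (pV 1), pd_cmul _ (cV 0 1)]
      have a := eV 0 x
      have b : pd 0 (pd 1 (pd 1 V)) x = pd 1 (pd 1 (pd 0 V)) x := by rw [pd_comm (pV2 1) 0 1, kV]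
      rw [kV]
      have c := sV x
      have d : pd 0 V x * (pd 0 (pd 0 V) x + pd 1 (pd 1 V) x) = pd 0 V x * (- exp (V x)) := by rw [c]
      linarith)
    (fun x => by
      rw [pd_sub' ((cV 0 0).sub (cV 1 1)) (contDiff_const.mul (((pV 0).mul (pV 0)).sub ((pV 1).mul (pV 1)))),
        pd_sub' (cV 0 0) (cV 1 1), pd_cmul _ (((pV 0).mul (pV 0)).sub ((pV 1).mul (pV 1))), pd_sub' ((pV 0).mul (pV 0)) ((pV 1).mul (pV 1)),
        pd_mul' (pV 0) (pV 0), pd_mul' (pV 1) (pV 1), pd_sub' ((pV 0).mul (pV 1)) (contDiff_const.mul (cV 0 1)), pd_mul' (pV 0) (pV 1), pd_cmul _ (cV 0 1)]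
      have a := eV 1 x
      have b : pd 1 (pd 0 (pd 0 V)) x = pd 0 (pd 1 (pd 0 V)) x := by rw [pd_comm (pV2 0) 0 1]
      rw [kV]
      have c := sV x
      have d : pd 1 V x * (pd 0 (pd 0 V) x + pd 1 (pd 1 V) x) = pd 1 V x * (- exp (V x)) := by rw [c]
      linarith)
    (((dV2 0 0).sub' (dV2 1 1)).sub' ((((dV 0).mul' (dV 0)).sub' ((dV 1).mul' (dV 1))).cmul _))
    (((dV 0).mul' (dV 1)).sub' ((dV2 0 1).cmul _))
  have LX := liouv (P := fun x => (pd 0 (pd 0 Ξ) x - pd 1 (pd 1 Ξ) x) - (pd 0 V x * pd 0 Ξ x - pd 1 V x * pd 1 Ξ x))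
    (Q := fun x => (pd 0 V x * pd 1 Ξ x + pd 1 V x * pd 0 Ξ x) - 2 * pd 1 (pd 0 Ξ) x)
    (((cX 0 0).sub (cX 1 1)).sub ((((pV 0).mul (pX 0)).sub ((pV 1).mul (pX 1)))))
    ((((pV 0).mul (pX 1)).add ((pV 1).mul (pX 0))).sub (contDiff_const.mul (cX 0 1)))
    (fun x => by
      rw [pd_sub' ((cX 0 0).sub (cX 1 1)) (((pV 0).mul (pX 0)).sub ((pV 1).mul (pX 1))),
        pd_sub' (cX 0 0) (cX 1 1), pd_sub' ((pV 0).mul (pX 0)) ((pV 1).mul (pX 1)),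
        pd_mul' (pV 0) (pX 0), pd_mul' (pV 1) (pX 1), pd_sub' (((pV 0).mul (pX 1)).add ((pV 1).mul (pX 0))) (contDiff_const.mul (cX 0 1)),
        pd_add' ((pV 0).mul (pX 1)) ((pV 1).mul (pX 0)), pd_mul' (pV 0) (pX 1), pd_mul' (pV 1) (pX 0), pd_cmul _ (cX 0 1)]
      have a := eX 0 x
      have b : pd 0 (pd 1 (pd 1 Ξ)) x = pd 1 (pd 1 (pd 0 Ξ)) x := by rw [pd_comm (pX2 1) 0 1, kX]
      rw [kV, kX]
      have d : pd 0 Ξ x * (pd 0 (pd 0 V) x + pd 1 (pd 1 V) x) = pd 0 Ξ x * (- exp (V x)) := by rw [sV x]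
      have d' : pd 0 V x * (pd 0 (pd 0 Ξ) x + pd 1 (pd 1 Ξ) x) = pd 0 V x * (- (exp (V x) * Ξ x)) := by rw [sX x]
      linarith)
    (fun x => by
      rw [pd_sub' ((cX 0 0).sub (cX 1 1)) (((pV 0).mul (pX 0)).sub ((pV 1).mul (pX 1))),
        pd_sub' (cX 0 0) (cX 1 1), pd_sub' ((pV 0).mul (pX 0)) ((pV 1).mul (pX 1)),
        pd_mul' (pV 0) (pX 0), pd_mul' (pV 1) (pX 1), pd_sub' (((pV 0).mul (pX 1)).add ((pV 1).mul (pX 0))) (contDiff_const.mul (cX 0 1)),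
        pd_add' ((pV 0).mul (pX 1)) ((pV 1).mul (pX 0)), pd_mul' (pV 0) (pX 1), pd_mul' (pV 1) (pX 0), pd_cmul _ (cX 0 1)]
      have a := eX 1 x
      have b : pd 1 (pd 0 (pd 0 Ξ)) x = pd 0 (pd 1 (pd 0 Ξ)) x := by rw [pd_comm (pX2 0) 0 1]
      rw [kV, kX]
      have d : pd 1 Ξ x * (pd 0 (pd 0 V) x + pd 1 (pd 1 V) x) = pd 1 Ξ x * (- exp (V x)) := by rw [sV x]
      have d' : pd 1 V x * (pd 0 (pd 0 Ξ) x + pd 1 (pd 1 Ξ) x) = pd 1 V x * (- (exp (V x) * Ξ x)) := by rw [sX x]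
      linarith)
    (((dX2 0 0).sub' (dX2 1 1)).sub' ((((dV 0).mul' (dX 0)).sub' ((dV 1).mul' (dX 1)))))
    ((((dV 0).mul' (dX 1)).add' ((dV 1).mul' (dX 0))).sub' ((dX2 0 1).cmul _))
  obtain ⟨LV1, LV2⟩ := LV
  obtain ⟨LX1, LX2⟩ := LX
  -- ψ
  set ψ : E2 → ℝ := fun x => exp (-(1/2) * V x) with hψ
  have cψ : ContDiff ℝ 2 ψ := (contDiff_const.mul hV).exp
  have cψ1 : ContDiff ℝ 1 ψ := (contDiff_const.mul V1).exp
  have ψp : ∀ i, pd i ψ = fun x => ψ x * (-(1/2) * pd i V x) := fun i => funext fun x => by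
    rw [hψ, pd_exp (contDiff_const.mul V1), pd_cmul _ V1]
  have ψpp : ∀ i j, pd j (pd i ψ) = fun x => ψ x * (1/4 * (pd i V x * pd j V x) - 1/2 * pd j (pd i V) x) := fun i j => funext fun x => by
    rw [ψp, pd_mul' cψ1 (contDiff_const.mul (pV i)), ψp, pd_cmul _ (pV i)]; ring
  have ψpos : ∀ x, 0 < ψ x := fun x => exp_pos _
  have g0 : ∀ i, pd i V 0 = 0 := by
    intro i
    have : IsLocalMax V 0 := Eventually.of_forall fun x => by rw [h0]; exact hV0 x
    simp only [pd]; rw [this.fderiv_eq_zero]; rfl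
  have Pψ := poly cψ (fun i j => by
    rw [ψpp]
    exact cψ1.mul ((contDiff_const.mul ((pV i).mul (pV j))).sub (contDiff_const.mul (cV i j))))
    (fun x => by rw [ψpp]; have := LV2 x; simp only at this ⊢; rw [mul_eq_zero]; right; linarith)
    (fun x => by rw [ψpp, ψpp]; have := LV1 x; simp only at this ⊢; congr 1; linarith)
  have ψ0 : ψ 0 = 1 := by simp [hψ, h0]
  have V00 : pd 0 (pd 0 V) 0 = -(1/2) := by
    have a := LV1 0
    have b := sV 0
    simp only [g0, h0, exp_zero] at a b
    linarith
  have ψ1 : ∀ z : E2, ψ z = 1 + (z 0 * z 0 + z 1 * z 1) / 8 := by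
    intro z
    rw [Pψ z, ψpp, ψp, ψp]
    simp only [g0, V00, ψ0]; ring
  -- X
  have pp : ∀ i, pd i (fun x => ψ x * Ξ x) = fun x => pd i ψ x * Ξ x + ψ x * pd i Ξ x := fun i => funext fun x => by
    rw [pd_mul' cψ1 X1]
  have dψ : ∀ i, ContDiff ℝ 1 (pd i ψ) := fun i => pd_contDiff1 cψ i
  have ppp : ∀ i j, pd j (pd i (fun x => ψ x * Ξ x)) = fun x => (ψ x * (1/4 * (pd i V x * pd j V x) - 1/2 * pd j (pd i V) x)) * Ξ x + ψ x * (-(1/2) * pd i V x) * pd j Ξ x + (ψ x * (-(1/2) * pd j V x) * pd i Ξ x + ψ x * pd j (pd i Ξ) x) := fun i j => funext fun x => by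
    rw [pp, pd_add' ((dψ i).mul X1) (cψ1.mul (pX i)), pd_mul' (dψ i) X1, pd_mul' cψ1 (pX i), ψpp, ψp, ψp]
  have PX := poly (cψ.mul hX) (fun i j => by
    rw [ppp]
    exact ((((cψ1.mul ((contDiff_const.mul ((pV i).mul (pV j))).sub (contDiff_const.mul (cV i j)))).mul X1).add ((cψ1.mul (contDiff_const.mul (pV i))).mul (pX j))).add
      (((cψ1.mul (contDiff_const.mul (pV j))).mul (pX i)).add (cψ1.mul (cX i j)))))
    (fun x => by
      rw [ppp]; have a := LV2 x; have b := LX2 x; simp only at a b ⊢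
      linear_combination (1/4 * ψ x * Ξ x) * a - (1/2 * ψ x) * b)
    (fun x => by
      rw [ppp, ppp]; have a := LV1 x; have b := LX1 x; simp only at a b ⊢
      linear_combination (-(1/2) * ψ x * Ξ x) * a + (ψ x) * b)
  have X00 : pd 0 (pd 0 Ξ) 0 = -(1/2) * Ξ 0 := by
    have a := LX1 0
    have b := sX 0
    simp only [g0, h0, exp_zero] at a b
    linarith
  have Xz : ∀ z : E2, ψ z * Ξ z = Ξ 0 * (1 - (z 0 * z 0 + z 1 * z 1) / 8) + pd 0 Ξ 0 * z 0 + pd 1 Ξ 0 * z 1 := by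
    intro z
    rw [PX z, ppp, pp, pp, ψp, ψp]
    simp only [g0, V00, ψ0, X00]; ring
  refine ⟨Ξ 0, fun j => 8 * pd j Ξ 0, fun z => ?_⟩
  have nz : ‖z‖ ^ 2 = z 0 * z 0 + z 1 * z 1 := by
    rw [EuclideanSpace.norm_sq_eq]; simp [Fin.sum_univ_two]; ring
  have a := Xz z
  rw [ψ1] at a
  rw [Fin.sum_univ_two, nz]
  have hpos : 0 < 8 + (z 0 * z 0 + z 1 * z 1) := by nlinarith [mul_self_nonneg (z 0), mul_self_nonneg (z 1)]
  field_simp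
  linear_combination 8 * a

lemma local_final {p : ℕ → ℝ} (hp : Tendsto p atTop atTop) {v ξ : ℕ → E2 → ℝ} {R : ℕ → ℝ}
    (hR : Tendsto R atTop atTop) (hv0 : ∀ n, v n 0 = 0)
    (hreg : ∀ᶠ n in atTop, ContDiffOn ℝ 2 (v n) (ball 0 (R n)) ∧ ContDiffOn ℝ 2 (ξ n) (ball 0 (R n)))
    (hloc : ∀ᶠ n in atTop, ∀ x ∈ ball (0:E2) (R n), v n x ≤ 0 ∧ |1 + v n x / p n| ≤ 1 ∧
      lap (v n) x = -(|1 + v n x / p n| ^ (p n - 1) * (1 + v n x / p n)) ∧ |ξ n x| ≤ 1 ∧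
      lap (ξ n) x = -(|1 + v n x / p n| ^ (p n - 1) * ξ n x)) {C0 : ℝ}
    (hm : ∀ r : ℝ, ∀ᶠ n in atTop, ∫ x in ball (0:E2) r, |1 + v n x / p n| ^ (p n + 1) ≤ C0) :
    ∃ φ : ℕ → ℕ, StrictMono φ ∧ ∃ a : ℝ, ∃ b : Fin 2 → ℝ, TendstoC2LocOn Set.univ
      (fun m => ξ (φ m)) (fun z => a * ((8 - ‖z‖ ^ 2) / (8 + ‖z‖ ^ 2)) +
        ∑ j : Fin 2, b j * z j / (8 + ‖z‖ ^ 2)) := by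
  have ext : ∀ n, ∃ v' ξ' : E2 → ℝ, ContDiff ℝ 2 v' ∧ ContDiff ℝ 2 ξ' ∧ v' 0 = 0 ∧
      ((1 < R n ∧ ContDiffOn ℝ 2 (v n) (ball 0 (R n)) ∧ ContDiffOn ℝ 2 (ξ n) (ball 0 (R n))) →
        Set.EqOn v' (v n) (ball 0 (R n - 1)) ∧ Set.EqOn ξ' (ξ n) (ball 0 (R n - 1))) := by
    intro n
    by_cases h : 1 < R n ∧ ContDiffOn ℝ 2 (v n) (ball 0 (R n)) ∧ ContDiffOn ℝ 2 (ξ n) (ball 0 (R n))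
    · obtain ⟨h1, h2, h3⟩ := h
      obtain ⟨v', c1, S, s1, s2, e1⟩ := ext_ball (n := 2) (R := R n - 1) (by linarith) (by linarith) h2
      obtain ⟨ξ', c2, S', s3, s4, e2⟩ := ext_ball (n := 2) (R := R n - 1) (by linarith) (by linarith) h3
      refine ⟨v', ξ', c1, c2, ?_, fun _ => ⟨e1.mono (ball_subset_ball s1.le), e2.mono (ball_subset_ball s3.le)⟩⟩
      rw [e1 (mem_ball_self (by linarith)), hv0]
    · exact ⟨fun _ => 0, fun _ => 0, contDiff_const, contDiff_const, rfl, fun h' => absurd h' h⟩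
  choose v' ξ' cv cξ v0 he using ext
  have hEv : ∀ r : ℝ, ∀ᶠ n in atTop, r < R n ∧ Set.EqOn (v' n) (v n) (ball 0 r) ∧ Set.EqOn (ξ' n) (ξ n) (ball 0 r) := by
    intro r
    filter_upwards [hreg, hR.eventually_gt_atTop 1, hR.eventually_gt_atTop (r + 1)] with n h1 h2 h3
    obtain ⟨a, b⟩ := he n ⟨h2, h1⟩
    have : r ≤ R n - 1 := by linarith
    exact ⟨by linarith, a.mono (ball_subset_ball this), b.mono (ball_subset_ball this)⟩
  obtain ⟨φ, hφ, V, Ξ, cV, cΞ, lV, lΞ, l1, l2, eV, eΞ, hV0, hV00, hΞ1⟩ := local_lim hp cv cξ v0 (by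
    intro r
    filter_upwards [hEv r, hloc] with n h1 h2 x hx
    obtain ⟨hr, h1, h3⟩ := h1
    rw [h1 hx, h3 hx, lap_congr isOpen_ball h1 hx, lap_congr isOpen_ball h3 hx]
    exact h2 x (ball_subset_ball hr.le hx))
  have hmass : ∀ r, ∫ x in ball (0:E2) r, exp (V x) ≤ C0 := by
    intro r
    refine limit_mass (p := fun n => p (φ n)) (v := fun n => v' (φ n)) (hp.comp hφ.tendsto_atTop) (fun n => (cv _).continuous) lV ?_
    have := hφ.tendsto_atTop.eventually ((hEv r).and (hm r))
    filter_upwards [this] with n hn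
    obtain ⟨⟨_, h1, _⟩, h2⟩ := hn
    refine le_of_eq_of_le (setIntegral_congr_fun measurableSet_ball ?_) h2
    intro x hx
    simp only [h1 hx]
  obtain ⟨a, b, hab⟩ := classify cV cΞ eV eΞ hV0 hV00 hΞ1 hmass
  refine ⟨φ, hφ, a, b, ?_⟩
  have key : TendstoC2LocOn Set.univ (fun n => ξ' (φ n)) Ξ := LU_to_C2 (fun n => cξ _) cΞ lΞ l1 l2
  have : Ξ = (fun z => a * ((8 - ‖z‖ ^ 2) / (8 + ‖z‖ ^ 2)) +
        ∑ j : Fin 2, b j * z j / (8 + ‖z‖ ^ 2)) := funext hab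
  rw [← this]
  intro K hK hKc k hk
  obtain ⟨r, hr⟩ := hKc.isBounded.subset_ball (0:E2)
  refine (key K hK hKc k hk).congr ?_
  filter_upwards [hφ.tendsto_atTop.eventually (hEv r)] with n hn x hx
  have : ξ' (φ n) =ᶠ[𝓝 x] ξ (φ n) := hn.2.2.eventuallyEq_of_mem (isOpen_ball.mem_nhds (hr hx))
  exact (this.iteratedFDeriv ℝ k).eq_of_nhds

lemma hasDerivAt_posSq (x : ℝ) : HasDerivAt (fun s : ℝ => max s 0 ^ 2) (2 * max x 0) x := by
  rcases lt_trichotomy x 0 with h | h | h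
  · rw [max_eq_right h.le, mul_zero]
    refine (hasDerivAt_const x (0:ℝ)).congr_of_eventuallyEq ?_
    filter_upwards [eventually_lt_nhds h] with s hs
    rw [max_eq_right hs.le]; norm_num
  · subst h
    rw [max_self, mul_zero, hasDerivAt_iff_isLittleO]
    have h1 : (fun s : ℝ => s ^ 2) =o[𝓝 0] (fun s : ℝ => s) := by
      simpa using Asymptotics.isLittleO_pow_id (𝕜 := ℝ) (n := 2) (by norm_num)
    refine Asymptotics.IsLittleO.congr' (f₁ := fun s : ℝ => max s 0 ^ 2) (g₁ := fun s => s) ?_ (by simp) (by simp)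
    refine Asymptotics.IsBigO.trans_isLittleO ?_ h1
    refine Asymptotics.IsBigO.of_bound 1 (Eventually.of_forall fun s => ?_)
    rw [Real.norm_eq_abs, Real.norm_eq_abs, abs_of_nonneg (by positivity), abs_of_nonneg (by positivity), one_mul]
    rcases le_total s 0 with hs | hs
    · rw [max_eq_right hs]; nlinarith
    · rw [max_eq_left hs]
  · rw [max_eq_left h.le]
    have : HasDerivAt (fun s : ℝ => s ^ 2) (2 * x) x := by simpa using hasDerivAt_pow 2 x
    refine this.congr_of_eventuallyEq ?_
    filter_upwards [eventually_gt_nhds h] with s hs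
    rw [max_eq_left hs.le]

def Fd (δ s : ℝ) : ℝ := √(max (s - δ) 0 ^ 2 + δ ^ 2) - δ
def Sd (δ s : ℝ) : ℝ := max (s - δ) 0 / √(max (s - δ) 0 ^ 2 + δ ^ 2)

lemma Fd_deriv {δ : ℝ} (hδ : 0 < δ) (s : ℝ) : HasDerivAt (Fd δ) (Sd δ s) s := by
  have h1 : HasDerivAt (fun s => max (s - δ) 0 ^ 2) (2 * max (s - δ) 0) s := by
    simpa using (hasDerivAt_posSq (s - δ)).comp_sub_const s δ
  have hp : 0 < max (s - δ) 0 ^ 2 + δ ^ 2 := by positivity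
  have h2 := ((h1.add_const (δ ^ 2)).sqrt hp.ne').sub_const δ
  have e : Sd δ s = 2 * max (s - δ) 0 / (2 * √(max (s - δ) 0 ^ 2 + δ ^ 2)) := by
    unfold Sd; rw [mul_div_mul_left _ _ (by norm_num)]
  rw [e]; exact h2

lemma Sd_cont {δ : ℝ} (hδ : 0 < δ) : Continuous (Sd δ) := by
  unfold Sd
  refine Continuous.div (by fun_prop) (by fun_prop) (fun s => ?_)
  have hp : 0 < max (s - δ) 0 ^ 2 + δ ^ 2 := by positivity
  positivity

lemma Fd_C1 {δ : ℝ} (hδ : 0 < δ) : ContDiff ℝ 1 (Fd δ) := by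
  rw [contDiff_one_iff_deriv]
  refine ⟨fun s => (Fd_deriv hδ s).differentiableAt, ?_⟩
  have : deriv (Fd δ) = Sd δ := funext fun s => (Fd_deriv hδ s).deriv
  rw [this]; exact Sd_cont hδ

lemma Sd_nonneg (δ s : ℝ) : 0 ≤ Sd δ s := by unfold Sd; positivity
lemma Sd_le_one (δ s : ℝ) : Sd δ s ≤ 1 := by
  unfold Sd
  refine div_le_one_of_le₀ ?_ (sqrt_nonneg _)
  refine Real.le_sqrt_of_sq_le ?_
  nlinarith [sq_nonneg δ]
lemma Fd_zero {δ s : ℝ} (hδ : 0 < δ) (h : s ≤ δ) : Fd δ s = 0 := by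
  unfold Fd; rw [max_eq_right (by linarith)]; simp [abs_of_pos hδ, Real.sqrt_sq hδ.le]
lemma Fd_nonneg {δ : ℝ} (hδ : 0 < δ) (s : ℝ) : 0 ≤ Fd δ s := by
  unfold Fd
  have : δ ≤ √(max (s - δ) 0 ^ 2 + δ ^ 2) := Real.le_sqrt_of_sq_le (by nlinarith [sq_nonneg (max (s-δ) 0)])
  linarith
lemma Fd_lower {δ : ℝ} (s : ℝ) : s - 2 * δ ≤ Fd δ s := by
  unfold Fd
  have : max (s - δ) 0 ≤ √(max (s - δ) 0 ^ 2 + δ ^ 2) := Real.le_sqrt_of_sq_le (by nlinarith [sq_nonneg δ])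
  linarith [le_max_left (s - δ) 0]
lemma Fd_upper {δ : ℝ} (hδ : 0 < δ) (s : ℝ) : Fd δ s ≤ max s 0 := by
  unfold Fd
  have h0 : 0 ≤ max (s - δ) 0 := le_max_right _ _
  have : √(max (s - δ) 0 ^ 2 + δ ^ 2) ≤ max (s - δ) 0 + δ := by
    apply Real.sqrt_le_iff.2; constructor
    · linarith
    · nlinarith
  have h2 : max (s - δ) 0 ≤ max s 0 := max_le_max (by linarith) le_rfl
  linarith

lemma zero_ext {Ω K : Set E2} (hΩ : IsOpen Ω) (hK : IsClosed K) (hKΩ : K ⊆ Ω) {g : E2 → ℝ}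
    (hg : ContDiffOn ℝ 1 g Ω) (h0 : ∀ x ∈ Ω, x ∉ K → g x = 0) : ContDiff ℝ 1 (Ω.indicator g) := by
  rw [contDiff_iff_contDiffAt]
  intro x
  by_cases hx : x ∈ Ω
  · refine (hg.contDiffAt (hΩ.mem_nhds hx)).congr_of_eventuallyEq ?_
    filter_upwards [hΩ.mem_nhds hx] with y hy
    rw [Set.indicator_of_mem hy]
  · refine (contDiffAt_const (c := (0:ℝ))).congr_of_eventuallyEq ?_
    filter_upwards [hK.isOpen_compl.mem_nhds (fun h => hx (hKΩ h))] with y hy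
    by_cases hy' : y ∈ Ω
    · rw [Set.indicator_of_mem hy', h0 y hy' hy]
    · rw [Set.indicator_of_notMem hy']

lemma zero_ext_supp {Ω K : Set E2} (hK : IsCompact K) {g : E2 → ℝ}
    (h0 : ∀ x ∈ Ω, x ∉ K → g x = 0) : HasCompactSupport (Ω.indicator g) := by
  refine HasCompactSupport.intro hK (fun x hx => ?_)
  by_cases hy' : x ∈ Ω
  · rw [Set.indicator_of_mem hy', h0 x hy' hx]
  · rw [Set.indicator_of_notMem hy']

lemma pd_cs {g : E2 → ℝ} (hg : HasCompactSupport g) (i : Fin 2) : HasCompactSupport (pd i g) := by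
  exact hg.fderiv_apply (𝕜 := ℝ) _

lemma int_pd_zero {g : E2 → ℝ} (hg : ContDiff ℝ 1 g) (hc : HasCompactSupport g) (i : Fin 2) :
    ∫ x, pd i g x = 0 := by
  have h := integral_mul_fderiv_eq_neg_fderiv_mul_of_integrable (μ := (volume : Measure E2)) (f := fun _ : E2 => (1:ℝ)) (g := g)
    (v := EuclideanSpace.single i 1) (by simp)
    (by simp only [one_mul]; exact (pd_continuous hg i).integrable_of_hasCompactSupport (pd_cs hc i))
    (by simpa using hg.continuous.integrable_of_hasCompactSupport hc)
    (fun x _ => differentiableAt_const _) (fun x _ => hg.differentiable (by norm_num) x)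
  simpa [pd] using h

lemma trunc {Ω : Set E2} (hΩ : IsOpen Ω) (hb : IsBounded Ω) {p δ : ℝ} (hp : 1 < p) (hδ : 0 < δ) {u : E2 → ℝ}
    (hu : IsSolution Ω p u) :
    ∃ W : E2 → ℝ, ContDiff ℝ 1 W ∧ (∀ x, 0 ≤ W x) ∧ (∀ x, x ∉ Ω → W x = 0) ∧ (∀ x ∈ Ω, u x - 2 * δ ≤ W x) ∧
      Integrable (fun x => pd 0 W x ^ 2 + pd 1 W x ^ 2) ∧
      ∫ x, (pd 0 W x ^ 2 + pd 1 W x ^ 2) ≤ ∫ x in Ω, max (u x) 0 ^ (p + 1) := by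
  obtain ⟨hu2, huc, hue, hu0⟩ := hu
  have hcl : IsCompact (closure Ω) := hb.isCompact_closure
  set K := {x | x ∈ closure Ω ∧ δ ≤ u x} with hKd
  have hKc : IsClosed K := by
    have := huc.preimage_isClosed_of_isClosed isClosed_closure (isClosed_Ici (a := δ))
    exact this
  have hKcomp : IsCompact K := hcl.of_isClosed_subset hKc (fun x hx => hx.1)
  have hKΩ : K ⊆ Ω := by
    rintro x ⟨hx, hx2⟩
    by_contra hn
    have : x ∈ frontier Ω := ⟨hx, by rwa [hΩ.interior_eq]⟩
    rw [hu0 x this] at hx2; linarith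
  have hz : ∀ x ∈ Ω, x ∉ K → Fd δ (u x) = 0 := by
    intro x hx hn
    apply Fd_zero hδ
    by_contra hc
    exact hn ⟨subset_closure hx, (not_le.1 hc).le⟩
  have cF : ContDiffOn ℝ 1 (fun x => Fd δ (u x)) Ω := (Fd_C1 hδ).comp_contDiffOn (hu2.of_le (by norm_num))
  have cpd : ∀ i, ContDiffOn ℝ 1 (pd i u) Ω := by
    intro i
    have h1 : ContDiffOn ℝ 1 (fderiv ℝ u) Ω := hu2.fderiv_of_isOpen hΩ (by norm_num)
    exact h1.clm_apply contDiffOn_const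
  have hcF : ∀ i, ContDiffOn ℝ 1 (fun x => Fd δ (u x) * pd i u x) Ω := fun i => cF.mul (cpd i)
  have hz2 : ∀ i, ∀ x ∈ Ω, x ∉ K → Fd δ (u x) * pd i u x = 0 := fun i x hx hn => by rw [hz x hx hn, zero_mul]
  set W := Ω.indicator (fun x => Fd δ (u x)) with hW
  set Z : Fin 2 → E2 → ℝ := fun i => Ω.indicator (fun x => Fd δ (u x) * pd i u x) with hZ
  have cW : ContDiff ℝ 1 W := zero_ext hΩ hKc hKΩ cF hz
  have cZ : ∀ i, ContDiff ℝ 1 (Z i) := fun i => zero_ext hΩ hKc hKΩ (hcF i) (hz2 i)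
  have sW : HasCompactSupport W := zero_ext_supp hKcomp hz
  have sZ : ∀ i, HasCompactSupport (Z i) := fun i => zero_ext_supp hKcomp (hz2 i)
  have chain : ∀ i, ∀ x ∈ Ω, pd i (fun x => Fd δ (u x)) x = Sd δ (u x) * pd i u x := by
    intro i x hx
    have h1 : HasFDerivAt u (fderiv ℝ u x) x :=
      ((hu2.contDiffAt (hΩ.mem_nhds hx)).differentiableAt (by norm_num)).hasFDerivAt
    have h2 : HasFDerivAt (fun x => Fd δ (u x)) (Sd δ (u x) • fderiv ℝ u x) x := (Fd_deriv hδ (u x)).comp_hasFDerivAt x h1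
    rw [pd_of h2]; simp [pd]
  have pW : ∀ i, ∀ x ∈ Ω, pd i W x = Sd δ (u x) * pd i u x := by
    intro i x hx
    rw [← chain i x hx]
    exact pd_congr hΩ (fun y hy => Set.indicator_of_mem hy _) i hx
  have pZ : ∀ i, ∀ x ∈ Ω, pd i (Z i) x = Sd δ (u x) * pd i u x ^ 2 + Fd δ (u x) * pd i (pd i u) x := by
    intro i x hx
    rw [pd_congr hΩ (f := Z i) (fun y hy => Set.indicator_of_mem hy _) i hx, pd_mul hΩ cF (cpd i) i hx, chain i x hx]
    ring
  have off : ∀ (g : E2 → ℝ), (∀ x ∈ Ω, x ∉ K → g x = 0) → ∀ i, ∀ x, x ∉ Ω → pd i (Ω.indicator g) x = 0 := by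
    intro g hg i x hx
    have : Set.EqOn (Ω.indicator g) (fun _ => 0) Kᶜ := by
      intro y hy
      by_cases hy' : y ∈ Ω
      · rw [Set.indicator_of_mem hy', hg y hy' hy]
      · rw [Set.indicator_of_notMem hy']
    rw [pd_congr hKc.isOpen_compl this i (fun h => hx (hKΩ h))]
    simp [pd]
  have iZ : ∀ i, Integrable (pd i (Z i)) := fun i =>
    (pd_continuous (cZ i) i).integrable_of_hasCompactSupport (pd_cs (sZ i) i)
  have iW : Integrable (fun x => pd 0 W x ^ 2 + pd 1 W x ^ 2) := by
    have : ∀ i, Integrable (fun x => pd i W x ^ 2) := by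
      intro i
      refine ((pd_continuous cW i).pow 2).integrable_of_hasCompactSupport ?_
      have := (pd_cs sW i).comp_left (g := fun t : ℝ => t ^ 2) (by norm_num)
      exact this
    exact (this 0).add (this 1)
  have iP : IntegrableOn (fun x => max (u x) 0 ^ (p + 1)) Ω := by
    have : ContinuousOn (fun x => max (u x) 0 ^ (p + 1)) (closure Ω) :=
      (ContinuousOn.sup huc continuousOn_const).rpow_const (fun x _ => Or.inr (by linarith))
    exact (this.integrableOn_compact hcl).mono_set subset_closure
  refine ⟨W, cW, ?_, ?_, ?_, iW, ?_⟩
  · intro x; exact Set.indicator_nonneg (fun x _ => Fd_nonneg hδ _) x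
  · intro x hx; exact Set.indicator_of_notMem hx _
  · intro x hx; rw [hW, Set.indicator_of_mem hx]; exact Fd_lower _
  · have hI : ∫ x, (pd 0 (Z 0) x + pd 1 (Z 1) x + Ω.indicator (fun x => max (u x) 0 ^ (p + 1)) x) = ∫ x in Ω, max (u x) 0 ^ (p + 1) := by
      have i3 : Integrable (Ω.indicator (fun x => max (u x) 0 ^ (p + 1))) := (integrable_indicator_iff hΩ.measurableSet).2 iP
      rw [integral_add (f := fun x => pd 0 (Z 0) x + pd 1 (Z 1) x) ((iZ 0).add (iZ 1)) i3, integral_add (iZ 0) (iZ 1), int_pd_zero (cZ 0) (sZ 0),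
        int_pd_zero (cZ 1) (sZ 1), integral_indicator hΩ.measurableSet]
      simp
    rw [← hI]
    refine integral_mono iW (((iZ 0).add (iZ 1)).add ((integrable_indicator_iff hΩ.measurableSet).2 iP)) ?_
    intro x
    show pd 0 W x ^ 2 + pd 1 W x ^ 2 ≤ pd 0 (Z 0) x + pd 1 (Z 1) x + Ω.indicator (fun x => max (u x) 0 ^ (p + 1)) x
    by_cases hx : x ∈ Ω
    · rw [pW 0 x hx, pW 1 x hx, pZ 0 x hx, pZ 1 x hx, Set.indicator_of_mem hx]
      have e := hue x hx
      rw [lap_eq] at e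
      have h1 : Fd δ (u x) * (|u x| ^ (p - 1) * u x) ≤ max (u x) 0 ^ (p + 1) := by
        rcases le_total (u x) 0 with h | h
        · rw [Fd_zero hδ (by linarith), zero_mul]; positivity
        · rw [abs_of_nonneg h, max_eq_left h]
          have h2 : Fd δ (u x) ≤ u x := by simpa [h] using Fd_upper hδ (u x)
          have h3 : u x ^ (p + 1) = u x * (u x ^ (p - 1) * u x) := by
            rcases h.eq_or_lt with h' | h'
            · rw [← h', Real.zero_rpow (by linarith)]; ring
            · rw [show p + 1 = (p - 1) + 1 + 1 by ring, Real.rpow_add_one h'.ne', Real.rpow_add_one h'.ne']; ring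
          rw [h3]
          exact mul_le_mul_of_nonneg_right h2 (by positivity)
      have s0 := Sd_nonneg δ (u x)
      have s1 := Sd_le_one δ (u x)
      have h4 : Sd δ (u x) * (pd 0 u x ^ 2 + pd 1 u x ^ 2) * Sd δ (u x) ≤ Sd δ (u x) * (pd 0 u x ^ 2 + pd 1 u x ^ 2) * 1 :=
        mul_le_mul_of_nonneg_left s1 (by positivity)
      have h5 : Fd δ (u x) * (pd 0 (pd 0 u) x + pd 1 (pd 1 u) x) = - (Fd δ (u x) * (|u x| ^ (p - 1) * u x)) := by
        rw [← e]; ring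
      nlinarith
    · rw [off _ hz 0 x hx, off _ hz 1 x hx, off _ (hz2 0) 0 x hx, off _ (hz2 1) 1 x hx, Set.indicator_of_notMem hx]
      norm_num

lemma capacity {W : E2 → ℝ} (hW : ContDiff ℝ 1 W) (c : E2) {r1 r2 : ℝ} (h1 : 0 < r1) (h2 : r1 < r2) :
    2 * π * (cav c r1 W - cav c r2 W) ^ 2 ≤ Real.log (r2 / r1) *
      ∫ y in {y | r1 < dist y c ∧ dist y c < r2}, (pd 0 W y ^ 2 + pd 1 W y ^ 2) := by
  set g : E2 → ℝ := fun y => pd 0 W y ^ 2 + pd 1 W y ^ 2 with hg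
  have c0 := pd_continuous hW 0
  have c1 := pd_continuous hW 1
  have cg : Continuous g := by fun_prop
  have cev := continuous_ev
  set D : ℝ → ℝ → ℝ := fun r θ => cos θ * pd 0 W (c + r • ev θ) + sin θ * pd 1 W (c + r • ev θ) with hD
  have cD : Continuous (Function.uncurry D) := by
    simp only [hD]; unfold Function.uncurry; fun_prop
  have hder : ∀ r, HasDerivAt (fun r => ∫ θ in (-π)..π, W (c + r • ev θ)) (∫ θ in (-π)..π, D r θ) r := by
    intro r
    refine hasDerivAt_param (F := fun r θ => W (c + r • ev θ)) (F' := D) ?_ cD ?_ _ _ r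
    · have := hW.continuous
      unfold Function.uncurry; fun_prop
    · intro r θ; exact hasDerivAt_ray (hW.differentiable (by norm_num)) c r θ
  have cI : Continuous (fun r => ∫ θ in (-π)..π, D r θ) :=
    intervalIntegral.continuous_parametric_intervalIntegral_of_continuous' cD _ _
  have ftc : ∫ r in r1..r2, ∫ θ in (-π)..π, D r θ = 2 * π * (cav c r2 W - cav c r1 W) := by
    rw [intervalIntegral.integral_eq_sub_of_hasDerivAt (fun r _ => hder r) (cI.intervalIntegrable _ _)]
    unfold cav; field_simp
  have cG : Continuous (fun r => ∫ θ in (-π)..π, r * g (c + r • ev θ)) := by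
    refine intervalIntegral.continuous_parametric_intervalIntegral_of_continuous' (f := fun r θ => r * g (c + r • ev θ)) ?_ _ _
    unfold Function.uncurry; fun_prop
  have hL : 0 < Real.log (r2 / r1) := Real.log_pos (by rw [lt_div_iff₀ h1]; linarith)
  rw [polar_annulus cg c h1.le h2.le]
  have key : ∀ l : ℝ, 2 * l * (2 * π * (cav c r1 W - cav c r2 W)) ≤
      (∫ r in r1..r2, ∫ θ in (-π)..π, r * g (c + r • ev θ)) + 2 * π * l ^ 2 * Real.log (r2 / r1) := by
    intro l
    have hpt : ∀ r ∈ Set.Icc r1 r2, -(2 * l) * (∫ θ in (-π)..π, D r θ) ≤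
        (∫ θ in (-π)..π, r * g (c + r • ev θ)) + 2 * π * l ^ 2 * r⁻¹ := by
      intro r hr
      have hr0 : 0 < r := lt_of_lt_of_le h1 hr.1
      have e1 : 2 * π * l ^ 2 * r⁻¹ = ∫ θ in (-π)..π, l ^ 2 * r⁻¹ := by
        rw [intervalIntegral.integral_const, smul_eq_mul]; ring
      have cg' : Continuous (fun θ => r * g (c + r • ev θ)) := by fun_prop
      have cD' : Continuous (fun θ => D r θ) := by simp only [hD]; fun_prop
      rw [e1, ← intervalIntegral.integral_const_mul, ← intervalIntegral.integral_add (cg'.intervalIntegrable _ _) (by simp)]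
      refine intervalIntegral.integral_mono_on (μ := volume) (by linarith [pi_pos]) ((cD'.const_mul _).intervalIntegrable _ _)
        ((cg'.add continuous_const).intervalIntegrable _ _) ?_
      intro θ _
      simp only [hD, hg]
      set a := pd 0 W (c + r • ev θ)
      set b := pd 1 W (c + r • ev θ)
      have cs : (cos θ * a + sin θ * b) ^ 2 ≤ a ^ 2 + b ^ 2 := by
        nlinarith [sq_nonneg (sin θ * a - cos θ * b), sin_sq_add_cos_sq θ]
      have e2 : r * (a ^ 2 + b ^ 2) + l ^ 2 * r⁻¹ - -(2 * l) * (cos θ * a + sin θ * b) =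
        r * (a ^ 2 + b ^ 2 - (cos θ * a + sin θ * b) ^ 2) + r⁻¹ * (r * (cos θ * a + sin θ * b) + l) ^ 2 := by
        field_simp; ring
      have : 0 ≤ r * (a ^ 2 + b ^ 2 - (cos θ * a + sin θ * b) ^ 2) + r⁻¹ * (r * (cos θ * a + sin θ * b) + l) ^ 2 := by
        have := mul_nonneg hr0.le (sub_nonneg.2 cs)
        positivity
      linarith
    have hinv : IntervalIntegrable (fun r : ℝ => 2 * π * l ^ 2 * r⁻¹) volume r1 r2 := by
      apply ContinuousOn.intervalIntegrable
      rw [Set.uIcc_of_le h2.le]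
      refine continuousOn_const.mul (continuousOn_inv₀.mono ?_)
      intro r hr; exact (lt_of_lt_of_le h1 hr.1).ne'
    have := intervalIntegral.integral_mono_on (μ := volume) h2.le ((cI.const_mul (-(2*l))).intervalIntegrable _ _)
      ((cG.intervalIntegrable _ _).add hinv) hpt
    rw [intervalIntegral.integral_const_mul, ftc, intervalIntegral.integral_add (cG.intervalIntegrable _ _) hinv,
      intervalIntegral.integral_const_mul, integral_inv_of_pos h1 (h1.trans h2)] at this
    linarith
  set D0 := ∫ r in r1..r2, ∫ θ in (-π)..π, r * g (c + r • ev θ)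
  set A := cav c r1 W - cav c r2 W
  set L := Real.log (r2 / r1)
  have := key (A / L)
  have e : 2 * (A / L) * (2 * π * A) - 2 * π * (A / L) ^ 2 * L = 2 * π * A ^ 2 / L := by field_simp; ring
  have h3 : 2 * π * A ^ 2 / L ≤ D0 := by linarith
  rw [div_le_iff₀ hL] at h3
  linarith

lemma f_le {p s m : ℝ} (hp : 1 < p) (hm : 0 ≤ m) (hs : s ≤ m) : |s| ^ (p - 1) * s ≤ m ^ p := by
  rcases le_or_gt s 0 with h | h
  · have : |s| ^ (p - 1) * s ≤ 0 := mul_nonpos_of_nonneg_of_nonpos (by positivity) h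
    exact this.trans (by positivity)
  · rw [abs_of_pos h, ← Real.rpow_add_one h.ne', sub_add_cancel]
    exact Real.rpow_le_rpow h.le hs (by linarith)

lemma center {Ω : Set E2} {p δ m : ℝ} (hp : 1 < p) {w W : E2 → ℝ} (hw : IsSolution Ω p w)
    (hm : 0 ≤ m) (hwm : ∀ x ∈ Ω, w x ≤ m) (hW : Continuous W) (hWw : ∀ x ∈ Ω, w x - 2 * δ ≤ W x)
    {y : E2} {r r' : ℝ} (hr : 0 ≤ r) (hr' : r < r') (hy : ball y r' ⊆ Ω) :
    w y - m ^ p * r ^ 2 / 4 - 2 * δ ≤ cav y r W := by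
  obtain ⟨h1, h2, h3, h4⟩ := hw
  have hcb : closedBall y r ⊆ Ω := (closedBall_subset_ball hr').trans hy
  have e1 := mean_ineq (Λ := m ^ p) (h1.mono hy) hr hr' (by
    intro x hx
    have := h3 x (hcb hx)
    have := f_le hp hm (hwm x (hcb hx))
    linarith)
  have e2 : cav y r w ≤ cav y r (fun x => W x + 2 * δ) :=
    cav_mono hr (h1.continuousOn.mono hcb) (by fun_prop) (fun x hx => by linarith [hWw x (hcb hx)])
  have e3 : cav y r (fun x => W x + 2 * δ) = cav y r W + 2 * δ := by
    unfold cav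
    have := continuous_ev
    rw [intervalIntegral.integral_add ((by fun_prop : Continuous _).intervalIntegrable _ _) (by simp), intervalIntegral.integral_const]
    field_simp
    rw [smul_eq_mul]; ring
  linarith

lemma cav_out {Ω : Set E2} {W : E2 → ℝ} (hW : ∀ x, x ∉ Ω → W x = 0) {c : E2} {R : ℝ} (hR : 0 ≤ R) (h : Ω ⊆ ball c R) :
    cav c R W = 0 := by
  unfold cav
  have : ∀ θ, W (c + R • ev θ) = 0 := by
    intro θ
    apply hW
    intro hx
    have := h hx
    rw [mem_ball, dist_eq_norm, add_sub_cancel_left, norm_smul, norm_ev, mul_one, Real.norm_eq_abs, abs_of_nonneg hR] at this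
    exact lt_irrefl _ this
  simp [this]

lemma cav_nonneg' {W : E2 → ℝ} (hW : ∀ x, 0 ≤ W x) (c : E2) (r : ℝ) : 0 ≤ cav c r W := by
  unfold cav
  refine div_nonneg (intervalIntegral.integral_nonneg (by linarith [pi_pos]) (fun θ _ => hW _)) (by positivity)

lemma sub_two_tendsto (t : ℝ) : Tendsto (fun δ : ℝ => t - 2 * δ) (𝓝[>] 0) (𝓝 t) := by
  have : Tendsto (fun δ : ℝ => t - 2 * δ) (𝓝 0) (𝓝 (t - 2 * 0)) := (by fun_prop : Continuous fun δ : ℝ => t - 2 * δ).tendsto 0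
  rw [mul_zero, sub_zero] at this
  exact this.mono_left nhdsWithin_le_nhds

lemma one_center {Ω : Set E2} (hΩ : IsOpen Ω) (hb : IsBounded Ω) {p m : ℝ} (hp : 1 < p) {w : E2 → ℝ} (hw : IsSolution Ω p w)
    (hm : 0 ≤ m) (hwm : ∀ x ∈ Ω, w x ≤ m) {y : E2} {r r' R0 : ℝ} (hr : 0 < r) (hr' : r < r') (hy : ball y r' ⊆ Ω)
    (hR : r < R0) (hΩR : Ω ⊆ ball y R0) (ht : 0 ≤ w y - m ^ p * r ^ 2 / 4) :
    2 * π * (w y - m ^ p * r ^ 2 / 4) ^ 2 ≤ Real.log (R0 / r) * ∫ x in Ω, max (w x) 0 ^ (p + 1) := by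
  set t := w y - m ^ p * r ^ 2 / 4 with htd
  have hL : 0 < Real.log (R0 / r) := Real.log_pos (by rw [lt_div_iff₀ hr]; linarith)
  rcases ht.eq_or_lt with h0 | h0
  · rw [← h0]
    have : 0 ≤ ∫ x in Ω, max (w x) 0 ^ (p + 1) := integral_nonneg (fun x => by positivity)
    have := mul_nonneg hL.le this
    simpa using this
  refine le_of_tendsto (((sub_two_tendsto t).pow 2).const_mul (2 * π)) ?_
  filter_upwards [self_mem_nhdsWithin, (sub_two_tendsto t).eventually (lt_mem_nhds h0)] with δ hδ hpos
  obtain ⟨W, cW, W0, Woff, Ww, Wi, WI⟩ := trunc hΩ hb hp hδ hw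
  have e1 := center hp hw hm hwm cW.continuous Ww hr.le hr' hy
  have e2 := capacity cW y hr hR
  rw [cav_out Woff (by linarith) hΩR, sub_zero] at e2
  have e3 : ∫ x in {x | r < dist x y ∧ dist x y < R0}, (pd 0 W x ^ 2 + pd 1 W x ^ 2) ≤ ∫ x, (pd 0 W x ^ 2 + pd 1 W x ^ 2) :=
    setIntegral_le_integral Wi (Eventually.of_forall fun x => by positivity)
  have e4 : (t - 2 * δ) ^ 2 ≤ (cav y r W) ^ 2 := pow_le_pow_left₀ hpos.le e1 2
  calc 2 * π * (t - 2 * δ) ^ 2 ≤ 2 * π * (cav y r W) ^ 2 := by gcongr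
    _ ≤ _ := e2
    _ ≤ _ := by gcongr; exact e3.trans WI

lemma two_center {Ω : Set E2} (hΩ : IsOpen Ω) (hb : IsBounded Ω) {p m : ℝ} (hp : 1 < p) {w : E2 → ℝ} (hw : IsSolution Ω p w)
    (hm : 0 ≤ m) (hwm : ∀ x ∈ Ω, w x ≤ m) {y : Fin 2 → E2} {r ρ R0 s : ℝ} (hr : 0 < r) (hr' : r < ρ)
    (hy : ∀ i, ball (y i) ρ ⊆ Ω) (hd : 2 * ρ ≤ dist (y 0) (y 1))
    (hR : ρ < R0) (hΩR : ∀ i, Ω ⊆ ball (y i) R0) (hs0 : 0 ≤ s)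
    (hs : Real.log (R0 / ρ) * (∫ x in Ω, max (w x) 0 ^ (p + 1)) ≤ 2 * π * s ^ 2)
    (ht : ∀ i, 0 < w (y i) - m ^ p * r ^ 2 / 4 - s) :
    2 * π * ((w (y 0) - m ^ p * r ^ 2 / 4 - s) ^ 2 + (w (y 1) - m ^ p * r ^ 2 / 4 - s) ^ 2)
      ≤ Real.log (R0 / r) * ∫ x in Ω, max (w x) 0 ^ (p + 1) := by
  set t : Fin 2 → ℝ := fun i => w (y i) - m ^ p * r ^ 2 / 4 - s with htd
  show 2 * π * (t 0 ^ 2 + t 1 ^ 2) ≤ _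
  have hρ : 0 < ρ := hr.trans hr'
  have hL0 : 0 < Real.log (R0 / ρ) := Real.log_pos (by rw [lt_div_iff₀ hρ]; linarith)
  have hL : 0 < Real.log (ρ / r) := Real.log_pos (by rw [lt_div_iff₀ hr]; linarith)
  have hLL : Real.log (ρ / r) ≤ Real.log (R0 / r) := Real.log_le_log (by positivity) (by gcongr)
  refine le_of_tendsto ((((sub_two_tendsto (t 0)).pow 2).add ((sub_two_tendsto (t 1)).pow 2)).const_mul (2 * π)) ?_
  filter_upwards [self_mem_nhdsWithin, (sub_two_tendsto (t 0)).eventually (lt_mem_nhds (ht 0)), (sub_two_tendsto (t 1)).eventually (lt_mem_nhds (ht 1))] with δ hδ hpos0 hpos1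
  have hpos : ∀ i, 0 < t i - 2 * δ := by
    intro i; fin_cases i
    · exact hpos0
    · exact hpos1
  obtain ⟨W, cW, W0, Woff, Ww, Wi, WI⟩ := trunc hΩ hb hp hδ hw
  set I := ∫ x in Ω, max (w x) 0 ^ (p + 1)
  set g : E2 → ℝ := fun x => pd 0 W x ^ 2 + pd 1 W x ^ 2
  have hg0 : ∀ x, 0 ≤ g x := fun x => by positivity
  set D : Fin 2 → ℝ := fun i => ∫ x in {x | r < dist x (y i) ∧ dist x (y i) < ρ}, g x with hD
  have each : ∀ i, 2 * π * (t i - 2 * δ) ^ 2 ≤ Real.log (ρ / r) * D i := by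
    intro i
    have e1 := center hp hw hm hwm cW.continuous Ww hr.le hr' (hy i)
    have e2 := capacity cW (y i) hr hr'
    have e3 := capacity cW (y i) hρ hR
    rw [cav_out Woff (by linarith) (hΩR i), sub_zero] at e3
    have e4 : ∫ x in {x | ρ < dist x (y i) ∧ dist x (y i) < R0}, g x ≤ ∫ x, g x :=
      setIntegral_le_integral Wi (Eventually.of_forall hg0)
    have e5 : 2 * π * (cav (y i) ρ W) ^ 2 ≤ 2 * π * s ^ 2 := by
      refine (e3.trans ?_).trans hs
      gcongr
      exact e4.trans WI
    have e6 : cav (y i) ρ W ≤ s := by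
      have h : (cav (y i) ρ W) ^ 2 ≤ s ^ 2 := le_of_mul_le_mul_left e5 (by positivity)
      exact (pow_le_pow_iff_left₀ (cav_nonneg' W0 _ _) hs0 two_ne_zero).1 h
    have e7 : t i - 2 * δ ≤ cav (y i) r W - cav (y i) ρ W := by simp only [htd]; linarith
    calc 2 * π * (t i - 2 * δ) ^ 2 ≤ 2 * π * (cav (y i) r W - cav (y i) ρ W) ^ 2 := by
          gcongr
          exact (hpos i).le
      _ ≤ _ := e2
  have meas : ∀ i, MeasurableSet {x | r < dist x (y i) ∧ dist x (y i) < ρ} := by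
    intro i
    have hc : Continuous (fun x : E2 => dist x (y i)) := by fun_prop
    exact (isOpen_lt continuous_const hc).measurableSet.inter (isOpen_lt hc continuous_const).measurableSet
  have hdis : Disjoint {x | r < dist x (y 0) ∧ dist x (y 0) < ρ} {x | r < dist x (y 1) ∧ dist x (y 1) < ρ} := by
    rw [Set.disjoint_left]
    rintro x ⟨_, h1⟩ ⟨_, h2⟩
    have := dist_triangle_left (y 0) (y 1) x
    linarith
  have hsum : D 0 + D 1 ≤ I := by
    simp only [hD]
    rw [← setIntegral_union hdis (meas 1) Wi.integrableOn Wi.integrableOn]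
    exact (setIntegral_le_integral Wi (Eventually.of_forall hg0)).trans WI
  have hI0 : 0 ≤ I := integral_nonneg (fun x => by positivity)
  have a0 := each 0
  have a1 := each 1
  calc 2 * π * ((t 0 - 2 * δ) ^ 2 + (t 1 - 2 * δ) ^ 2) ≤ Real.log (ρ / r) * (D 0 + D 1) := by linarith
    _ ≤ Real.log (R0 / r) * I := by
      have := hL.le.trans hLL
      gcongr

section

structure Side (Ω : Set E2) (p : ℕ → ℝ) (w : ℕ → E2 → ℝ) (z : ℕ → E2) (zl : E2) (ε : ℕ → ℝ) (R0 : ℝ) : Prop where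
  ho : IsOpen Ω
  hb : IsBounded Ω
  hp1 : ∀ n, 1 < p n
  hp : Tendsto p atTop atTop
  sol : ∀ n, IsSolution Ω (p n) (w n)
  zmem : ∀ n, z n ∈ Ω
  zmax : ∀ n, ∀ y ∈ closure Ω, w n y ≤ w n (z n)
  pos : ∀ n, 0 < w n (z n)
  zlmem : zl ∈ Ω
  zlim : Tendsto z atTop (𝓝 zl)
  εpos : ∀ n, 0 < ε n
  εdef : ∀ n, ε n ^ 2 * (p n * w n (z n) ^ (p n - 1)) = 1
  R0pos : 0 < R0
  hR0 : ∀ c ∈ Ω, Ω ⊆ ball c R0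

def Ipos (Ω : Set E2) (p : ℝ) (w : E2 → ℝ) : ℝ := ∫ x in Ω, max (w x) 0 ^ (p + 1)

lemma Ipos_nonneg (Ω : Set E2) (p : ℝ) (w : E2 → ℝ) : 0 ≤ Ipos Ω p w :=
  integral_nonneg (fun x => by positivity)

variable {Ω : Set E2} {p : ℕ → ℝ} {w : ℕ → E2 → ℝ} {z : ℕ → E2} {zl : E2} {ε : ℕ → ℝ} {R0 : ℝ}

lemma Side.max' (h : Side Ω p w z zl ε R0) (n : ℕ) : ∀ x ∈ Ω, w n x ≤ w n (z n) :=
  fun x hx => h.zmax n x (subset_closure hx)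

lemma Side.Ile (h : Side Ω p w z zl ε R0) (n : ℕ) :
    Ipos Ω (p n) (w n) ≤ w n (z n) ^ (p n + 1) * volume.real Ω := by
  have := norm_setIntegral_le_of_norm_le_const (μ := volume) (s := Ω) (f := fun x => max (w n x) 0 ^ (p n + 1))
    (C := w n (z n) ^ (p n + 1)) h.hb.measure_lt_top (by
      intro x hx
      rw [Real.norm_eq_abs, abs_of_nonneg (by positivity)]
      exact Real.rpow_le_rpow (le_max_right _ _) (max_le (h.max' n x hx) (h.pos n).le) (by linarith [h.hp1 n]))
  exact (le_abs_self _).trans this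

lemma Side.ballz (h : Side Ω p w z zl ε R0) : ∃ ρ > 0, ∀ᶠ n in atTop, ball (z n) ρ ⊆ Ω := by
  obtain ⟨ρ, hρ, hb⟩ := Metric.isOpen_iff.1 h.ho zl h.zlmem
  refine ⟨ρ / 2, by positivity, ?_⟩
  filter_upwards [h.zlim (ball_mem_nhds zl (half_pos hρ))] with n hn
  intro x hx
  apply hb
  have h1 : dist (z n) zl < ρ / 2 := hn
  rw [mem_ball] at hx ⊢
  linarith [dist_triangle x (z n) zl]

lemma Side.lower (h : Side Ω p w z zl ε R0) : ∃ c0 > 0, ∀ᶠ n in atTop, c0 ≤ w n (z n) ^ (p n - 1) := by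
  obtain ⟨ρ, hρ, hball⟩ := h.ballz
  have hR := h.R0pos
  set r := min ρ R0 / 2 with hr
  have hr0 : 0 < r := by positivity
  have hr1 : r < ρ := by have := min_le_left ρ R0; rw [hr]; linarith
  have hr2 : r < R0 := by have := min_le_right ρ R0; rw [hr]; linarith
  have hL : 0 < Real.log (R0 / r) := Real.log_pos (by rw [lt_div_iff₀ hr0]; linarith)
  set L := Real.log (R0 / r)
  set V := volume.real Ω
  have hV : 0 ≤ V := measureReal_nonneg
  refine ⟨min (1 / r ^ 2) (1 / (L * V + 1)), by positivity, ?_⟩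
  filter_upwards [hball] with n hn
  have hm := h.pos n
  have hI := h.Ile n
  have hone := one_center h.ho h.hb (h.hp1 n) (h.sol n) hm.le (h.max' n) hr0 hr1 hn hr2 (h.hR0 _ (h.zmem n))
  set m := w n (z n)
  set q := m ^ (p n - 1) with hq
  have hq0 : 0 < q := by positivity
  have e1 : m ^ p n = q * m := by
    rw [hq, ← Real.rpow_add_one hm.ne', sub_add_cancel]
  have e2 : m ^ (p n + 1) = q * m * m := by rw [Real.rpow_add_one hm.ne', e1]
  by_cases hc : 1 ≤ q * r ^ 2
  · refine (min_le_left _ _).trans ?_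
    rw [div_le_iff₀ (by positivity)]; exact hc
  · push Not at hc
    refine (min_le_right _ _).trans ?_
    rw [div_le_iff₀ (by positivity)]
    have ht : 3 / 4 * m ≤ m - m ^ p n * r ^ 2 / 4 := by rw [e1]; nlinarith
    have h1 := hone (by nlinarith)
    have h2 : (3 / 4 * m) ^ 2 ≤ (m - m ^ p n * r ^ 2 / 4) ^ 2 := by gcongr
    have h3 : L * Ipos Ω (p n) (w n) ≤ L * (q * m * m * V) := by rw [e2] at hI; gcongr
    have h4 : 2 * 3 * (3 / 4 * m) ^ 2 ≤ 2 * π * (m - m ^ p n * r ^ 2 / 4) ^ 2 := by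
      gcongr; exact pi_gt_three.le
    have h5 : 2 * 3 * (3 / 4 * m) ^ 2 ≤ L * (q * m * m * V) := h4.trans (h1.trans h3)
    have h6 : m ^ 2 * 1 ≤ m ^ 2 * (L * V * q) := by nlinarith [sq_nonneg m]
    have h7 := le_of_mul_le_mul_left h6 (by positivity)
    nlinarith

lemma Side.eps (h : Side Ω p w z zl ε R0) : Tendsto ε atTop (𝓝 0) := by
  obtain ⟨c0, hc0, hc⟩ := h.lower
  have h1 : Tendsto (fun n => ε n ^ 2) atTop (𝓝 0) := by
    refine tendsto_of_tendsto_of_tendsto_of_le_of_le' tendsto_const_nhds (h := fun n => (p n * c0)⁻¹)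
      (tendsto_inv_atTop_zero.comp (h.hp.atTop_mul_const hc0)) (Eventually.of_forall fun n => by positivity) ?_
    filter_upwards [hc] with n hn
    have hp := h.hp1 n
    have := h.εdef n
    rw [← one_div, le_div_iff₀ (by positivity), ← this]
    gcongr
  have h2 := h1.sqrt
  rw [Real.sqrt_zero] at h2
  refine h2.congr (fun n => Real.sqrt_sq (h.εpos n).le)

lemma Side.half (h : Side Ω p w z zl ε R0) : ∀ᶠ n in atTop, 1 / 2 ≤ w n (z n) := by
  obtain ⟨c0, hc0, hc⟩ := h.lower
  have h1 : Tendsto (fun n => (1 / 2 : ℝ) ^ (p n - 1)) atTop (𝓝 0) :=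
    (tendsto_rpow_atTop_of_base_lt_one (1 / 2) (by norm_num) (by norm_num)).comp (tendsto_atTop_add_const_right _ (-1) h.hp)
  filter_upwards [hc, h1.eventually (gt_mem_nhds hc0)] with n h2 h3
  by_contra hn
  push Not at hn
  have := Real.rpow_le_rpow (h.pos n).le hn.le (by linarith [h.hp1 n] : 0 ≤ p n - 1)
  linarith

def tau (p : ℕ → ℝ) (R0 : ℝ) (n : ℕ) : ℝ := (|Real.log R0| + 1 / 2 * Real.log (p n) + 1 / 2 * Real.log 2) / p n

lemma Side.tau_lim (h : Side Ω p w z zl ε R0) : Tendsto (tau p R0) atTop (𝓝 0) := by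
  have h1 : Tendsto (fun x : ℝ => Real.log x / x) atTop (𝓝 0) := by
    have := Real.isLittleO_log_id_atTop.tendsto_div_nhds_zero
    exact this
  have h2 : Tendsto (fun x : ℝ => (|Real.log R0| + 1 / 2 * Real.log 2) / x + 1 / 2 * (Real.log x / x)) atTop (𝓝 (0 + 1 / 2 * 0)) :=
    (tendsto_const_nhds.div_atTop tendsto_id).add (h1.const_mul _)
  rw [mul_zero, add_zero] at h2
  refine (h2.comp h.hp).congr (fun n => ?_)
  simp only [tau, Function.comp]
  ring

lemma Side.tau_nonneg (h : Side Ω p w z zl ε R0) (n : ℕ) : 0 ≤ tau p R0 n := by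
  have := h.hp1 n
  have := Real.log_pos this
  have := Real.log_pos (by norm_num : (1:ℝ) < 2)
  unfold tau; positivity

lemma Side.logb (h : Side Ω p w z zl ε R0) : ∀ᶠ n in atTop,
    Real.log (R0 / ε n) ≤ p n * (tau p R0 n + w n (z n) ^ 2 / (4 * exp 1)) ∧
    Real.log (R0 / ε n) ≤ p n * (tau p R0 n + w n (z n) / 2) := by
  filter_upwards [h.half] with n hm
  have hp := h.hp1 n
  have hm0 := h.pos n
  have hd := h.εdef n
  have he := h.εpos n
  have hR := h.R0pos
  set m := w n (z n)
  have e1 : 2 * Real.log (ε n) = -(Real.log (p n) + (p n - 1) * Real.log m) := by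
    have := congrArg Real.log hd
    rw [Real.log_one, Real.log_mul (by positivity) (by positivity), Real.log_mul (by positivity) (by positivity),
      Real.log_rpow hm0, Real.log_pow] at this
    push_cast at this
    linarith
  have e2 : Real.log (R0 / ε n) = Real.log R0 + 1 / 2 * Real.log (p n) + (p n - 1) / 2 * Real.log m := by
    rw [Real.log_div hR.ne' he.ne']; linarith
  have e3 : -Real.log m ≤ Real.log 2 := by
    rw [← Real.log_inv]
    refine Real.log_le_log (by positivity) ?_
    rw [inv_le_comm₀ hm0 (by norm_num)]; linarith
  have e4 : p n * tau p R0 n = |Real.log R0| + 1 / 2 * Real.log (p n) + 1 / 2 * Real.log 2 := by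
    unfold tau; field_simp
  have e5 : Real.log (R0 / ε n) ≤ p n * tau p R0 n + p n * (Real.log m / 2) := by
    rw [e4, e2]; linarith [le_abs_self (Real.log R0)]
  have e6 : Real.log m / 2 ≤ m / 2 := by linarith [Real.log_le_sub_one_of_pos hm0]
  have e7 : Real.log m / 2 ≤ m ^ 2 / (4 * exp 1) := by
    have := Real.log_le_sub_one_of_pos (x := m ^ 2 / exp 1) (by positivity)
    rw [Real.log_div (by positivity) (by positivity), Real.log_pow, Real.log_exp] at this
    push_cast at this
    have e : m ^ 2 / (4 * exp 1) = (m ^ 2 / exp 1) / 4 := by field_simp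
    rw [e]; linarith
  have p0 : 0 ≤ p n := by linarith
  constructor
  · have := mul_le_mul_of_nonneg_left e7 p0
    rw [mul_add]; linarith
  · have := mul_le_mul_of_nonneg_left e6 p0
    rw [mul_add]; linarith

/-- the value `m^p ε² = m/p` -/
lemma Side.scale (h : Side Ω p w z zl ε R0) (n : ℕ) : w n (z n) ^ p n * ε n ^ 2 / 4 = w n (z n) / (4 * p n) := by
  have hp := h.hp1 n
  have hm := h.pos n
  have hd := h.εdef n
  set m := w n (z n)
  have e1 : m ^ p n = m ^ (p n - 1) * m := by rw [← Real.rpow_add_one hm.ne', sub_add_cancel]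
  rw [e1]
  have : m ^ (p n - 1) * ε n ^ 2 = 1 / p n := by
    rw [eq_div_iff (by positivity)]; linarith
  calc m ^ (p n - 1) * m * ε n ^ 2 / 4 = (m ^ (p n - 1) * ε n ^ 2) * m / 4 := by ring
    _ = _ := by rw [this]; field_simp

lemma Side.one (h : Side Ω p w z zl ε R0) : ∀ᶠ n in atTop,
    2 * π * (w n (z n) * (1 - 1 / (4 * p n))) ^ 2 ≤ Real.log (R0 / ε n) * Ipos Ω (p n) (w n) := by
  obtain ⟨ρ, hρ, hball⟩ := h.ballz
  filter_upwards [hball, h.eps.eventually (gt_mem_nhds hρ), h.eps.eventually (gt_mem_nhds h.R0pos)] with n hn h1 h2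
  have hp := h.hp1 n
  have hm := h.pos n
  have := one_center h.ho h.hb (h.hp1 n) (h.sol n) hm.le (h.max' n) (h.εpos n) h1 hn h2 (h.hR0 _ (h.zmem n))
  have e : w n (z n) - w n (z n) ^ p n * ε n ^ 2 / 4 = w n (z n) * (1 - 1 / (4 * p n)) := by
    rw [h.scale n]; field_simp
  rw [e] at this
  refine this (mul_nonneg hm.le ?_)
  rw [sub_nonneg, div_le_one (by positivity)]; linarith

lemma Side.Elow (h : Side Ω p w z zl ε R0) {η : ℝ} (hη : 0 < η) : ∀ᶠ n in atTop,
    8 * π * exp 1 - η ≤ p n * Ipos Ω (p n) (w n) := by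
  have l1 : Tendsto (fun n => 1 / (4 * p n)) atTop (𝓝 0) := by
    simpa using (tendsto_const_nhds (x := (1:ℝ))).div_atTop (h.hp.const_mul_atTop (by norm_num : (0:ℝ) < 4))
  have l2 : Tendsto (fun n => 2 * π * (1 - 1 / (4 * p n)) ^ 2 / (4 * tau p R0 n + 1 / (4 * exp 1))) atTop
      (𝓝 (2 * π * (1 - 0) ^ 2 / (4 * 0 + 1 / (4 * exp 1)))) :=
    (((tendsto_const_nhds.sub l1).pow 2).const_mul _).div ((h.tau_lim.const_mul 4).add tendsto_const_nhds) (by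
      have := exp_pos 1; positivity)
  have e : 2 * π * (1 - 0) ^ 2 / (4 * 0 + 1 / (4 * exp 1)) = 8 * π * exp 1 := by field_simp; ring
  rw [e] at l2
  filter_upwards [l2.eventually (lt_mem_nhds (show 8 * π * exp 1 - η < 8 * π * exp 1 by linarith)), h.one, h.logb, h.half] with n h1 h2 h3 h4
  refine h1.le.trans ?_
  have ht := h.tau_nonneg n
  have hI := Ipos_nonneg Ω (p n) (w n)
  rw [div_le_iff₀ (by positivity)]
  have hm := h.pos n
  set m := w n (z n)
  have h5 := h2.trans (mul_le_mul_of_nonneg_right h3.1 hI)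
  have hp := h.hp1 n
  have h6 : tau p R0 n ≤ 4 * tau p R0 n * m ^ 2 := by
    have : 1 ≤ 4 * m ^ 2 := by nlinarith
    have := mul_le_mul_of_nonneg_left this ht
    linarith
  have h7 : tau p R0 n + m ^ 2 / (4 * exp 1) ≤ m ^ 2 * (4 * tau p R0 n + 1 / (4 * exp 1)) := by
    have : m ^ 2 / (4 * exp 1) = m ^ 2 * (1 / (4 * exp 1)) := by ring
    rw [this]; linarith
  have h8 := mul_le_mul_of_nonneg_left h7 (by positivity : 0 ≤ p n * Ipos Ω (p n) (w n))
  have h9 : m ^ 2 * (2 * π * (1 - 1 / (4 * p n)) ^ 2) ≤ m ^ 2 * (p n * Ipos Ω (p n) (w n) * (4 * tau p R0 n + 1 / (4 * exp 1))) := by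
    linarith
  exact le_of_mul_le_mul_left h9 (by positivity)

lemma Side.bdd (h : Side Ω p w z zl ε R0) {C : ℝ} (hC : ∀ᶠ n in atTop, p n * Ipos Ω (p n) (w n) ≤ C) :
    ∃ B > 0, ∀ᶠ n in atTop, w n (z n) ≤ B := by
  refine ⟨5 * |C| + 1, by positivity, ?_⟩
  filter_upwards [hC, h.one, h.logb, h.half, h.tau_lim.eventually (gt_mem_nhds one_pos)] with n hC h2 h3 h4 h5
  have ht := h.tau_nonneg n
  have hI := Ipos_nonneg Ω (p n) (w n)
  have hm := h.pos n
  have hp := h.hp1 n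
  set m := w n (z n)
  have h6 := h2.trans (mul_le_mul_of_nonneg_right h3.2 hI)
  have h7 : 3 / 4 ≤ 1 - 1 / (4 * p n) := by
    have : 1 / (4 * p n) ≤ 1 / 4 := one_div_le_one_div_of_le (by norm_num) (by linarith)
    linarith
  have h8 : 2 * 3 * (m * (3 / 4)) ^ 2 ≤ 2 * π * (m * (1 - 1 / (4 * p n))) ^ 2 := by
    gcongr; exact pi_gt_three.le
  have h9 : p n * (tau p R0 n + m / 2) * Ipos Ω (p n) (w n) ≤ (1 + m / 2) * |C| := by
    have : p n * Ipos Ω (p n) (w n) ≤ |C| := hC.trans (le_abs_self _)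
    calc _ = (tau p R0 n + m / 2) * (p n * Ipos Ω (p n) (w n)) := by ring
      _ ≤ _ := by gcongr
  have h10 : m * m ≤ m * (5 * |C|) := by
    have : (1 + m / 2) * |C| ≤ (5 / 2 * m) * |C| := by gcongr; linarith
    nlinarith [mul_nonneg hm.le (abs_nonneg C)]
  have := le_of_mul_le_mul_left h10 hm
  linarith

end

set_option maxHeartbeats 1000000 in
lemma Side.far {Ω : Set E2} {p : ℕ → ℝ} {w : ℕ → E2 → ℝ} {z : ℕ → E2} {zl : E2} {ε : ℕ → ℝ} {R0 : ℝ}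
    (h : Side Ω p w z zl ε R0)
    (hE : ∀ η > 0, ∀ᶠ n in atTop, p n * Ipos Ω (p n) (w n) ≤ 8 * π * exp 1 + η)
    {x0 : E2} {ρ : ℝ} (hρ : 0 < ρ) (hρR : ρ < R0) (hx0 : ball x0 (2 * ρ) ⊆ Ω) (hz : ball zl (2 * ρ) ⊆ Ω)
    (hd : 4 * ρ ≤ dist x0 zl) : ∀ᶠ n in atTop, ∀ y ∈ ball x0 ρ, w n y ≤ 1 / 2 := by
  obtain ⟨B, hB, hBm⟩ := h.bdd (hE 1 one_pos)
  set C := 8 * π * exp 1 + 1 with hCd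
  have hC0 : 0 < C := by positivity
  have hL0 : 0 < Real.log (R0 / ρ) := Real.log_pos (by rw [lt_div_iff₀ hρ]; linarith)
  set L0 := Real.log (R0 / ρ)
  set s : ℕ → ℝ := fun n => √(L0 * (C / p n) / (2 * π)) with hs
  have ls : Tendsto s atTop (𝓝 0) := by
    have h1 : Tendsto (fun n => L0 * (C / p n) / (2 * π)) atTop (𝓝 (L0 * 0 / (2 * π))) :=
      ((tendsto_const_nhds.div_atTop h.hp).const_mul L0).div_const _
    have h2 := h1.sqrt
    simpa using h2
  have lp : Tendsto (fun n => B / (4 * p n)) atTop (𝓝 0) :=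
    tendsto_const_nhds.div_atTop (h.hp.const_mul_atTop (by norm_num : (0:ℝ) < 4))
  have lk : Tendsto (fun n => tau p R0 n * C + 4 * π * B * (B / (4 * p n) + s n)) atTop (𝓝 0) := by
    have := (h.tau_lim.mul_const C).add ((lp.add ls).const_mul (4 * π * B))
    simpa using this
  have hη : 0 < 1 / B ^ 2 := by positivity
  filter_upwards [hBm, hE 1 one_pos, hE _ hη, ls.eventually (gt_mem_nhds (by norm_num : (0:ℝ) < 1 / 8)),
    lp.eventually (gt_mem_nhds (by norm_num : (0:ℝ) < 1 / 8)), lk.eventually (gt_mem_nhds (by norm_num : (0:ℝ) < 1 / 8)),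
    h.half, h.logb, h.zlim (ball_mem_nhds zl hρ), h.eps.eventually (gt_mem_nhds hρ)] with n h1 h2 h3 h4 h5 h6 h7 h8 h9 h10 y hy
  by_contra hc
  push Not at hc
  have hp := h.hp1 n
  have hm := h.pos n
  have hzn : dist (z n) zl < ρ := h9
  have hyx : dist y x0 < ρ := hy
  have hI := Ipos_nonneg Ω (p n) (w n)
  have hs0 : 0 ≤ s n := sqrt_nonneg _
  have hsq : 2 * π * s n ^ 2 = L0 * (C / p n) := by
    rw [hs, Real.sq_sqrt (by positivity)]; field_simp
  have bz : ball (z n) ρ ⊆ Ω := fun x hx => hz (by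
    rw [mem_ball] at hx ⊢; linarith [dist_triangle x (z n) zl])
  have bY : ball y ρ ⊆ Ω := fun x hx => hx0 (by
    rw [mem_ball] at hx ⊢; linarith [dist_triangle x y x0])
  have hyΩ : y ∈ Ω := bY (mem_ball_self hρ)
  have hsc := h.scale n
  have hmp : w n (z n) / (4 * p n) ≤ B / (4 * p n) := by gcongr
  have key := two_center h.ho h.hb hp (h.sol n) hm.le (h.max' n) (y := ![z n, y]) (r := ε n) (ρ := ρ) (R0 := R0) (s := s n)
    (h.εpos n) h10 (by intro i; fin_cases i; exacts [bz, bY])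
    (by
      show 2 * ρ ≤ dist (z n) y
      have a1 := dist_triangle x0 y zl
      have a2 := dist_triangle y (z n) zl
      rw [dist_comm] at hyx
      rw [dist_comm (z n) y]
      linarith) hρR (by intro i; fin_cases i; exacts [h.hR0 _ (h.zmem n), h.hR0 _ hyΩ]) hs0
    (by
      rw [hsq]
      refine mul_le_mul_of_nonneg_left ?_ hL0.le
      rw [le_div_iff₀ (by linarith)]
      have : Ipos Ω (p n) (w n) * p n ≤ C := by linarith
      exact this)
    (by
      intro i; fin_cases i
      · show 0 < w n (z n) - w n (z n) ^ p n * ε n ^ 2 / 4 - s n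
        rw [hsc]; linarith
      · show 0 < w n y - w n (z n) ^ p n * ε n ^ 2 / 4 - s n
        rw [hsc]; linarith)
  replace key : 2 * π * ((w n (z n) - w n (z n) ^ p n * ε n ^ 2 / 4 - s n) ^ 2 + (w n y - w n (z n) ^ p n * ε n ^ 2 / 4 - s n) ^ 2)
      ≤ Real.log (R0 / ε n) * Ipos Ω (p n) (w n) := key
  rw [hsc] at key
  have k1 := key.trans (mul_le_mul_of_nonneg_right h8.1 hI)
  set m := w n (z n)
  set d := m / (4 * p n) + s n with hdd
  have hd0 : 0 ≤ d := by positivity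
  set E := p n * Ipos Ω (p n) (w n) with hEd
  have hE0 : 0 ≤ E := by positivity
  have ht := h.tau_nonneg n
  have k2 : p n * (tau p R0 n + m ^ 2 / (4 * exp 1)) * Ipos Ω (p n) (w n) = tau p R0 n * E + m ^ 2 / (4 * exp 1) * E := by
    rw [hEd]; ring
  have k3 : m ^ 2 / (4 * exp 1) * E ≤ 2 * π * m ^ 2 + 1 / 8 := by
    have a1 : m ^ 2 / (4 * exp 1) * E ≤ m ^ 2 / (4 * exp 1) * (8 * π * exp 1 + 1 / B ^ 2) := by gcongr
    have a2 : m ^ 2 / (4 * exp 1) * (8 * π * exp 1 + 1 / B ^ 2) = 2 * π * m ^ 2 + (m ^ 2 / B ^ 2) / (4 * exp 1) := by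
      field_simp; ring
    have a3 : m ^ 2 / B ^ 2 ≤ 1 := by
      rw [div_le_one (by positivity)]; gcongr
    have a4 : (m ^ 2 / B ^ 2) / (4 * exp 1) ≤ 1 / 8 := by
      rw [div_le_iff₀ (by positivity)]
      have := Real.add_one_le_exp (1:ℝ)
      linarith
    linarith
  have k4 : tau p R0 n * E ≤ tau p R0 n * C := by gcongr
  have k5 : m ^ 2 - 2 * B * d ≤ (m - m / (4 * p n) - s n) ^ 2 := by
    have : (m - m / (4 * p n) - s n) ^ 2 = m ^ 2 - 2 * m * d + d ^ 2 := by rw [hdd]; ring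
    rw [this]
    nlinarith [sq_nonneg d, mul_le_mul_of_nonneg_right h1 hd0]
  have k6 : (1 / 4) ^ 2 ≤ (w n y - m / (4 * p n) - s n) ^ 2 := by
    apply pow_le_pow_left₀ (by norm_num); linarith
  have k7 : d ≤ B / (4 * p n) + s n := by rw [hdd]; linarith
  have k8 : 4 * π * B * d ≤ 4 * π * B * (B / (4 * p n) + s n) := by gcongr
  have k9 : 2 * π * (m ^ 2 - 2 * B * d + (1 / 4) ^ 2) ≤ 2 * π * ((m - m / (4 * p n) - s n) ^ 2 + (w n y - m / (4 * p n) - s n) ^ 2) := by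
    gcongr
  have := pi_gt_three
  linarith

lemma pd_affine {U : Set E2} (hU : IsOpen U) {f : E2 → ℝ} (hf : ContDiffOn ℝ 1 f U) (X : E2) (a e b : ℝ) (i : Fin 2) {z : E2}
    (hz : X + e • z ∈ U) : pd i (fun z => a * f (X + e • z) + b) z = a * e * pd i f (X + e • z) + 0 := by
  have h1 : HasFDerivAt f (fderiv ℝ f (X + e • z)) (X + e • z) :=
    ((hf.contDiffAt (hU.mem_nhds hz)).differentiableAt (by norm_num)).hasFDerivAt
  have h2 : HasFDerivAt (fun z : E2 => X + e • z) (e • ContinuousLinearMap.id ℝ E2) z :=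
    ((hasFDerivAt_id z).const_smul e).const_add X
  have h3 : HasFDerivAt (fun z : E2 => f (X + e • z)) ((fderiv ℝ f (X + e • z)).comp (e • ContinuousLinearMap.id ℝ E2)) z :=
    h1.comp z h2
  have h4 := (h3.const_mul a).add_const b
  rw [pd_of h4]
  simp [pd]; ring

lemma lap_affine {U : Set E2} (hU : IsOpen U) {f : E2 → ℝ} (hf : ContDiffOn ℝ 2 f U) (X : E2) (a e b : ℝ) {z : E2}
    (hz : X + e • z ∈ U) : lap (fun z => a * f (X + e • z) + b) z = a * e ^ 2 * lap f (X + e • z) := by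
  have hU' : IsOpen {z : E2 | X + e • z ∈ U} := hU.preimage (by fun_prop)
  have cpd : ∀ i, ContDiffOn ℝ 1 (pd i f) U := by
    intro i
    have h1 : ContDiffOn ℝ 1 (fderiv ℝ f) U := hf.fderiv_of_isOpen hU (by norm_num)
    exact h1.clm_apply contDiffOn_const
  have h : ∀ i, pd i (pd i (fun z => a * f (X + e • z) + b)) z = a * e * e * pd i (pd i f) (X + e • z) + 0 := by
    intro i
    rw [pd_congr hU' (fun y hy => pd_affine hU (hf.of_le (by norm_num)) X a e b i hy) i hz]
    exact pd_affine hU (cpd i) X (a * e) e 0 i hz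
  rw [lap_eq, lap_eq, h, h]; ring

lemma mass_scale {Ω : Set E2} (hΩ : IsOpen Ω) {g : E2 → ℝ} (hg : IntegrableOn g Ω) (hg0 : ∀ x, 0 ≤ g x) {X : E2} {e r : ℝ} (he : 0 < e)
    (hb : ball X (e * r) ⊆ Ω) : ∫ z in ball (0:E2) r, g (X + e • z) ≤ (e ^ 2)⁻¹ * ∫ x in Ω, g x := by
  have h1 := MeasureTheory.Measure.setIntegral_comp_smul_of_pos (volume : Measure E2) (fun y => g (X + y)) (ball (0:E2) r) he
  rw [_root_.smul_ball he.ne', smul_zero, Real.norm_eq_abs, abs_of_pos he] at h1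
  have h2 : (fun x => X + x) ⁻¹' (ball X (e * r)) = ball (0:E2) (e * r) := by
    ext x; simp [mem_ball, dist_eq_norm]
  have h3 := (MeasureTheory.measurePreserving_add_left (volume : Measure E2) X).setIntegral_preimage_emb
    (measurableEmbedding_addLeft X) g (ball X (e * r))
  rw [h2] at h3
  rw [h1, h3]
  simp only [finrank_euclideanSpace, Fintype.card_fin, smul_eq_mul]
  gcongr
  · exact Eventually.of_forall hg0

set_option maxHeartbeats 1000000 in
lemma side_lim {Ω : Set E2} {p : ℕ → ℝ} {u : ℕ → E2 → ℝ} {X : ℕ → E2} {x : E2} {ε : ℕ → ℝ} {R0 : ℝ}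
    (h : Side Ω p u X x ε R0) {ρ : ℝ} (hρ : 0 < ρ) (hx : ball x ρ ⊆ Ω)
    (hfar : ∀ᶠ n in atTop, ∀ y ∈ ball x ρ, -u n y ≤ 1 / 2) {C : ℝ}
    (hC : ∀ᶠ n in atTop, p n * ∫ x in Ω, |u n x| ^ (p n + 1) ≤ C)
    {ξ : ℕ → E2 → ℝ} (hξreg : ∀ n, ContDiffOn ℝ 2 (ξ n) Ω)
    (hξeq : ∀ n, ∀ y ∈ Ω, -lap (ξ n) y = p n * |u n y| ^ (p n - 1) * ξ n y)
    (hξ1 : ∀ n, ∀ y ∈ Ω, |ξ n y| ≤ 1) :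
    ∃ φ : ℕ → ℕ, StrictMono φ ∧ ∃ a : ℝ, ∃ b : Fin 2 → ℝ, TendstoC2LocOn Set.univ
      (fun m z => ξ (φ m) (X (φ m) + ε (φ m) • z)) (fun z => a * ((8 - ‖z‖ ^ 2) / (8 + ‖z‖ ^ 2)) +
        ∑ j : Fin 2, b j * z j / (8 + ‖z‖ ^ 2)) := by
  set M : ℕ → ℝ := fun n => u n (X n) with hM
  set v : ℕ → E2 → ℝ := fun n z => p n / M n * u n (X n + ε n • z) + - p n with hv
  set R : ℕ → ℝ := fun n => (ρ / 2) / ε n with hR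
  have lR : Tendsto R atTop atTop := by
    have : Tendsto ε atTop (𝓝[>] 0) := tendsto_nhdsWithin_iff.2 ⟨h.eps, Eventually.of_forall fun n => h.εpos n⟩
    exact (tendsto_inv_nhdsGT_zero.comp this).const_mul_atTop (half_pos hρ)
  have mem : ∀ᶠ n in atTop, ∀ z ∈ ball (0:E2) (R n), X n + ε n • z ∈ ball x ρ := by
    filter_upwards [h.zlim (ball_mem_nhds x (half_pos hρ))] with n hn z hz
    have h1 : dist (X n) x < ρ / 2 := hn
    have h2 : dist (X n + ε n • z) (X n) < ρ / 2 := by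
      rw [dist_eq_norm, add_sub_cancel_left, norm_smul, Real.norm_eq_abs, abs_of_pos (h.εpos n)]
      rw [mem_ball_zero_iff, hR, lt_div_iff₀ (h.εpos n)] at hz
      linarith
    rw [mem_ball]
    linarith [dist_triangle (X n + ε n • z) (X n) x]
  have hvp : ∀ n z, 1 + v n z / p n = u n (X n + ε n • z) / M n := by
    intro n z
    have := h.hp1 n
    have := h.pos n
    have : M n ≠ 0 := this.ne'
    simp only [hv]; field_simp; ring
  have hA : ∀ n, ContDiff ℝ 2 (fun z : E2 => X n + ε n • z) := fun n => by fun_prop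
  have cont : ∀ n, ContinuousOn (fun x => |u n x| ^ (p n + 1)) (closure Ω) := fun n =>
    (h.sol n).2.1.abs.rpow_const (fun x _ => Or.inr (by linarith [h.hp1 n]))
  refine local_final (p := p) h.hp (v := v) (ξ := fun n z => ξ n (X n + ε n • z)) lR ?_ ?_ ?_ (C0 := 4 * C) ?_
  · intro n
    have : M n ≠ 0 := (h.pos n).ne'
    simp only [hv, smul_zero, add_zero]
    change p n / M n * M n + -p n = 0
    field_simp; ring
  · filter_upwards [mem] with n hn
    have maps : Set.MapsTo (fun z : E2 => X n + ε n • z) (ball 0 (R n)) Ω := fun z hz => hx (hn z hz)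
    refine ⟨?_, (hξreg n).comp (hA n).contDiffOn maps⟩
    exact (contDiffOn_const.mul ((h.sol n).1.comp (hA n).contDiffOn maps)).add contDiffOn_const
  · filter_upwards [mem, hfar, h.half] with n hn hf hhalf z hz
    have hy := hn z hz
    have hyΩ := hx hy
    have hm := h.pos n
    have hp := h.hp1 n
    have hd := h.εdef n
    rw [hvp]
    have eq1 := (h.sol n).2.2.1 _ hyΩ
    have eq2 := hξeq n _ hyΩ
    have hle := h.max' n _ hyΩ
    have hge := hf _ hy
    have l1 := lap_affine h.ho (h.sol n).1 (X n) (p n / M n) (ε n) (- p n) hyΩ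
    have l2 := lap_affine h.ho (hξreg n) (X n) 1 (ε n) 0 hyΩ
    simp only [one_mul, add_zero] at l2
    set y := X n + ε n • z
    set m := u n (X n) with hmd
    have hMm : M n = m := rfl
    rw [hMm] at l1 ⊢
    have q : |u n y / m| ^ (p n - 1) = |u n y| ^ (p n - 1) / m ^ (p n - 1) := by
      rw [abs_div, abs_of_pos hm, Real.div_rpow (abs_nonneg _) hm.le]
    have qe : ε n ^ 2 = 1 / (p n * m ^ (p n - 1)) := by
      rw [eq_div_iff (by positivity)]; exact hd
    refine ⟨?_, ?_, ?_, hξ1 n _ hyΩ, ?_⟩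
    · have : v n z = p n * (u n y / m - 1) := by simp only [hv, hMm]; ring
      rw [this]
      have : u n y / m ≤ 1 := by rw [div_le_one hm]; exact hle
      nlinarith
    · rw [abs_div, abs_of_pos hm, div_le_one hm, abs_le]
      exact ⟨by linarith, hle⟩
    · show lap (fun z => p n / M n * u n (X n + ε n • z) + - p n) z = _
      rw [hMm, l1, q, qe, show lap (u n) y = -(|u n y| ^ (p n - 1) * u n y) by linarith]
      have : m ^ (p n - 1) ≠ 0 := by positivity
      field_simp
    · rw [l2, q, qe, show lap (ξ n) y = -(p n * |u n y| ^ (p n - 1) * ξ n y) by linarith]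
      have : m ^ (p n - 1) ≠ 0 := by positivity
      field_simp
  · intro r
    filter_upwards [mem, h.half, hC, lR.eventually_ge_atTop r] with n hn hhalf hCn hr
    have hm := h.pos n
    have hp := h.hp1 n
    have he := h.εpos n
    have hd := h.εdef n
    have hb : ball (X n) (ε n * r) ⊆ Ω := by
      intro y hy
      have : (ε n)⁻¹ • (y - X n) ∈ ball (0:E2) (R n) := by
        rw [mem_ball_zero_iff, norm_smul, Real.norm_eq_abs, abs_of_pos (by positivity)]
        rw [mem_ball, dist_eq_norm] at hy
        refine lt_of_lt_of_le ?_ hr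
        rw [inv_mul_lt_iff₀ he]; exact hy
      have := hx (hn _ this)
      rwa [smul_inv_smul₀ he.ne', add_sub_cancel] at this
    have hint : IntegrableOn (fun x => |u n x| ^ (p n + 1)) Ω :=
      ((cont n).integrableOn_compact h.hb.isCompact_closure).mono_set subset_closure
    have ms := mass_scale h.ho (g := fun x => |u n x| ^ (p n + 1)) hint (fun x => by positivity) he hb
    have e1 : ∀ z, |1 + v n z / p n| ^ (p n + 1) = (M n ^ (p n + 1))⁻¹ * |u n (X n + ε n • z)| ^ (p n + 1) := by
      intro z
      rw [hvp, abs_div, abs_of_pos hm, Real.div_rpow (abs_nonneg _) hm.le, div_eq_inv_mul]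
    simp only [e1]
    rw [integral_const_mul]
    have hMm : M n = u n (X n) := rfl
    rw [hMm]
    set m := u n (X n)
    set J := ∫ x in Ω, |u n x| ^ (p n + 1)
    have hJ : 0 ≤ J := integral_nonneg (fun x => by positivity)
    have e2 : m ^ (p n + 1) = m ^ (p n - 1) * m ^ 2 := by
      rw [← Real.rpow_natCast m 2, ← Real.rpow_add hm]; congr 1; push_cast; ring
    have e3 : (ε n ^ 2)⁻¹ = p n * m ^ (p n - 1) := by
      exact inv_eq_of_mul_eq_one_right hd
    calc (m ^ (p n + 1))⁻¹ * ∫ z in ball (0:E2) r, |u n (X n + ε n • z)| ^ (p n + 1)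
        ≤ (m ^ (p n + 1))⁻¹ * ((ε n ^ 2)⁻¹ * J) := by gcongr
      _ = (p n * J) / m ^ 2 := by
        rw [e2, e3]
        have : m ^ (p n - 1) ≠ 0 := by positivity
        field_simp
      _ ≤ 4 * C := by
        rw [div_le_iff₀ (by positivity)]
        have h0 : 0 ≤ p n * J := by positivity
        have h1 : 1 ≤ 4 * m ^ 2 := by nlinarith
        nlinarith

lemma sol_neg {Ω : Set E2} {p : ℝ} {u : E2 → ℝ} (h : IsSolution Ω p u) : IsSolution Ω p (fun x => -u x) := by
  obtain ⟨h1, h2, h3, h4⟩ := h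
  refine ⟨h1.neg, h2.neg, fun x hx => ?_, fun x hx => by simp [h4 x hx]⟩
  rw [lap_neg, abs_neg]
  linarith [h3 x hx]

lemma Ipos_split {Ω : Set E2} (hb : IsBounded Ω) {p : ℝ} (hp : 1 < p) {u : E2 → ℝ}
    (hu : ContinuousOn u (closure Ω)) :
    ∫ x in Ω, |u x| ^ (p + 1) = Ipos Ω p u + Ipos Ω p (fun x => -u x) := by
  have key : ∀ v : E2 → ℝ, ContinuousOn v (closure Ω) →
      IntegrableOn (fun x => max (v x) 0 ^ (p + 1)) Ω := by
    intro v hv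
    have hc : ContinuousOn (fun x => max (v x) 0 ^ (p + 1)) (closure Ω) :=
      (hv.sup continuousOn_const).rpow_const (fun x _ => Or.inr (by linarith))
    exact (hc.integrableOn_compact hb.isCompact_closure).mono_set subset_closure
  unfold Ipos
  rw [← integral_add (key u hu) (key (fun x => -u x) hu.neg)]
  congr 1
  funext x
  have h0 : (0:ℝ) ^ (p + 1) = 0 := Real.zero_rpow (by linarith)
  rcases le_total 0 (u x) with h | h
  · rw [abs_of_nonneg h, max_eq_left h, max_eq_right (by linarith), h0, add_zero]
  · rw [abs_of_nonpos h, max_eq_right h, max_eq_left (by linarith), h0, zero_add]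

lemma Side.sub {Ω : Set E2} {p : ℕ → ℝ} {w : ℕ → E2 → ℝ} {z : ℕ → E2} {zl : E2} {ε : ℕ → ℝ} {R0 : ℝ}
    (h : Side Ω p w z zl ε R0) {φ : ℕ → ℕ} (hφ : StrictMono φ) :
    Side Ω (fun n => p (φ n)) (fun n => w (φ n)) (fun n => z (φ n)) zl (fun n => ε (φ n)) R0 where
  ho := h.ho
  hb := h.hb
  hp1 := fun n => h.hp1 _
  hp := h.hp.comp hφ.tendsto_atTop
  sol := fun n => h.sol _
  zmem := fun n => h.zmem _
  zmax := fun n => h.zmax _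
  pos := fun n => h.pos _
  zlmem := h.zlmem
  zlim := h.zlim.comp hφ.tendsto_atTop
  εpos := fun n => h.εpos _
  εdef := fun n => h.εdef _
  R0pos := h.R0pos
  hR0 := h.hR0

lemma C2_sub {S : Set E2} {F : ℕ → E2 → ℝ} {g : E2 → ℝ} (h : TendstoC2LocOn S F g) {φ : ℕ → ℕ}
    (hφ : StrictMono φ) : TendstoC2LocOn S (fun n => F (φ n)) g :=
  fun K hK hc k hk u hu => hφ.tendsto_atTop.eventually (h K hK hc k hk u hu)

/-- Lemma 4.1: local limit of rescalings of solutions of the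
linearized problem: combinations of `(8−|z|²)/(8+|z|²)` and `z_j/(8+|z|²)`. -/
theorem linearized_rescaled_limit
    (Ω : Set E2) (hΩo : IsOpen Ω) (hΩb : IsBounded Ω) (hΩne : Ω.Nonempty)
    (p : ℕ → ℝ) (hp1 : ∀ n, 1 < p n) (hptop : Tendsto p atTop atTop)
    (u : ℕ → E2 → ℝ)
    (hsol : ∀ n, IsSolution Ω (p n) (u n))
    (hnod : ∀ n, IsNodal Ω (u n))
    (hlow : Tendsto (fun n => p n * ∫ x in Ω, |u n x| ^ (p n + 1)) atTop
      (𝓝 (16 * π * Real.exp 1)))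
    (xl : Fin 2 → ℕ → E2)
    (hmax : ∀ n, xl 0 n ∈ Ω ∧ ∀ y ∈ closure Ω, u n y ≤ u n (xl 0 n))
    (hmin : ∀ n, xl 1 n ∈ Ω ∧ ∀ y ∈ closure Ω, u n (xl 1 n) ≤ u n y)
    (x : Fin 2 → E2) (hx : ∀ i, x i ∈ Ω) (hxne : x 0 ≠ x 1)
    (hxconv : ∀ i, Tendsto (fun n => xl i n) atTop (𝓝 (x i)))
    (ε : Fin 2 → ℕ → ℝ) (hεpos : ∀ i n, 0 < ε i n)
    (hεdef : ∀ i n, (ε i n) ^ 2 * (p n * |u n (xl i n)| ^ (p n - 1)) = 1)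
    (ξ : ℕ → E2 → ℝ)
    (hξreg : ∀ n, ContDiffOn ℝ 2 (ξ n) Ω ∧ ContinuousOn (ξ n) (closure Ω))
    (hξeq : ∀ n, ∀ y ∈ Ω, -lap (ξ n) y = p n * |u n y| ^ (p n - 1) * ξ n y)
    (hξ0 : ∀ n, ∀ y ∈ frontier Ω, ξ n y = 0)
    (hξnorm : ∀ n, (∀ y ∈ closure Ω, |ξ n y| ≤ 1) ∧ ∃ y ∈ closure Ω, |ξ n y| = 1)
    :
    ∃ φ : ℕ → ℕ, StrictMono φ ∧ ∃ a : Fin 2 → ℝ, ∃ b : Fin 2 → Fin 2 → ℝ,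
      ∀ i : Fin 2, TendstoC2LocOn Set.univ
        (fun m z => ξ (φ m) (xl i (φ m) + ε i (φ m) • z))
        (fun z => a i * ((8 - ‖z‖ ^ 2) / (8 + ‖z‖ ^ 2)) +
          ∑ j : Fin 2, b i j * z j / (8 + ‖z‖ ^ 2)) := by
  obtain ⟨R1, hR1⟩ := hΩb.subset_ball (0 : E2)
  have hR1pos : 0 < R1 := by
    obtain ⟨c, hc⟩ := hΩne
    exact pos_of_mem_ball (hR1 hc)
  have hR0 : ∀ c ∈ Ω, Ω ⊆ ball c (2 * R1) := by
    intro c hc y hy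
    have h1 := hR1 hc
    have h2 := hR1 hy
    rw [mem_ball] at *
    have := dist_triangle_right y c 0
    linarith
  have up : ∀ n, 0 < u n (xl 0 n) := by
    intro n
    obtain ⟨y, hy, hyp⟩ := (hnod n).1
    exact hyp.trans_le ((hmax n).2 y (subset_closure hy))
  have un : ∀ n, 0 < -u n (xl 1 n) := by
    intro n
    obtain ⟨y, hy, hyp⟩ := (hnod n).2
    have := (hmin n).2 y (subset_closure hy)
    linarith
  have S0 : Side Ω p u (xl 0) (x 0) (ε 0) (2 * R1) :=
    { ho := hΩo, hb := hΩb, hp1 := hp1, hp := hptop, sol := hsol, zmem := fun n => (hmax n).1,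
      zmax := fun n => (hmax n).2, pos := up, zlmem := hx 0, zlim := hxconv 0, εpos := hεpos 0,
      εdef := fun n => by
        have := hεdef 0 n
        rwa [abs_of_pos (up n)] at this
      R0pos := by linarith
      hR0 := hR0 }
  have S1 : Side Ω p (fun n x => -u n x) (xl 1) (x 1) (ε 1) (2 * R1) :=
    { ho := hΩo, hb := hΩb, hp1 := hp1, hp := hptop, sol := fun n => sol_neg (hsol n)
      zmem := fun n => (hmin n).1,
      zmax := fun n y hy => neg_le_neg ((hmin n).2 y hy), pos := un, zlmem := hx 1
      zlim := hxconv 1, εpos := hεpos 1,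
      εdef := fun n => by
        have := hεdef 1 n
        rwa [← abs_neg, abs_of_pos (un n)] at this
      R0pos := by linarith
      hR0 := hR0 }
  have split : ∀ n, p n * ∫ x in Ω, |u n x| ^ (p n + 1) =
      p n * Ipos Ω (p n) (u n) + p n * Ipos Ω (p n) (fun x => -u n x) := by
    intro n
    rw [Ipos_split hΩb (hp1 n) (hsol n).2.1, mul_add]
  have tot : ∀ η > 0, ∀ᶠ n in atTop, p n * ∫ x in Ω, |u n x| ^ (p n + 1) ≤ 16 * π * Real.exp 1 + η :=
    fun η hη => hlow.eventually_le_const (by linarith)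
  have E0 : ∀ η > 0, ∀ᶠ n in atTop, p n * Ipos Ω (p n) (u n) ≤ 8 * π * Real.exp 1 + η := by
    intro η hη
    filter_upwards [tot (η / 2) (half_pos hη), S1.Elow (half_pos hη)] with n h1 h2
    rw [split] at h1
    linarith
  have E1 : ∀ η > 0, ∀ᶠ n in atTop, p n * Ipos Ω (p n) (fun x => -u n x) ≤ 8 * π * Real.exp 1 + η := by
    intro η hη
    filter_upwards [tot (η / 2) (half_pos hη), S0.Elow (half_pos hη)] with n h1 h2
    rw [split] at h1
    linarith
  obtain ⟨ρ0, hρ0, hb0⟩ := Metric.isOpen_iff.1 hΩo (x 0) (hx 0)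
  obtain ⟨ρ1, hρ1, hb1⟩ := Metric.isOpen_iff.1 hΩo (x 1) (hx 1)
  have hd : 0 < dist (x 0) (x 1) := dist_pos.2 hxne
  obtain ⟨ρ, hρ, hρ'⟩ : ∃ ρ > 0, 2 * ρ ≤ ρ0 ∧ 2 * ρ ≤ ρ1 ∧ 4 * ρ ≤ dist (x 0) (x 1) ∧ ρ < 2 * R1 := by
    refine ⟨min (min (ρ0 / 2) (ρ1 / 2)) (min (dist (x 0) (x 1) / 4) R1), by positivity, ?_⟩
    have h1 := min_le_left (min (ρ0 / 2) (ρ1 / 2)) (min (dist (x 0) (x 1) / 4) R1)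
    have h2 := min_le_right (min (ρ0 / 2) (ρ1 / 2)) (min (dist (x 0) (x 1) / 4) R1)
    have h3 := min_le_left (ρ0 / 2) (ρ1 / 2)
    have h4 := min_le_right (ρ0 / 2) (ρ1 / 2)
    have h5 := min_le_left (dist (x 0) (x 1) / 4) R1
    have h6 := min_le_right (dist (x 0) (x 1) / 4) R1
    refine ⟨?_, ?_, ?_, ?_⟩ <;> linarith
  obtain ⟨r0, r1, r2, r3⟩ := hρ'
  have B0 : ball (x 0) (2 * ρ) ⊆ Ω := (ball_subset_ball r0).trans hb0
  have B1 : ball (x 1) (2 * ρ) ⊆ Ω := (ball_subset_ball r1).trans hb1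
  have F0 : ∀ᶠ n in atTop, ∀ y ∈ ball (x 0) ρ, -u n y ≤ 1 / 2 := S1.far E1 hρ r3 B0 B1 r2
  have F1 : ∀ᶠ n in atTop, ∀ y ∈ ball (x 1) ρ, u n y ≤ 1 / 2 :=
    S0.far E0 hρ r3 B1 B0 (by rwa [dist_comm])
  have sub : ∀ y : E2, ball y ρ ⊆ ball y (2 * ρ) := fun y => ball_subset_ball (by linarith)
  have bξ : ∀ n, ∀ y ∈ Ω, |ξ n y| ≤ 1 := fun n y hy => (hξnorm n).1 y (subset_closure hy)
  obtain ⟨φ0, hφ0, a0, b0, T0⟩ := side_lim S0 hρ ((sub _).trans B0) F0 (tot 1 one_pos)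
    (fun n => (hξreg n).1) hξeq bξ
  obtain ⟨φ1, hφ1, a1, b1, T1⟩ := side_lim (S1.sub hφ0) hρ ((sub _).trans B1)
    (hφ0.tendsto_atTop.eventually F1 |>.mono
      fun n (hn : ∀ y ∈ ball (x 1) ρ, u (φ0 n) y ≤ 1 / 2) y hy => by rw [neg_neg]; exact hn y hy)
    (C := 16 * π * Real.exp 1 + 1)
    (hφ0.tendsto_atTop.eventually (tot 1 one_pos) |>.mono
      fun n (hn : p (φ0 n) * ∫ x in Ω, |u (φ0 n) x| ^ (p (φ0 n) + 1) ≤ 16 * π * Real.exp 1 + 1) => by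
        simpa only [abs_neg] using hn)
    (ξ := fun n => ξ (φ0 n)) (fun n => (hξreg _).1)
    (fun n y hy => by rw [abs_neg]; exact hξeq _ y hy) (fun n => bξ _)
  refine ⟨fun n => φ0 (φ1 n), hφ0.comp hφ1, ![a0, a1], ![b0, b1], ?_⟩
  rw [Fin.forall_fin_two]
  exact ⟨C2_sub T0 hφ1, T1⟩

end
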